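/- Existence with Hölder continuous coefficients: Suppose p ∈ (1, ∞) when n = 2, and p ∈ (1, n/(n−2)) when n ≥ 3. Assume the coefficients a^{ij}, b^i, c of L are Hölder continuous on Ω with some exponent β ∈ (0,1) (in addition to the standing assumptions). Then there exists at least one function u ∈ C²(Ω) satisfying Lu(x) = (u(x))₊^p for all x ∈ Ω and u(x) → +∞ as d(x) → 0. -/

import Mathlib

open Metric Set Filter Real Bornology

/-- First-order partial derivative `D_i u (x)`. -/
noncomputable def pd {n : ℕ} (u : EuclideanSpace ℝ (Fin n) → ℝ) (i : Fin n)
    (x : EuclideanSpace ℝ (Fin n)) : ℝ :=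
  fderiv ℝ u x (EuclideanSpace.single i 1)

/-- Second-order partial derivative `D_{ij} u (x)`. -/
noncomputable def pd2 {n : ℕ} (u : EuclideanSpace ℝ (Fin n) → ℝ) (i j : Fin n)
    (x : EuclideanSpace ℝ (Fin n)) : ℝ :=
  fderiv ℝ (fun y => fderiv ℝ u y (EuclideanSpace.single j 1)) x (EuclideanSpace.single i 1)

/-- The operator `L u = a^{ij} D_{ij} u + b^i D_i u - c u`. -/
noncomputable def Lop {n : ℕ} (a : EuclideanSpace ℝ (Fin n) → Fin n → Fin n → ℝ)
    (b : EuclideanSpace ℝ (Fin n) → Fin n → ℝ) (c : EuclideanSpace ℝ (Fin n) → ℝ)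
    (u : EuclideanSpace ℝ (Fin n) → ℝ) (x : EuclideanSpace ℝ (Fin n)) : ℝ :=
  (∑ i, ∑ j, a x i j * pd2 u i j x) + (∑ i, b x i * pd u i x) - c x * u x

/-- The standing assumptions on the coefficients of `L`: measurability, symmetry,
`Σ (b^i)² ≤ K`, `0 ≤ c ≤ K`, `K > 0`, and uniform ellipticity `λ|ξ|² ≤ aᵢⱼξᵢξⱼ ≤ Λ|ξ|²`
with `0 < λ ≤ Λ`. -/
def CoeffsOK {n : ℕ} (a : EuclideanSpace ℝ (Fin n) → Fin n → Fin n → ℝ)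
    (b : EuclideanSpace ℝ (Fin n) → Fin n → ℝ) (c : EuclideanSpace ℝ (Fin n) → ℝ)
    (K lam Lam : ℝ) : Prop :=
  (∀ i j, Measurable fun x => a x i j) ∧ (∀ i, Measurable fun x => b x i) ∧
  Measurable c ∧ (∀ x i j, a x i j = a x j i) ∧
  (∀ x, ∑ i, (b x i) ^ 2 ≤ K) ∧ (∀ x, 0 ≤ c x ∧ c x ≤ K) ∧
  0 < K ∧ 0 < lam ∧ lam ≤ Lam ∧
  (∀ x (ξ : EuclideanSpace ℝ (Fin n)),
    lam * ‖ξ‖ ^ 2 ≤ ∑ i, ∑ j, a x i j * ξ i * ξ j ∧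
    ∑ i, ∑ j, a x i j * ξ i * ξ j ≤ Lam * ‖ξ‖ ^ 2)

/-- `u(x) → +∞` as `d(x) := dist(x, ∂Ω) → 0`. -/
def BlowsUp {n : ℕ} (Ω : Set (EuclideanSpace ℝ (Fin n)))
    (u : EuclideanSpace ℝ (Fin n) → ℝ) : Prop :=
  ∀ M : ℝ, ∃ δ > 0, ∀ x ∈ Ω, infDist x (frontier Ω) < δ → M ≤ u x

open scoped ContDiff
set_option maxSynthPendingDepth 3

abbrev ES (n : ℕ) := EuclideanSpace ℝ (Fin n)

noncomputable def D2 {n : ℕ} (u : ES n → ℝ) (x : ES n) : ES n →L[ℝ] ES n →L[ℝ] ℝ :=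
  fderiv ℝ (fderiv ℝ u) x

noncomputable def ee {n : ℕ} (i : Fin n) : ES n := EuclideanSpace.single i 1

noncomputable def tr {n : ℕ} (A : Fin n → Fin n → ℝ) (H : ES n →L[ℝ] ES n →L[ℝ] ℝ) : ℝ :=
  ∑ i, ∑ j, A i j * H (ee i) (ee j)

section calc1
variable {n : ℕ}

lemma tr_add (A : Fin n → Fin n → ℝ) (H H' : ES n →L[ℝ] ES n →L[ℝ] ℝ) :
    tr A (H + H') = tr A H + tr A H' := by
  simp [tr, mul_add, Finset.sum_add_distrib]

lemma tr_sub (A : Fin n → Fin n → ℝ) (H H' : ES n →L[ℝ] ES n →L[ℝ] ℝ) :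
    tr A (H - H') = tr A H - tr A H' := by
  simp [tr, mul_sub, Finset.sum_sub_distrib]

lemma tr_smul (A : Fin n → Fin n → ℝ) (r : ℝ) (H : ES n →L[ℝ] ES n →L[ℝ] ℝ) :
    tr A (r • H) = r * tr A H := by
  simp only [tr, Finset.mul_sum]
  refine Finset.sum_congr rfl fun i _ => Finset.sum_congr rfl fun j _ => ?_
  simp; ring

lemma norm_ee (i : Fin n) : ‖(ee i : ES n)‖ = 1 := by simp [ee]

lemma ee_apply (i j : Fin n) : (ee i : ES n) j = if j = i then 1 else 0 := by
  simp [ee]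

lemma sum_ee (x : ES n) : ∑ i, x i • (ee i : ES n) = x := by
  ext j; simp [ee_apply]

lemma abs_H_le (H : ES n →L[ℝ] ES n →L[ℝ] ℝ) (ξ η : ES n) : |H ξ η| ≤ ‖H‖ * ‖ξ‖ * ‖η‖ := by
  simpa using H.le_opNorm₂ ξ η

lemma abs_tr_le (A : Fin n → Fin n → ℝ) (B : ℝ) (hA : ∀ i j, |A i j| ≤ B)
    (H : ES n →L[ℝ] ES n →L[ℝ] ℝ) : |tr A H| ≤ (n : ℝ) ^ 2 * B * ‖H‖ := by
  have h : ∀ i j, |A i j * H (ee i) (ee j)| ≤ B * ‖H‖ := by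
    intro i j
    rw [abs_mul]
    have := abs_H_le H (ee i) (ee j)
    rw [norm_ee, norm_ee] at this
    have hB : 0 ≤ B := (abs_nonneg _).trans (hA i j)
    exact mul_le_mul (hA i j) (by linarith) (abs_nonneg _) hB
  calc |tr A H| ≤ ∑ i, ∑ j, |A i j * H (ee i) (ee j)| := by
        refine (Finset.abs_sum_le_sum_abs _ _).trans ?_
        exact Finset.sum_le_sum fun i _ => Finset.abs_sum_le_sum_abs _ _
    _ ≤ ∑ i : Fin n, ∑ j : Fin n, B * ‖H‖ :=
        Finset.sum_le_sum fun i _ => Finset.sum_le_sum fun j _ => h i j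
    _ = _ := by simp; ring

lemma tr_subA (A B : Fin n → Fin n → ℝ) (H : ES n →L[ℝ] ES n →L[ℝ] ℝ) :
    tr (fun i j => A i j - B i j) H = tr A H - tr B H := by
  simp [tr, sub_mul, Finset.sum_sub_distrib]

lemma tr_addA (A B : Fin n → Fin n → ℝ) (H : ES n →L[ℝ] ES n →L[ℝ] ℝ) :
    tr (fun i j => A i j + B i j) H = tr A H + tr B H := by
  simp [tr, add_mul, Finset.sum_add_distrib]

lemma tr_smulA (r : ℝ) (A : Fin n → Fin n → ℝ) (H : ES n →L[ℝ] ES n →L[ℝ] ℝ) :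
    tr (fun i j => r * A i j) H = r * tr A H := by
  simp [tr, mul_assoc, Finset.mul_sum]

open scoped MatrixOrder in
lemma sqrt_exists (A : Fin n → Fin n → ℝ) (lam Lam : ℝ) (hl : 0 < lam)
    (hs : ∀ i j, A i j = A j i)
    (he : ∀ ξ : ES n, lam * ‖ξ‖ ^ 2 ≤ ∑ i, ∑ j, A i j * ξ i * ξ j ∧
      ∑ i, ∑ j, A i j * ξ i * ξ j ≤ Lam * ‖ξ‖ ^ 2) :
    ∃ σ : ES n ≃L[ℝ] ES n, (∀ H : ES n →L[ℝ] ES n →L[ℝ] ℝ,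
        tr A H = ∑ k, H (σ (ee k)) (σ (ee k))) ∧
      ∀ ξ, lam * ‖ξ‖ ^ 2 ≤ ‖σ ξ‖ ^ 2 ∧ ‖σ ξ‖ ^ 2 ≤ Lam * ‖ξ‖ ^ 2 := by
  set M : Matrix (Fin n) (Fin n) ℝ := Matrix.of A with hM
  have hherm : M.IsHermitian := by
    ext i j; simp [hM, hs i j]
  have hpsd : M.PosSemidef := by
    refine Matrix.PosSemidef.of_dotProduct_mulVec_nonneg hherm ?_
    intro x
    have := (he (WithLp.toLp 2 x)).1
    have h2 : 0 ≤ ∑ i, ∑ j, A i j * x i * x j := le_trans (by positivity) this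
    refine le_of_le_of_eq h2 ?_
    simp only [dotProduct, Matrix.mulVec, hM, Matrix.of_apply, Finset.mul_sum]
    refine Finset.sum_congr rfl fun i _ => Finset.sum_congr rfl fun j _ => ?_
    simp only [Pi.star_apply, star_trivial]; ring
  set S := CFC.sqrt M with hS
  have hSS : S * S = M := CFC.sqrt_mul_sqrt_self M hpsd.nonneg
  have hSh : S.IsHermitian := (Matrix.nonneg_iff_posSemidef.mp (CFC.sqrt_nonneg M)).isHermitian
  have hSs : ∀ i j, S i j = S j i := by
    intro i j
    have := congrFun (congrFun hSh j) i
    simpa using this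
  have hA : ∀ i j, A i j = ∑ k, S i k * S j k := by
    intro i j
    have := congrFun (congrFun hSS i) j
    simp only [Matrix.mul_apply, hM, Matrix.of_apply] at this
    rw [← this]
    exact Finset.sum_congr rfl fun k _ => by rw [hSs k j]
  let T : ES n →ₗ[ℝ] ES n := Matrix.toEuclideanLin S
  have hT : ∀ ξ i, (T ξ) i = ∑ k, S i k * ξ k := by
    intro ξ i
    simp [T, Matrix.toEuclideanLin, Matrix.mulVec, dotProduct]
  have hnorm : ∀ ξ, ‖T ξ‖ ^ 2 = ∑ i, ∑ j, A i j * ξ i * ξ j := by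
    intro ξ
    rw [EuclideanSpace.norm_sq_eq]
    simp only [hT, Real.norm_eq_abs, sq_abs, hA]
    simp only [sq, Finset.sum_mul, Finset.mul_sum]
    rw [Finset.sum_comm]
    refine Finset.sum_congr rfl fun i _ => ?_
    rw [Finset.sum_comm]
    refine Finset.sum_congr rfl fun j _ => Finset.sum_congr rfl fun k _ => ?_
    rw [hSs k i, hSs k j]; ring
  have hinj : Function.Injective T := by
    rw [← LinearMap.ker_eq_bot, LinearMap.ker_eq_bot']
    intro ξ h
    have h1 := (he ξ).1
    rw [← hnorm, h] at h1
    simp at h1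
    have h3 : ‖ξ‖ ^ 2 ≤ 0 := by
      by_contra hc
      push Not at hc
      have := mul_pos hl hc
      linarith
    have : ‖ξ‖ = 0 := by nlinarith [norm_nonneg ξ]
    simpa using this
  let σ : ES n ≃L[ℝ] ES n := (LinearEquiv.ofInjectiveEndo T hinj).toContinuousLinearEquiv
  have hσ : ∀ ξ, σ ξ = T ξ := fun ξ => rfl
  refine ⟨σ, ?_, ?_⟩
  · intro H
    have hcol : ∀ k, σ (ee k) = ∑ i, S i k • (ee i : ES n) := by
      intro k
      rw [hσ]
      ext i
      simp [hT, ee_apply]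
    simp only [hcol, map_sum, map_smul, tr, hA]
    simp only [_root_.sum_apply, _root_.smul_apply, smul_eq_mul,
      Finset.sum_mul, Finset.mul_sum]
    rw [Finset.sum_comm]
    conv_rhs => rw [Finset.sum_comm]
    refine Finset.sum_congr rfl fun j _ => ?_
    conv_rhs => rw [Finset.sum_comm]
    refine Finset.sum_congr rfl fun i _ => Finset.sum_congr rfl fun k _ => ?_
    ring
  · intro ξ
    rw [hσ, hnorm]
    exact he ξ

lemma diff_fderiv {u : ES n → ℝ} {x : ES n} (h : ContDiffAt ℝ 2 u x) :
    DifferentiableAt ℝ (fderiv ℝ u) x :=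
  (h.fderiv_right (m := 1) (by norm_num)).differentiableAt (by norm_num)

lemma D2_symm {u : ES n → ℝ} {x : ES n} (h : ContDiffAt ℝ 2 u x) (ξ η : ES n) :
    D2 u x ξ η = D2 u x η ξ := by
  have := h.isSymmSndFDerivAt (by simp)
  exact this ξ η

lemma D2_eq_dir {u : ES n → ℝ} {x : ES n} (h : ContDiffAt ℝ 2 u x) (ξ η : ES n) :
    D2 u x ξ η = fderiv ℝ (fun y => fderiv ℝ u y η) x ξ := by
  rw [D2, fderiv_clm_apply (diff_fderiv h) (by fun_prop)]
  simp

lemma Lop_eq {a : ES n → Fin n → Fin n → ℝ} {b : ES n → Fin n → ℝ} {c : ES n → ℝ}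
    {u : ES n → ℝ} {x : ES n} (h : ContDiffAt ℝ 2 u x) :
    Lop a b c u x = tr (a x) (D2 u x) + (∑ i, b x i * fderiv ℝ u x (ee i)) - c x * u x := by
  simp only [Lop, tr, pd2, pd]
  congr 2
  refine Finset.sum_congr rfl fun i _ => Finset.sum_congr rfl fun j _ => ?_
  rw [D2_eq_dir h]; rfl

lemma D2_comp {q : ES n → ℝ} {F : ℝ → ℝ} {x : ES n} (hq : ContDiffAt ℝ 2 q x)
    (hF : ContDiffAt ℝ 2 F (q x)) :
    ContDiffAt ℝ 2 (fun y => F (q y)) x ∧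
    (fderiv ℝ (fun y => F (q y)) x = deriv F (q x) • fderiv ℝ q x) ∧
    ∀ ξ η, D2 (fun y => F (q y)) x ξ η =
      deriv (deriv F) (q x) * (fderiv ℝ q x ξ * fderiv ℝ q x η) + deriv F (q x) * D2 q x ξ η := by
  have h1 : ∀ᶠ y in nhds x, ContDiffAt ℝ 2 q y := hq.eventually (by simp)
  have h2 : ∀ᶠ y in nhds x, ContDiffAt ℝ 2 F (q y) :=
    hq.continuousAt.eventually (hF.eventually (by simp))
  have h3 : fderiv ℝ (fun y => F (q y)) =ᶠ[nhds x] fun y => deriv F (q y) • fderiv ℝ q y := by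
    filter_upwards [h1, h2] with y hy1 hy2
    have := (hy2.differentiableAt (by norm_num)).hasDerivAt.comp_hasFDerivAt y
      (hy1.differentiableAt (by norm_num)).hasFDerivAt
    exact this.fderiv
  refine ⟨hF.comp x hq, h3.self_of_nhds, ?_⟩
  intro ξ η
  rw [D2, h3.fderiv_eq]
  have hd : DifferentiableAt ℝ (deriv F) (q x) := by
    have : ContDiffAt ℝ 1 (deriv F) (q x) := by
      have h := (hF.fderiv_right (m := 1) (by norm_num))
      have h' : ContDiffAt ℝ 1 (fun t => fderiv ℝ F t 1) (q x) := h.clm_apply contDiffAt_const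
      exact h'
    exact this.differentiableAt (by norm_num)
  have h4 := (hd.hasDerivAt.comp_hasFDerivAt x
      (hq.differentiableAt (by norm_num)).hasFDerivAt).smul (diff_fderiv hq).hasFDerivAt
  have h5 := h4.fderiv
  simp only [Function.comp_def] at h5
  have h6 : fderiv ℝ (fun y => deriv F (q y) • fderiv ℝ q y) x = _ := h5
  rw [h6]
  simp [D2]
  ring

lemma D2_affine {u : ES n → ℝ} (hu : ContDiff ℝ 2 u) (x : ES n) (S : ES n →L[ℝ] ES n) :
    ContDiff ℝ 2 (fun z => u (x + S z)) ∧
    (∀ z ξ, fderiv ℝ (fun z => u (x + S z)) z ξ = fderiv ℝ u (x + S z) (S ξ)) ∧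
    ∀ z ξ η, D2 (fun z => u (x + S z)) z ξ η = D2 u (x + S z) (S ξ) (S η) := by
  have hS : ∀ z, HasFDerivAt (fun z => x + S z) S z := fun z => S.hasFDerivAt.const_add x
  have h0 : ContDiff ℝ 2 (fun z => u (x + S z)) := hu.comp (by fun_prop)
  have h1 : fderiv ℝ (fun z => u (x + S z)) = fun z => (fderiv ℝ u (x + S z)).comp S := by
    ext1 z
    exact (((hu.differentiable (by norm_num)) _).hasFDerivAt.comp z (hS z)).fderiv
  refine ⟨h0, fun z ξ => by rw [h1]; rfl, fun z ξ η => ?_⟩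
  rw [D2_eq_dir h0.contDiffAt, h1]
  have h2 : HasFDerivAt (fun y => fderiv ℝ u y (S η)) (fderiv ℝ (fun y => fderiv ℝ u y (S η))
      (x + S z)) (x + S z) := by
    apply DifferentiableAt.hasFDerivAt
    exact (diff_fderiv hu.contDiffAt).clm_apply (by fun_prop)
  have h3 := (h2.comp z (hS z)).fderiv
  simp only [ContinuousLinearMap.comp_apply]
  rw [D2_eq_dir hu.contDiffAt]
  have h4 : fderiv ℝ (fun y => (fderiv ℝ u (x + S y)) (S η)) z = _ := h3
  rw [h4]; rfl

lemma max_test {w : ES n → ℝ} {x : ES n} (hw : ContDiffAt ℝ 2 w x) (hm : IsLocalMax w x) :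
    fderiv ℝ w x = 0 ∧ ∀ ξ, D2 w x ξ ξ ≤ 0 := by
  refine ⟨hm.fderiv_eq_zero, fun ξ => ?_⟩
  by_contra hc
  push Not at hc
  set g : ℝ → ℝ := fun t => w (x + t • ξ) with hg
  have hl : ∀ t, HasDerivAt (fun t : ℝ => x + t • ξ) ξ t := by
    intro t
    simpa using ((hasDerivAt_id t).smul_const ξ).const_add x
  have hc0 : ContinuousAt (fun t : ℝ => x + t • ξ) 0 := (hl 0).continuousAt
  have h00 : x + (0 : ℝ) • ξ = x := by simp
  have hev : ∀ᶠ t in nhds (0 : ℝ), ContDiffAt ℝ 2 w (x + t • ξ) := by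
    have := hw.eventually (by simp)
    rw [← h00] at this
    exact hc0.eventually this
  have hd : deriv g =ᶠ[nhds 0] fun t => fderiv ℝ w (x + t • ξ) ξ := by
    filter_upwards [hev] with t ht
    exact ((ht.differentiableAt (by norm_num)).hasFDerivAt.comp_hasDerivAt t (hl t)).deriv
  have hdd : deriv (deriv g) 0 = D2 w x ξ ξ := by
    rw [hd.deriv_eq]
    have h1 : HasFDerivAt (fun y => fderiv ℝ w y ξ) (fderiv ℝ (fun y => fderiv ℝ w y ξ) x) x :=
      ((diff_fderiv hw).clm_apply (by fun_prop)).hasFDerivAt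
    rw [D2_eq_dir hw]
    rw [← h00] at h1
    have := (h1.comp_hasDerivAt (0:ℝ) (hl 0)).deriv
    rw [h00] at this
    exact this
  have hmg : IsLocalMax g 0 := by
    have : IsLocalMax w (x + (0:ℝ) • ξ) := by rw [h00]; exact hm
    exact IsLocalMax.comp_continuous (g := fun t : ℝ => x + t • ξ) this hc0
  have hgc : ContinuousAt g 0 := by
    have h1 : ContinuousAt w (x + (0:ℝ) • ξ) := by rw [h00]; exact hw.continuousAt
    exact ContinuousAt.comp (f := fun t : ℝ => x + t • ξ) h1 hc0
  have hmin : IsLocalMin g 0 := by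
    apply isLocalMin_of_deriv_deriv_pos
    · rw [hdd]; exact hc
    · exact hmg.deriv_eq_zero
    · exact hgc
  have heq : g =ᶠ[nhds 0] fun _ => g 0 := by
    filter_upwards [hmg, hmin] with t h1 h2
    exact le_antisymm h1 h2
  have h7 : deriv g =ᶠ[nhds 0] fun _ => 0 := by
    have := heq.deriv
    simpa using this
  have h8 : deriv (deriv g) 0 = 0 := by rw [h7.deriv_eq]; simp
  rw [hdd] at h8
  linarith

lemma tr_nonpos {A : Fin n → Fin n → ℝ} {lam Lam : ℝ} (hl : 0 < lam)
    (hs : ∀ i j, A i j = A j i)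
    (he : ∀ ξ : ES n, lam * ‖ξ‖ ^ 2 ≤ ∑ i, ∑ j, A i j * ξ i * ξ j ∧
      ∑ i, ∑ j, A i j * ξ i * ξ j ≤ Lam * ‖ξ‖ ^ 2)
    {H : ES n →L[ℝ] ES n →L[ℝ] ℝ} (hH : ∀ ξ, H ξ ξ ≤ 0) : tr A H ≤ 0 := by
  obtain ⟨σ, h1, -⟩ := sqrt_exists A lam Lam hl hs he
  rw [h1]
  exact Finset.sum_nonpos fun k _ => hH _

end calc1

section kernel
variable {n : ℕ}

lemma two_le_infty : (2 : WithTop ℕ∞) ≤ ∞ := WithTop.coe_le_coe.mpr le_top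

lemma quad_D2 (S : ES n →L[ℝ] ES n) (x0 : ES n) (m : ℝ) :
    ContDiff ℝ ∞ (fun y => ‖S (y - x0)‖ ^ 2 + m) ∧
    (∀ y ξ, fderiv ℝ (fun y => ‖S (y - x0)‖ ^ 2 + m) y ξ = 2 * inner ℝ (S (y - x0)) (S ξ)) ∧
    ∀ y ξ η, D2 (fun y => ‖S (y - x0)‖ ^ 2 + m) y ξ η = 2 * inner ℝ (S ξ) (S η) := by
  have hS : ∀ y, HasFDerivAt (fun y => S (y - x0)) S y := fun y =>
    (S.hasFDerivAt.comp y ((hasFDerivAt_id y).sub_const x0))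
  have h1 : ∀ y, HasFDerivAt (fun y => ‖S (y - x0)‖ ^ 2 + m)
      (2 • (innerSL ℝ (S (y - x0))).comp S) y := fun y => ((hS y).norm_sq).add_const m
  have h2 : ∀ y ξ, fderiv ℝ (fun y => ‖S (y - x0)‖ ^ 2 + m) y ξ
      = 2 * inner ℝ (S (y - x0)) (S ξ) := by
    intro y ξ; rw [(h1 y).fderiv]; simp [inner_sub_left]
  have h0 : ContDiff ℝ ∞ (fun y => ‖S (y - x0)‖ ^ 2 + m) := by
    have : ContDiff ℝ ∞ (fun y => S (y - x0)) := by fun_prop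
    exact (this.norm_sq ℝ).add contDiff_const
  refine ⟨h0, h2, ?_⟩
  intro y ξ η
  rw [D2_eq_dir (h0.of_le two_le_infty).contDiffAt]
  simp only [h2]
  have h3 : HasFDerivAt (fun y => 2 * inner ℝ (S (y - x0)) (S η)) _ y :=
    ((hS y).inner ℝ (hasFDerivAt_const (S η) y)).const_mul 2
  rw [h3.fderiv]; simp

noncomputable def lap (v : ES n → ℝ) (x : ES n) : ℝ := ∑ k, D2 v x (ee k) (ee k)

lemma inner_ee (x : ES n) (k : Fin n) : inner ℝ x (ee k) = x k := by
  rw [ee, EuclideanSpace.inner_single_right]; simp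

lemma smooth_cut (r c : ℝ) (hc : 0 < c) (D : ℝ → ℝ) (hD : ContDiff ℝ ∞ D)
    (h0 : ∀ t < c, D t = 0) : ContDiff ℝ ∞ (fun t => t ^ r * D t) := by
  rw [contDiff_iff_contDiffAt]
  intro t
  rcases lt_or_ge t c with h | h
  · have : (fun t => t ^ r * D t) =ᶠ[nhds t] fun _ => 0 := by
      filter_upwards [Iio_mem_nhds h] with s hs
      simp [h0 s hs]
    exact contDiffAt_const.congr_of_eventuallyEq this
  · exact (Real.contDiffAt_rpow_const_of_ne (by linarith)).mul hD.contDiffAt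

/-- transition functions -/
noncomputable def Tr (r : ℝ) (s : ℝ) : ℝ := Real.smoothTransition ((s - r ^ 2 / 4) / (3 * r ^ 2 / 4))

lemma Tr_smooth (r : ℝ) : ContDiff ℝ ∞ (Tr r) := by
  have : ContDiff ℝ ∞ (fun s : ℝ => (s - r ^ 2 / 4) / (3 * r ^ 2 / 4)) := by fun_prop
  exact Real.smoothTransition.contDiff.comp this

lemma Tr_zero {r s : ℝ} (hr : 0 < r) (h : s ≤ r ^ 2 / 4) : Tr r s = 0 := by
  apply Real.smoothTransition.zero_of_nonpos
  exact div_nonpos_of_nonpos_of_nonneg (by linarith) (by positivity)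

lemma Tr_one {r s : ℝ} (hr : 0 < r) (h : r ^ 2 ≤ s) : Tr r s = 1 := by
  apply Real.smoothTransition.one_of_one_le
  rw [le_div_iff₀ (by positivity)]
  linarith

lemma Tr_mono {r : ℝ} (hr : 0 < r) : Monotone (Tr r) := by
  intro s t h
  apply Real.smoothTransition.monotone
  gcongr

lemma dTr_zero {r s : ℝ} (hr : 0 < r) (h : s < r ^ 2 / 4) : deriv (Tr r) s = 0 := by
  have : Tr r =ᶠ[nhds s] fun _ => 0 := by
    filter_upwards [Iio_mem_nhds h] with t ht
    exact Tr_zero hr (le_of_lt ht)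
  rw [this.deriv_eq]; simp

lemma dTr_smooth (r : ℝ) : ContDiff ℝ ∞ (deriv (Tr r)) := by
  have := Tr_smooth r
  rw [contDiff_infty_iff_deriv] at this
  exact this.2

lemma dTr_zero' {r s : ℝ} (hr : 0 < r) (h : r ^ 2 ≤ s) : deriv (Tr r) s = 0 := by
  have h1 : ∀ t ∈ Ioi (r ^ 2), deriv (Tr r) t = 0 := by
    intro t ht
    have : Tr r =ᶠ[nhds t] fun _ => 1 := by
      filter_upwards [Ioi_mem_nhds ht] with z hz
      exact Tr_one hr (le_of_lt hz)
    rw [this.deriv_eq]; simp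
  have h2 : s ∈ closure (Ioi (r ^ 2)) := by rw [closure_Ioi]; exact h
  have hcl : IsClosed {t | deriv (Tr r) t = 0} :=
    isClosed_eq (dTr_smooth r).continuous continuous_const
  exact hcl.closure_subset_iff.mpr h1 h2

/-- radial kernels -/
noncomputable def phr (n : ℕ) (r : ℝ) (x : ES n) : ℝ :=
  (‖x‖ ^ 2) ^ (1 - (n : ℝ) / 2) * deriv (Tr r) (‖x‖ ^ 2)

lemma phr_smooth {r : ℝ} (hr : 0 < r) : ContDiff ℝ ∞ (phr n r) := by
  have h := smooth_cut (1 - (n : ℝ) / 2) (r ^ 2 / 4) (by positivity) (deriv (Tr r))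
    (dTr_smooth r) (fun t ht => dTr_zero hr ht)
  have h2 : ContDiff ℝ ∞ (fun x : ES n => ‖x‖ ^ 2) := contDiff_norm_sq ℝ
  exact h.comp h2

lemma phr_nonneg {r : ℝ} (hr : 0 < r) (x : ES n) : 0 ≤ phr n r x :=
  mul_nonneg (by positivity) ((Tr_mono hr).deriv_nonneg)

lemma phr_zero {r : ℝ} (hr : 0 < r) (x : ES n) (hx : r ≤ ‖x‖) : phr n r x = 0 := by
  rw [phr, dTr_zero' hr (by gcongr), mul_zero]

lemma phr_ne (hn : 0 < n) : phr n 1 ≠ 0 := by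
  intro h
  have h1 : ∀ s : ℝ, 0 < s → deriv (Tr 1) s = 0 := by
    intro s hs
    have := congrFun h (Real.sqrt s • ee ⟨0, hn⟩)
    rw [phr, norm_smul, norm_ee] at this
    simp only [Real.norm_eq_abs, mul_one, sq_abs, Real.sq_sqrt hs.le, Pi.zero_apply] at this
    have h3 : s ^ (1 - (n : ℝ) / 2) ≠ 0 := (Real.rpow_pos_of_pos hs _).ne'
    exact (mul_eq_zero.mp this).resolve_left h3
  have h2 : ∀ s, deriv (Tr 1) s = 0 := by
    intro s
    rcases lt_or_ge 0 s with h | h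
    · exact h1 s h
    · exact dTr_zero one_pos (by linarith)
  have h3 := is_const_of_deriv_eq_zero ((Tr_smooth 1).differentiable (by simp)) h2 0 1
  rw [Tr_zero one_pos (by norm_num), Tr_one one_pos (by norm_num)] at h3
  norm_num at h3

lemma chi_exists {ε : ℝ} (h0 : 0 < ε) (h1 : ε < 1) : ∃ χ : ES n → ℝ, ContDiff ℝ ∞ χ ∧
    (∀ x, 1 ≤ ‖x‖ → χ x = 0) ∧ ∀ x, lap χ x = phr n ε x - phr n 1 x := by
  have hee : ε ^ 2 < 1 := by nlinarith
  set D : ℝ → ℝ := fun t => Tr ε t - Tr 1 t with hD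
  have hDs : ContDiff ℝ ∞ D := (Tr_smooth ε).sub (Tr_smooth 1)
  have hD0 : ∀ t < ε ^ 2 / 4, D t = 0 := fun t ht => by
    simp [hD, Tr_zero h0 ht.le, Tr_zero one_pos (show t ≤ 1 ^ 2 / 4 by linarith)]
  have hD1 : ∀ t, 1 ≤ t → D t = 0 := fun t ht => by
    simp [hD, Tr_one h0 (show ε ^ 2 ≤ t by linarith), Tr_one one_pos (show 1 ^ 2 ≤ t by linarith)]
  set κ : ℝ → ℝ := fun t => 1 / 4 * (t ^ (-((n : ℝ) / 2)) * D t) with hκ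
  have hκs : ContDiff ℝ ∞ κ :=
    contDiff_const.mul (smooth_cut _ (ε ^ 2 / 4) (by positivity) D hDs hD0)
  set k : ℝ → ℝ := fun s => ∫ t in (1:ℝ)..s, κ t with hk
  have hkd : ∀ s, HasDerivAt k (κ s) s := fun s =>
    intervalIntegral.integral_hasDerivAt_right (hκs.continuous.intervalIntegrable _ _)
      (hκs.continuous.stronglyMeasurableAtFilter _ _) hκs.continuous.continuousAt
  have hkdd : deriv k = κ := funext fun s => (hkd s).deriv
  have hks : ContDiff ℝ ∞ k := by
    rw [contDiff_infty_iff_deriv]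
    exact ⟨fun s => (hkd s).differentiableAt, by rw [hkdd]; exact hκs⟩
  have hode : ∀ t, 0 ≤ t → 4 * t * deriv κ t + 2 * n * κ t
      = t ^ (1 - (n : ℝ) / 2) * (deriv (Tr ε) t - deriv (Tr 1) t) := by
    intro t ht
    rcases lt_or_ge t (ε ^ 2 / 4) with h | h
    · have : κ =ᶠ[nhds t] fun _ => 0 := by
        filter_upwards [Iio_mem_nhds h] with s hs
        simp [hκ, hD0 s hs]
      rw [this.deriv_eq, dTr_zero h0 h, dTr_zero one_pos (by linarith), this.self_of_nhds]
      simp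
    · have htp : 0 < t := lt_of_lt_of_le (by positivity) h
      have hd1 : HasDerivAt D (deriv (Tr ε) t - deriv (Tr 1) t) t :=
        ((Tr_smooth ε).differentiable (by simp) t).hasDerivAt.sub
          ((Tr_smooth 1).differentiable (by simp) t).hasDerivAt
      have hd2 : HasDerivAt (fun t : ℝ => t ^ (-((n : ℝ) / 2)))
          (-((n : ℝ) / 2) * t ^ (-((n : ℝ) / 2) - 1)) t :=
        Real.hasDerivAt_rpow_const (Or.inl htp.ne')
      have hd3 := ((hd2.mul hd1).const_mul (1 / 4)).deriv
      have hd4 : deriv κ t = _ := hd3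
      rw [hd4]
      simp only [hκ]
      rw [Real.rpow_sub htp, Real.rpow_sub htp, Real.rpow_neg htp.le, Real.rpow_one]
      have : t ^ ((n : ℝ) / 2) ≠ 0 := (Real.rpow_pos_of_pos htp _).ne'
      field_simp
      ring
  refine ⟨fun x => k (‖x‖ ^ 2), hks.comp (contDiff_norm_sq ℝ), ?_, ?_⟩
  · intro x hx
    have hx2 : 1 ≤ ‖x‖ ^ 2 := one_le_pow₀ hx
    simp only [hk]
    rw [intervalIntegral.integral_congr (g := fun _ => 0)]
    · simp
    · intro t ht
      rw [uIcc_of_le hx2] at ht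
      simp [hκ, hD1 t ht.1]
  · intro x
    obtain ⟨q0, q1, q2⟩ := quad_D2 (ContinuousLinearMap.id ℝ (ES n)) 0 0
    simp only [ContinuousLinearMap.id_apply, sub_zero, add_zero] at q0 q1 q2
    have hc := (D2_comp (F := k) (q := fun y : ES n => ‖y‖ ^ 2) (x := x)
      (q0.of_le two_le_infty).contDiffAt
      (hks.of_le two_le_infty).contDiffAt).2.2
    simp only [lap, hc, q1, q2, hkdd]
    have hx := hode (‖x‖ ^ 2) (by positivity)
    have hsum : ∑ k, x k * x k = ‖x‖ ^ 2 := by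
      rw [EuclideanSpace.norm_sq_eq]
      exact Finset.sum_congr rfl fun k _ => by simp [sq]
    rw [Finset.sum_add_distrib, phr, phr, ← mul_sub, ← hx]
    simp only [inner_ee, real_inner_self_eq_norm_sq, norm_ee]
    rw [← Finset.mul_sum]
    have : ∑ i, 2 * x i * (2 * x i) = 4 * ‖x‖ ^ 2 := by
      rw [← hsum, Finset.mul_sum]
      exact Finset.sum_congr rfl fun k _ => by ring
    rw [this]
    simp
    ring
end kernel

section core
open MeasureTheory
variable {n : ℕ}

structure TF (f : ES n → ℝ) (r : ℝ) : Prop where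
  sm : ContDiff ℝ ∞ f
  z : ∀ x, r < ‖x‖ → f x = 0

lemma TF.dir {f : ES n → ℝ} {r : ℝ} (h : TF f r) (w : ES n) :
    TF (fun x => fderiv ℝ f x w) r := by
  refine ⟨?_, ?_⟩
  · have h1 : ContDiff ℝ ∞ (fderiv ℝ f) := by
      have := h.sm
      rw [contDiff_infty_iff_fderiv] at this
      exact this.2
    exact h1.clm_apply contDiff_const
  · intro x hx
    have : f =ᶠ[nhds x] fun _ => 0 := by
      have ho : IsOpen {x : ES n | r < ‖x‖} := isOpen_lt continuous_const continuous_norm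
      filter_upwards [ho.mem_nhds hx] with y hy
      exact h.z y hy
    rw [this.fderiv_eq]; simp

lemma TF.cs {f : ES n → ℝ} {r : ℝ} (h : TF f r) : HasCompactSupport f := by
  apply HasCompactSupport.intro (isCompact_closedBall (0 : ES n) r)
  intro x hx
  apply h.z
  simpa using hx

lemma TF.integrable_mul {f : ES n → ℝ} {r : ℝ} (h : TF f r) {g : ES n → ℝ} (hg : Continuous g) :
    Integrable (fun x => f x * g x) :=
  (h.sm.continuous.mul hg).integrable_of_hasCompactSupport h.cs.mul_right

lemma TF.integrable {f : ES n → ℝ} {r : ℝ} (h : TF f r) : Integrable f :=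
  h.sm.continuous.integrable_of_hasCompactSupport h.cs

lemma TF.bound {f : ES n → ℝ} {r : ℝ} (h : TF f r) {g : ES n → ℝ} {B : ℝ}
    (hB : ∀ x, ‖x‖ ≤ r → |g x| ≤ B) : |∫ x, f x * g x| ≤ B * ∫ x, |f x| := by
  rw [← integral_const_mul, ← Real.norm_eq_abs]
  apply norm_integral_le_of_norm_le (h.integrable.abs.const_mul B)
  filter_upwards with x
  rw [Real.norm_eq_abs, abs_mul, mul_comm]
  rcases le_or_gt ‖x‖ r with hx | hx
  · exact mul_le_mul_of_nonneg_right (hB x hx) (abs_nonneg _)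
  · simp [h.z x hx]

lemma TF.ibp {f : ES n → ℝ} {r : ℝ} (h : TF f r) {g : ES n → ℝ} (hg : ContDiff ℝ 1 g)
    (w : ES n) : ∫ x, f x * fderiv ℝ g x w = - ∫ x, fderiv ℝ f x w * g x := by
  have hc : Continuous (fun x => fderiv ℝ g x w) :=
    (hg.continuous_fderiv (by norm_num)).clm_apply continuous_const
  exact integral_mul_fderiv_eq_neg_fderiv_mul_of_integrable
    ((h.dir w).integrable_mul hg.continuous) (h.integrable_mul hc)
    (h.integrable_mul hg.continuous)
    (fun x _ => (h.sm.differentiable (by simp)) x)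
    (fun x _ => (hg.differentiable (by norm_num)) x)

lemma cd_dir {v : ES n → ℝ} (hv : ContDiff ℝ 2 v) (η : ES n) :
    ContDiff ℝ 1 (fun x => fderiv ℝ v x η) :=
  (hv.fderiv_right (m := 1) (by norm_num)).clm_apply contDiff_const

lemma cont_D2 {v : ES n → ℝ} (hv : ContDiff ℝ 2 v) : Continuous (D2 v) := by
  have : ContDiff ℝ 1 (fderiv ℝ v) := hv.fderiv_right (m := 1) (by norm_num)
  exact this.continuous_fderiv (by norm_num)

lemma cont_D2' {v : ES n → ℝ} (hv : ContDiff ℝ 2 v) (ξ η : ES n) :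
    Continuous (fun x => D2 v x ξ η) :=
  ((cont_D2 hv).clm_apply continuous_const).clm_apply continuous_const

lemma TF.cd2 {f : ES n → ℝ} {r : ℝ} (h : TF f r) : ContDiff ℝ 2 f := h.sm.of_le two_le_infty

lemma TF.d2 {f : ES n → ℝ} {r : ℝ} (h : TF f r) (ξ η : ES n) : TF (fun x => D2 f x ξ η) r := by
  have := (h.dir η).dir ξ
  convert this using 2
  rw [D2_eq_dir h.cd2.contDiffAt]

lemma TF.comm {f : ES n → ℝ} {r : ℝ} (h : TF f r) (a b : ES n) :
    (fun x => fderiv ℝ (fun y => fderiv ℝ f y a) x b)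
      = fun x => fderiv ℝ (fun y => fderiv ℝ f y b) x a := by
  ext x
  rw [← D2_eq_dir h.cd2.contDiffAt, ← D2_eq_dir h.cd2.contDiffAt, D2_symm h.cd2.contDiffAt]

lemma TF.ibp2 {f : ES n → ℝ} {r : ℝ} (h : TF f r) {v : ES n → ℝ} (hv : ContDiff ℝ 2 v)
    (ξ η : ES n) : ∫ x, f x * D2 v x ξ η = ∫ x, D2 f x ξ η * v x := by
  have h1 := h.ibp (cd_dir hv η) ξ
  have h2 := (h.dir ξ).ibp (hv.of_le (by norm_num)) η
  simp only [D2_eq_dir hv.contDiffAt]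
  rw [h1, h2, neg_neg]
  congr 1; ext x
  rw [D2_symm h.cd2.contDiffAt, D2_eq_dir h.cd2.contDiffAt]

lemma TF.swap {f : ES n → ℝ} {r : ℝ} (h : TF f r) {v : ES n → ℝ} (hv : ContDiff ℝ 2 v)
    (e ξ η : ES n) : ∫ x, D2 f x e e * D2 v x ξ η = ∫ x, D2 f x ξ η * D2 v x e e := by
  rw [(h.d2 e e).ibp2 hv, (h.d2 ξ η).ibp2 hv]
  congr 1; ext x; congr 1
  have c1 : (fun x => D2 f x e e) = fun x => fderiv ℝ (fun y => fderiv ℝ f y e) x e := by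
    ext x; rw [D2_eq_dir h.cd2.contDiffAt]
  have c2 : (fun x => D2 f x ξ η) = fun x => fderiv ℝ (fun y => fderiv ℝ f y η) x ξ := by
    ext x; rw [D2_eq_dir h.cd2.contDiffAt]
  rw [D2_eq_dir (h.d2 e e).cd2.contDiffAt, D2_eq_dir (h.d2 ξ η).cd2.contDiffAt, c1, c2]
  have k1 := ((h.dir e).comm e η)
  have k2 := h.comm e η
  have k3 := ((h.dir η).dir e).comm e ξ
  have k4 := (h.dir η).comm e ξ
  have s1 : (fun y => fderiv ℝ (fun x => fderiv ℝ (fun y => fderiv ℝ f y e) x e) y η)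
    = fun y => fderiv ℝ (fun x => fderiv ℝ (fun y => fderiv ℝ f y η) x e) y e := by
    rw [k1, k2]
  rw [s1, congrFun k3 x, k4]

lemma TF.int_d2 {f : ES n → ℝ} {r : ℝ} (h : TF f r) (ξ η : ES n) : ∫ x, D2 f x ξ η = 0 := by
  have := h.ibp2 (v := fun _ => 1) contDiff_const ξ η
  have h0 : ∀ x, D2 (fun _ : ES n => (1:ℝ)) x = 0 := by
    intro x
    have : fderiv ℝ (fun _ : ES n => (1:ℝ)) = fun _ => 0 := by ext; simp
    rw [D2, this]; simp
  simpa [h0] using this.symm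

lemma TF.lap_swap {f : ES n → ℝ} {r : ℝ} (h : TF f r) {v : ES n → ℝ} (hv : ContDiff ℝ 2 v)
    (ξ η : ES n) : ∫ x, lap f x * D2 v x ξ η = ∫ x, D2 f x ξ η * lap v x := by
  simp only [lap, Finset.sum_mul, Finset.mul_sum]
  rw [integral_finsetSum, integral_finsetSum]
  · exact Finset.sum_congr rfl fun k _ => h.swap hv _ _ _
  · intro k _
    exact (h.d2 ξ η).integrable_mul (cont_D2' hv _ _)
  · intro k _
    exact (h.d2 _ _).integrable_mul (cont_D2' hv _ _)

lemma phr_TF {r : ℝ} (hr : 0 < r) : TF (phr n r) r :=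
  ⟨phr_smooth hr, fun x hx => phr_zero hr x hx.le⟩

lemma cont_lap {v : ES n → ℝ} (hv : ContDiff ℝ 2 v) : Continuous (lap v) := by
  unfold lap
  exact continuous_finsetSum _ fun k _ => cont_D2' hv _ _

lemma TF.d2_bound {f : ES n → ℝ} {r : ℝ} (h : TF f r) :
    ∃ C, 0 ≤ C ∧ ∀ (ξ η : ES n), ∫ x, |D2 f x ξ η| ≤ C * (‖ξ‖ * ‖η‖) := by
  have hz : ∀ x, r < ‖x‖ → D2 f x = 0 := by
    intro x hx
    ext ξ η
    exact (h.d2 ξ η).z x hx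
  obtain ⟨g, hg⟩ : ∃ g : ES n → ℝ, g = fun x => ‖D2 f x‖ := ⟨_, rfl⟩
  have g0 : ∀ x, 0 ≤ g x := fun x => by rw [hg]; exact norm_nonneg (D2 f x)
  have gz : ∀ x, r < ‖x‖ → g x = 0 := fun x hx => by
    rw [hg]; exact norm_eq_zero.mpr (hz x hx)
  have gc : Continuous g := by rw [hg]; exact (cont_D2 h.cd2).norm
  have gb : ∀ x ξ η, |D2 f x ξ η| ≤ g x * (‖ξ‖ * ‖η‖) := fun x ξ η => by
    rw [hg, ← mul_assoc]; exact abs_H_le (D2 f x) ξ η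
  have hcs : HasCompactSupport g := by
    apply HasCompactSupport.intro (isCompact_closedBall (0 : ES n) r)
    intro x hx
    exact gz x (by simpa using hx)
  refine ⟨∫ x, g x, integral_nonneg g0, fun ξ η => ?_⟩
  rw [← integral_mul_const]
  apply integral_mono (h.d2 ξ η).integrable.abs
  · exact (gc.integrable_of_hasCompactSupport hcs).mul_const _
  · intro x
    exact gb x ξ η

lemma opnorm2 {H : ES n →L[ℝ] ES n →L[ℝ] ℝ} {C : ℝ} (hC : 0 ≤ C)
    (h : ∀ ξ η, |H ξ η| ≤ C * (‖ξ‖ * ‖η‖)) : ‖H‖ ≤ C := by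
  apply ContinuousLinearMap.opNorm_le_bound _ hC
  intro ξ
  apply ContinuousLinearMap.opNorm_le_bound _ (by positivity)
  intro η
  rw [Real.norm_eq_abs]
  linarith [h ξ η]

/-- total mass -/
lemma mass_pos (hn : 0 < n) : 0 < ∫ x, phr n 1 x :=
  (phr_smooth one_pos).continuous.integral_pos_of_hasCompactSupport_nonneg_nonzero
    (phr_TF one_pos).cs (phr_nonneg one_pos) (Function.ne_iff.mp (phr_ne hn)).choose_spec

lemma mass_eq {ε : ℝ} (h0 : 0 < ε) (h1 : ε < 1) : ∫ x, phr n ε x = ∫ x, phr n 1 x := by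
  obtain ⟨χ, a1, a2, a3⟩ := chi_exists (n := n) h0 h1
  have hT : TF χ 1 := ⟨a1, fun x hx => a2 x hx.le⟩
  have : ∫ x, lap χ x = 0 := by
    simp only [lap]
    rw [integral_finsetSum _ (fun k _ => (hT.d2 _ _).integrable)]
    exact Finset.sum_eq_zero fun k _ => hT.int_d2 _ _
  simp only [a3] at this
  rw [integral_sub (phr_TF h0).integrable (phr_TF one_pos).integrable] at this
  linarith
end core

section core2
open MeasureTheory
variable {n : ℕ}

lemma small_pow {s κ : ℝ} (hs : 0 < s) (hκ : 0 < κ) : ∃ t : ℝ, 0 < t ∧ t < 1 ∧ t ^ s ≤ κ := by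
  refine ⟨min (1/2) (κ ^ (1/s)), by positivity, by
    have := min_le_left (1/2:ℝ) (κ ^ (1/s)); linarith, ?_⟩
  calc (min (1/2) (κ ^ (1/s))) ^ s ≤ (κ ^ (1/s)) ^ s := by
        apply Real.rpow_le_rpow (by positivity) (min_le_right _ _) hs.le
    _ = κ := by rw [← Real.rpow_mul hκ.le]; field_simp; simp

lemma phr_abs_int {ε : ℝ} (h0 : 0 < ε) (h1 : ε < 1) :
    ∫ x : ES n, |phr n ε x| = ∫ x, phr n 1 x := by
  rw [← mass_eq h0 h1]
  congr 1; ext x; rw [abs_of_nonneg (phr_nonneg h0 x)]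

lemma coreA (hn : 0 < n) {ε : ℝ} (h0 : 0 < ε) (h1 : ε < 1) : ∃ C, 0 ≤ C ∧
    ∀ (v : ES n → ℝ), ContDiff ℝ 2 v → ∀ (P F L0 : ℝ) (ξ η : ES n), 0 ≤ F →
    (∀ z, ‖z‖ ≤ ε → ‖D2 v z - D2 v 0‖ ≤ P) → (∀ z, ‖z‖ ≤ 1 → |lap v z - L0| ≤ F) →
    |(∫ x, phr n 1 x) * D2 v 0 ξ η - ∫ x, phr n 1 x * D2 v x ξ η|
      ≤ (P * (∫ x, phr n 1 x) + C * F) * (‖ξ‖ * ‖η‖) := by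
  obtain ⟨χ, a1, a2, a3⟩ := chi_exists (n := n) h0 h1
  have hT : TF χ 1 := ⟨a1, fun x hx => a2 x hx.le⟩
  obtain ⟨C, hC, hCb⟩ := hT.d2_bound
  refine ⟨C, hC, fun v hv P F L0 ξ η hF hP hL => ?_⟩
  have hm := cont_D2' hv ξ η
  have e1 : ∫ x, phr n ε x * (D2 v x ξ η - D2 v 0 ξ η)
      = (∫ x, phr n ε x * D2 v x ξ η) - (∫ x, phr n 1 x) * D2 v 0 ξ η := by
    simp only [mul_sub]
    rw [integral_sub ((phr_TF h0).integrable_mul hm) ((phr_TF h0).integrable_mul continuous_const),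
      integral_mul_const, mass_eq h0 h1]
  have b1 : |∫ x, phr n ε x * (D2 v x ξ η - D2 v 0 ξ η)|
      ≤ (P * (‖ξ‖ * ‖η‖)) * ∫ x, phr n 1 x := by
    rw [← phr_abs_int (n := n) h0 h1]
    apply (phr_TF h0).bound
    intro x hx
    have := abs_H_le (D2 v x - D2 v 0) ξ η
    have h2 := hP x hx
    simp only [ContinuousLinearMap.sub_apply] at this
    refine this.trans ?_
    rw [mul_assoc]
    gcongr
  have e2 : ∫ x, D2 χ x ξ η * (lap v x - L0)
      = (∫ x, phr n ε x * D2 v x ξ η) - ∫ x, phr n 1 x * D2 v x ξ η := by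
    simp only [mul_sub]
    rw [integral_sub ((hT.d2 ξ η).integrable_mul (cont_lap hv))
      ((hT.d2 ξ η).integrable_mul continuous_const), integral_mul_const, hT.int_d2, zero_mul, sub_zero,
      ← hT.lap_swap hv, ← integral_sub ((phr_TF h0).integrable_mul hm)
      ((phr_TF one_pos).integrable_mul hm)]
    congr 1; ext x; rw [a3]; ring
  have b2 : |∫ x, D2 χ x ξ η * (lap v x - L0)| ≤ F * (C * (‖ξ‖ * ‖η‖)) :=
    ((hT.d2 ξ η).bound hL).trans (mul_le_mul_of_nonneg_left (hCb ξ η) hF)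
  rw [e1, abs_le] at b1
  rw [e2, abs_le] at b2
  rw [abs_le]
  constructor <;> nlinarith [b1.1, b1.2, b2.1, b2.2]

lemma coreB (n : ℕ) : ∃ C, 0 ≤ C ∧
    ∀ (v : ES n → ℝ), ContDiff ℝ 2 v → ∀ (P : ℝ) (ξ η e : ES n), ‖e‖ ≤ 1 → 0 ≤ P →
    (∀ z, ‖z‖ ≤ 2 → ‖D2 v z - D2 v 0‖ ≤ P) →
    |(∫ x, phr n 1 x * D2 v x ξ η) - ∫ x, phr n 1 x * D2 v (e + x) ξ η|
      ≤ C * ‖e‖ * P * (‖ξ‖ * ‖η‖) := by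
  have hφ := phr_TF (n := n) one_pos
  obtain ⟨K, hK⟩ := (hφ.sm.of_le (m := 1) (by exact_mod_cast le_top)).lipschitzWith_of_hasCompactSupport hφ.cs (by norm_num)
  set V := (volume (closedBall (0 : ES n) 2)).toReal with hV
  refine ⟨K * V, by positivity, fun v hv P ξ η e he hP0 hP => ?_⟩
  have hm := cont_D2' hv ξ η
  set g : ES n → ℝ := fun x => phr n 1 x - phr n 1 (x - e) with hg
  have hsm2 : ContDiff ℝ ∞ (fun x : ES n => phr n 1 (x - e)) :=
    hφ.sm.comp (contDiff_id.sub contDiff_const)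
  have hg2 : TF g 2 := by
    refine ⟨hφ.sm.sub hsm2, fun x hx => ?_⟩
    have : 1 < ‖x - e‖ := by have := norm_sub_norm_le x e; linarith
    simp only [hg]
    rw [hφ.z x (by linarith), hφ.z _ this, sub_zero]
  have hs2 : TF (fun x : ES n => phr n 1 (x - e)) 2 := by
    refine ⟨hsm2, fun x hx => ?_⟩
    have : 1 < ‖x - e‖ := by have := norm_sub_norm_le x e; linarith
    exact hφ.z _ this
  have t1 : ∫ x, phr n 1 x * D2 v (e + x) ξ η = ∫ x, phr n 1 (x - e) * D2 v x ξ η := by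
    rw [← integral_add_left_eq_self (fun x => phr n 1 (x - e) * D2 v x ξ η) e]
    simp
  have t2 : ∫ x, g x = 0 := by
    simp only [hg]
    rw [integral_sub hφ.integrable hs2.integrable, integral_sub_right_eq_self (fun x => phr n 1 x) e,
      sub_self]
  have t3 : (∫ x, phr n 1 x * D2 v x ξ η) - ∫ x, phr n 1 x * D2 v (e + x) ξ η
      = ∫ x, g x * (D2 v x ξ η - D2 v 0 ξ η) := by
    simp only [mul_sub]
    rw [integral_sub (hg2.integrable_mul hm) (hg2.integrable_mul continuous_const),
      integral_mul_const, t2, zero_mul, sub_zero, t1, ← integral_sub (hφ.integrable_mul hm)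
      (hs2.integrable_mul hm)]
    congr 1; ext x; simp only [hg]; ring
  have b1 : |∫ x, g x * (D2 v x ξ η - D2 v 0 ξ η)| ≤ (P * (‖ξ‖ * ‖η‖)) * ∫ x, |g x| := by
    apply hg2.bound
    intro x hx
    have := abs_H_le (D2 v x - D2 v 0) ξ η
    have h2 := hP x hx
    simp only [ContinuousLinearMap.sub_apply] at this
    refine this.trans ?_
    rw [mul_assoc]
    gcongr
  have b2 : ∫ x, |g x| ≤ K * ‖e‖ * V := by
    have : ∫ x, |g x| = ∫ x in closedBall (0 : ES n) 2, |g x| := by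
      rw [setIntegral_eq_integral_of_forall_compl_eq_zero]
      intro x hx
      rw [hg2.z x (by simpa using hx), abs_zero]
    rw [this]
    have h3 := norm_setIntegral_le_of_norm_le_const (μ := volume) (s := closedBall (0 : ES n) 2)
      (f := fun x => |g x|) (C := K * ‖e‖) (measure_closedBall_lt_top) (fun x _ => by
        rw [Real.norm_eq_abs, abs_abs]
        have := hK.dist_le_mul x (x - e)
        rw [Real.dist_eq, dist_eq_norm] at this
        simpa [hg] using this)
    exact (le_abs_self _).trans h3
  rw [t3]
  refine b1.trans ?_
  calc _ ≤ (P * (‖ξ‖ * ‖η‖)) * (K * ‖e‖ * V) := by gcongr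
    _ = _ := by ring

lemma core (hn : 0 < n) {α θ : ℝ} (ha0 : 0 < α) (ha1 : α < 1) (hθ : 0 < θ) :
    ∃ h0, 0 < h0 ∧ h0 ≤ 1 ∧ ∃ C, 0 ≤ C ∧ ∀ v : ES n → ℝ, ContDiff ℝ 2 v → ∀ Q F : ℝ, 0 ≤ Q → 0 ≤ F →
    ∀ e : ES n, ‖e‖ ≤ h0 →
    (∀ z w, ‖z‖ ≤ 2 → ‖w‖ ≤ 2 → ‖D2 v z - D2 v w‖ ≤ Q * ‖z - w‖ ^ α) →
    (∀ z, ‖z‖ ≤ 2 → |lap v z - lap v 0| ≤ F) →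
    ‖D2 v 0 - D2 v e‖ ≤ θ * h0 ^ α * Q + C * F := by
  obtain ⟨Cb, hCb, hB⟩ := coreB n
  set c0 := ∫ x, phr n 1 x with hc0
  have c0p : 0 < c0 := mass_pos hn
  obtain ⟨h0, h0p, h01, h0s⟩ := small_pow (s := 1 - α) (κ := c0 * θ / (4 * (Cb + 1)))
    (by linarith) (by positivity)
  obtain ⟨ε, εp, ε1, εs⟩ := small_pow (s := α) (κ := θ / 4 * h0 ^ α) ha0 (by positivity)
  obtain ⟨Ca, hCa, hA⟩ := coreA hn εp ε1
  refine ⟨h0, h0p, h01.le, 2 * Ca / c0, by positivity, fun v hv Q F hQ hF e he hH hL => ?_⟩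
  apply opnorm2 (by positivity)
  intro ξ η
  obtain ⟨w1, w2, w3⟩ := D2_affine hv e (ContinuousLinearMap.id ℝ (ES n))
  set w := fun z => v (e + (ContinuousLinearMap.id ℝ (ES n)) z) with hw
  have wD : ∀ z, D2 w z = D2 v (e + z) := by intro z; ext ξ η; rw [w3]; simp
  have e1 : ‖e‖ ≤ 1 := he.trans h01.le
  have i1 := hA v hv (Q * ε ^ α) F (lap v 0) ξ η hF (fun z hz => by
    refine (hH z 0 (by linarith) (by simp)).trans ?_
    rw [sub_zero]; gcongr) (fun z hz => hL z (by linarith))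
  have i2 := hA w w1 (Q * ε ^ α) F (lap v 0) ξ η hF (fun z hz => by
    rw [wD, wD]
    have : ‖e + z‖ ≤ 2 := by have := norm_add_le e z; linarith
    refine (hH _ _ this (by simp; linarith)).trans ?_
    simp only [add_zero, add_sub_cancel_left]; gcongr) (fun z hz => by
    have : ‖e + z‖ ≤ 2 := by have := norm_add_le e z; linarith
    simp only [lap, wD] 
    exact hL _ this)
  have i3 := hB v hv (Q * 2) ξ η e e1 (by positivity) (fun z hz => by
    refine (hH z 0 hz (by simp)).trans ?_
    rw [sub_zero]
    gcongr
    calc ‖z‖ ^ α ≤ 2 ^ α := by gcongr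
      _ ≤ 2 ^ (1:ℝ) := Real.rpow_le_rpow_of_exponent_le (by norm_num) ha1.le
      _ = 2 := by simp)
  simp only [wD, add_zero] at i2
  rw [← hc0] at i1 i2
  set I1 := ∫ x, phr n 1 x * D2 v x ξ η
  set I2 := ∫ x, phr n 1 x * D2 v (e + x) ξ η
  set N := ‖ξ‖ * ‖η‖ with hN
  have hN0 : 0 ≤ N := by positivity
  have k1 : Cb * ‖e‖ * (Q * 2) * N ≤ c0 * (θ / 2 * h0 ^ α * Q) * N := by
    have : (Cb + 1) * h0 ≤ c0 * θ / 4 * h0 ^ α := by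
      have h5 : h0 = h0 ^ (1 - α) * h0 ^ α := by
        rw [← Real.rpow_add h0p]; simp
      calc (Cb + 1) * h0 = ((Cb + 1) * h0 ^ (1 - α)) * h0 ^ α := by
            rw [mul_assoc, ← h5]
        _ ≤ ((Cb + 1) * (c0 * θ / (4 * (Cb + 1)))) * h0 ^ α := by gcongr
        _ = _ := by field_simp
    have h6 : Cb * ‖e‖ ≤ c0 * θ / 4 * h0 ^ α :=
      (mul_le_mul (by linarith) he (norm_nonneg _) (by linarith)).trans this
    calc Cb * ‖e‖ * (Q * 2) * N ≤ (c0 * θ / 4 * h0 ^ α) * (Q * 2) * N := by gcongr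
      _ = _ := by ring
  have k2 : (Q * ε ^ α * c0 + Ca * F) * N ≤ c0 * (θ / 4 * h0 ^ α * Q + Ca / c0 * F) * N := by
    have : c0 * (θ / 4 * h0 ^ α * Q + Ca / c0 * F) = Q * (θ / 4 * h0 ^ α) * c0 + Ca * F := by
      field_simp
    rw [this]
    gcongr
  have k3 : c0 * |D2 v 0 ξ η - D2 v e ξ η| ≤ c0 * ((θ * h0 ^ α * Q + 2 * Ca / c0 * F) * N) := by
    have : c0 * |D2 v 0 ξ η - D2 v e ξ η| = |c0 * D2 v 0 ξ η - c0 * D2 v e ξ η| := by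
      rw [← mul_sub, abs_mul, abs_of_pos c0p]
    rw [this]
    rw [abs_le] at i1 i2 i3 ⊢
    have e7 : c0 * ((θ * h0 ^ α * Q + 2 * Ca / c0 * F) * N) = c0 * (θ / 2 * h0 ^ α * Q) * N
      + c0 * (θ / 4 * h0 ^ α * Q + Ca / c0 * F) * N + c0 * (θ / 4 * h0 ^ α * Q + Ca / c0 * F) * N := by
      ring
    rw [e7]
    constructor <;> linarith [i1.1, i1.2, i2.1, i2.2, i3.1, i3.2]
  exact le_of_mul_le_mul_left k3 c0p
end core2

section interp
open MeasureTheory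
variable {n : ℕ}

lemma interp2 (hn : 0 < n) : ∃ C, 0 ≤ C ∧ ∀ v : ES n → ℝ, ContDiff ℝ 2 v → ∀ Q M : ℝ, 0 ≤ M →
    (∀ z, ‖z‖ ≤ 1 → ‖D2 v z - D2 v 0‖ ≤ Q) → (∀ z, ‖z‖ ≤ 1 → |v z| ≤ M) →
    ‖D2 v 0‖ ≤ Q + C * M := by
  have hφ := phr_TF (n := n) one_pos
  obtain ⟨C, hC, hCb⟩ := hφ.d2_bound
  set c0 := ∫ x, phr n 1 x with hc0
  have c0p : 0 < c0 := mass_pos hn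
  refine ⟨C / c0, by positivity, fun v hv Q M hM hQ hv0 => ?_⟩
  have hQ0 : 0 ≤ Q := (norm_nonneg _).trans (hQ 0 (by simp))
  apply opnorm2 (by positivity)
  intro ξ η
  have hm := cont_D2' hv ξ η
  have e1 : ∫ x, phr n 1 x * (D2 v x ξ η - D2 v 0 ξ η)
      = (∫ x, D2 (phr n 1) x ξ η * v x) - c0 * D2 v 0 ξ η := by
    simp only [mul_sub]
    rw [integral_sub (hφ.integrable_mul hm) (hφ.integrable_mul continuous_const),
      integral_mul_const, hφ.ibp2 hv]
  have b1 : |∫ x, phr n 1 x * (D2 v x ξ η - D2 v 0 ξ η)| ≤ (Q * (‖ξ‖ * ‖η‖)) * c0 := by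
    have : c0 = ∫ x, |phr n 1 x| := by
      rw [hc0]; congr 1; ext x; rw [abs_of_nonneg (phr_nonneg one_pos x)]
    rw [this]
    apply hφ.bound
    intro x hx
    have := abs_H_le (D2 v x - D2 v 0) ξ η
    have h2 := hQ x hx
    rw [sub_apply, sub_apply] at this
    refine this.trans ?_
    rw [mul_assoc]
    gcongr
  have b2 : |∫ x, D2 (phr n 1) x ξ η * v x| ≤ M * (C * (‖ξ‖ * ‖η‖)) :=
    ((hφ.d2 ξ η).bound hv0).trans (mul_le_mul_of_nonneg_left (hCb ξ η) hM)
  rw [e1, abs_le] at b1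
  rw [abs_le] at b2
  have k3 : c0 * |D2 v 0 ξ η| ≤ c0 * ((Q + C / c0 * M) * (‖ξ‖ * ‖η‖)) := by
    have : c0 * |D2 v 0 ξ η| = |c0 * D2 v 0 ξ η| := by rw [abs_mul, abs_of_pos c0p]
    rw [this]
    have e2 : c0 * ((Q + C / c0 * M) * (‖ξ‖ * ‖η‖)) =
      (Q * (‖ξ‖ * ‖η‖)) * c0 + M * (C * (‖ξ‖ * ‖η‖)) := by field_simp
    rw [e2, abs_le]
    constructor <;> linarith [b1.1, b1.2, b2.1, b2.2]
  exact le_of_mul_le_mul_left k3 c0p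

lemma interp1 {v : ES n → ℝ} (hv : ContDiff ℝ 2 v) {B M : ℝ}
    (hB : ∀ z, ‖z‖ ≤ 1 → ‖D2 v z‖ ≤ B) (hM : ∀ z, ‖z‖ ≤ 1 → |v z| ≤ M) :
    ‖fderiv ℝ v 0‖ ≤ B + 2 * M := by
  have hd : ∀ z, DifferentiableAt ℝ v z := fun z => (hv.differentiable (by norm_num)) z
  have hd2 : ∀ z, DifferentiableAt ℝ (fderiv ℝ v) z := fun z => diff_fderiv hv.contDiffAt
  have B0 : 0 ≤ B := (norm_nonneg (D2 v 0)).trans (hB 0 (by simp))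
  have M0 : 0 ≤ M := (abs_nonneg _).trans (hM 0 (by simp))
  have h1 : ∀ z ∈ closedBall (0 : ES n) 1, ‖fderiv ℝ v z - fderiv ℝ v 0‖ ≤ B := by
    intro z hz
    have := (convex_closedBall (0 : ES n) 1).norm_image_sub_le_of_norm_fderiv_le (𝕜 := ℝ)
      (f := fderiv ℝ v) (C := B) (fun y _ => hd2 y) (fun y hy => hB y (by simpa using hy))
      (mem_closedBall_self (by norm_num)) hz
    refine this.trans ?_
    have : ‖z - 0‖ ≤ 1 := by simpa using hz
    nlinarith
  have h2 : ∀ ξ : ES n, ‖ξ‖ ≤ 1 → |fderiv ℝ v 0 ξ| ≤ B + 2 * M := by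
    intro ξ hξ
    have hξ' : ξ ∈ closedBall (0 : ES n) 1 := by simpa using hξ
    have := (convex_closedBall (0 : ES n) 1).norm_image_sub_le_of_norm_fderiv_le' (𝕜 := ℝ)
      (f := v) (C := B) (φ := fderiv ℝ v 0) (fun y _ => hd y) h1
      (mem_closedBall_self (by norm_num)) hξ'
    rw [sub_zero, Real.norm_eq_abs, abs_le] at this
    have a1 := abs_le.mp (hM ξ hξ)
    have a2 := abs_le.mp (hM 0 (by simp))
    have a3 : B * ‖ξ‖ ≤ B := by nlinarith
    rw [abs_le]
    constructor <;> linarith [this.1, this.2, a1.1, a1.2, a2.1, a2.2]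
  apply ContinuousLinearMap.opNorm_le_of_unit_norm (by positivity)
  intro ξ hξ
  rw [Real.norm_eq_abs]
  exact h2 ξ hξ.le

lemma scale_facts {u : ES n → ℝ} (hu : ContDiff ℝ 2 u) (x : ES n) (τ : ℝ) :
    ContDiff ℝ 2 (fun z => u (x + (τ • ContinuousLinearMap.id ℝ (ES n)) z)) ∧
    (∀ z, fderiv ℝ (fun z => u (x + (τ • ContinuousLinearMap.id ℝ (ES n)) z)) z
      = τ • fderiv ℝ u (x + τ • z)) ∧
    (∀ z, D2 (fun z => u (x + (τ • ContinuousLinearMap.id ℝ (ES n)) z)) z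
      = (τ ^ 2) • D2 u (x + τ • z)) := by
  obtain ⟨h1, h2, h3⟩ := D2_affine hu x (τ • ContinuousLinearMap.id ℝ (ES n))
  refine ⟨h1, fun z => ?_, fun z => ?_⟩
  · ext ξ; rw [h2]; simp
  · ext ξ η; rw [h3]; simp; ring

lemma interp2s (hn : 0 < n) : ∃ C, 0 ≤ C ∧ ∀ u : ES n → ℝ, ContDiff ℝ 2 u → ∀ (x : ES n)
    (τ Q M : ℝ), 0 < τ → 0 ≤ M →
    (∀ z, ‖z - x‖ ≤ τ → ‖D2 u z - D2 u x‖ ≤ Q) → (∀ z, ‖z - x‖ ≤ τ → |u z| ≤ M) →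
    ‖D2 u x‖ ≤ Q + C * M / τ ^ 2 := by
  obtain ⟨C, hC, h⟩ := interp2 hn
  refine ⟨C, hC, fun u hu x τ Q M hτ hM hQ hv => ?_⟩
  obtain ⟨s1, s2, s3⟩ := scale_facts hu x τ
  have hb : ∀ z : ES n, ‖z‖ ≤ 1 → ‖(x + τ • z) - x‖ ≤ τ := by
    intro z hz
    rw [add_sub_cancel_left, norm_smul, Real.norm_eq_abs, abs_of_pos hτ]
    nlinarith
  have := h _ s1 (τ ^ 2 * Q) M hM (fun z hz => by
    rw [s3, s3, ← smul_sub, norm_smul, Real.norm_eq_abs, abs_of_pos (by positivity)]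
    have := hQ _ (hb z hz)
    simp only [smul_zero, add_zero]
    gcongr) (fun z hz => by
    have := hv _ (hb z hz)
    simpa using this)
  rw [s3, norm_smul, Real.norm_eq_abs, abs_of_pos (by positivity)] at this
  simp only [smul_zero, add_zero] at this
  have t2 : 0 < τ ^ 2 := by positivity
  have e : τ ^ 2 * (Q + C * M / τ ^ 2) = τ ^ 2 * Q + C * M := by field_simp
  rw [← e] at this
  exact le_of_mul_le_mul_left this t2

lemma interp1s {u : ES n → ℝ} (hu : ContDiff ℝ 2 u) (x : ES n) {τ B M : ℝ} (hτ : 0 < τ)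
    (hB : ∀ z, ‖z - x‖ ≤ τ → ‖D2 u z‖ ≤ B) (hM : ∀ z, ‖z - x‖ ≤ τ → |u z| ≤ M) :
    ‖fderiv ℝ u x‖ ≤ τ * B + 2 * M / τ := by
  obtain ⟨s1, s2, s3⟩ := scale_facts hu x τ
  have hb : ∀ z : ES n, ‖z‖ ≤ 1 → ‖(x + τ • z) - x‖ ≤ τ := by
    intro z hz
    rw [add_sub_cancel_left, norm_smul, Real.norm_eq_abs, abs_of_pos hτ]
    nlinarith
  have := interp1 s1 (B := τ ^ 2 * B) (M := M) (fun z hz => by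
    rw [s3, norm_smul, Real.norm_eq_abs, abs_of_pos (by positivity)]
    have := hB _ (hb z hz)
    gcongr) (fun z hz => by
    have := hM _ (hb z hz)
    simpa using this)
  rw [s2, norm_smul, Real.norm_eq_abs, abs_of_pos (by positivity)] at this
  simp only [smul_zero, add_zero] at this
  have e : τ * (τ * B + 2 * M / τ) = τ ^ 2 * B + 2 * M := by field_simp
  rw [← e] at this
  exact le_of_mul_le_mul_left this hτ
end interp

section schauder
variable {n : ℕ}

/-- symmetric, uniformly elliptic matrix -/
def Ell (A : Fin n → Fin n → ℝ) (lam Lam : ℝ) : Prop :=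
  (∀ i j, A i j = A j i) ∧ ∀ ξ : ES n, lam * ‖ξ‖ ^ 2 ≤ ∑ i, ∑ j, A i j * ξ i * ξ j ∧
      ∑ i, ∑ j, A i j * ξ i * ξ j ≤ Lam * ‖ξ‖ ^ 2

/-- hypotheses of the interior Schauder estimate -/
structure SchHyp (α lam Lam A0 F0 F1 M : ℝ) (x0 : ES n) (R : ℝ)
    (a : ES n → Fin n → Fin n → ℝ) (f u : ES n → ℝ) : Prop where
  R1 : R ≤ 1
  ell : ∀ x ∈ ball x0 R, Ell (a x) lam Lam
  hol : ∀ x ∈ ball x0 R, ∀ y ∈ ball x0 R, ∀ i j, |a x i j - a y i j| ≤ A0 * ‖x - y‖ ^ α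
  cd : ContDiff ℝ 2 u
  eq : ∀ x ∈ ball x0 R, tr (a x) (D2 u x) = f x
  fh : ∀ x ∈ ball x0 R, ∀ y ∈ ball x0 R, |f x - f y| ≤ F0 * ‖x - y‖ ^ α * (1 + ‖fderiv ℝ u x‖)
    + F1 * |u x - u y| + F1 * ‖fderiv ℝ u x - fderiv ℝ u y‖
  bd : ∀ x ∈ ball x0 R, |u x| ≤ M

/-- weighted Hölder bound -/
def PQ (α : ℝ) (x0 : ES n) (R : ℝ) (u : ES n → ℝ) (Q : ℝ) : Prop :=
  ∀ x ∈ ball x0 R, ∀ y, ‖x - y‖ ≤ (R - ‖x - x0‖) / 2 →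
    (R - ‖x - x0‖) ^ (2 + α) * ‖D2 u x - D2 u y‖ ≤ Q * ‖x - y‖ ^ α

lemma dpos {x x0 : ES n} {R : ℝ} (hx : x ∈ ball x0 R) : 0 < R - ‖x - x0‖ := by
  rw [mem_ball, dist_eq_norm] at hx; linarith

lemma in_ball {x y x0 : ES n} {R : ℝ} (h : ‖x - y‖ < R - ‖x - x0‖) : y ∈ ball x0 R := by
  rw [mem_ball, dist_eq_norm]
  have := norm_sub_le (x - x0) (x - y)
  have e : x - x0 - (x - y) = y - x0 := by abel
  rw [e] at this; linarith

lemma d_ge {x y x0 : ES n} {R : ℝ} : R - ‖x - x0‖ - ‖x - y‖ ≤ R - ‖y - x0‖ := by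
  have := norm_sub_le (x - x0) (x - y)
  have e : x - x0 - (x - y) = y - x0 := by abel
  rw [e] at this; linarith

lemma sch_interp (hn : 0 < n) {α : ℝ} (ha0 : 0 < α) {M μ : ℝ} (hM : 0 ≤ M)
    (hμ : 0 < μ) : ∃ C, 0 ≤ C ∧ ∀ (x0 : ES n) (R : ℝ) (u : ES n → ℝ), ContDiff ℝ 2 u →
    (∀ x ∈ ball x0 R, |u x| ≤ M) → ∀ Q, 0 ≤ Q → PQ α x0 R u Q → ∀ x ∈ ball x0 R,
    (R - ‖x - x0‖) ^ 2 * ‖D2 u x‖ ≤ μ * Q + C ∧ (R - ‖x - x0‖) * ‖fderiv ℝ u x‖ ≤ μ * Q + C := by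
  obtain ⟨C, hC, h⟩ := interp2s hn
  obtain ⟨t, t0, t1, ht⟩ := small_pow (s := α) (κ := μ / 2) ha0 (by positivity)
  set τ := t / 2 with hτ
  have τ0 : 0 < τ := by positivity
  have τh : τ ≤ 1 / 2 := by linarith
  have τs : τ ^ α ≤ μ / 2 := le_trans (Real.rpow_le_rpow (by positivity) (by linarith) ha0.le) ht
  refine ⟨2 * (C * M / τ ^ 2) + 4 * M, by positivity, ?_⟩
  intro x0 R u hu hb Q hQ hP
  have key : ∀ x ∈ ball x0 R, (R - ‖x - x0‖) ^ 2 * ‖D2 u x‖ ≤ μ / 2 * Q + C * M / τ ^ 2 := by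
    intro x hx
    have hd := dpos hx
    set d := R - ‖x - x0‖ with hdd
    have hz : ∀ z, ‖z - x‖ ≤ τ * d → ‖x - z‖ ≤ d / 2 := fun z hz => by
      rw [norm_sub_rev]; nlinarith
    have k := h u hu x (τ * d) (Q * τ ^ α / d ^ 2) M (by positivity) hM (fun z hzz => by
      have h1 := hP x hx z (hz z hzz)
      rw [norm_sub_rev (D2 u z), le_div_iff₀ (by positivity)]
      have h2 : ‖x - z‖ ^ α ≤ τ ^ α * d ^ α := by
        rw [← Real.mul_rpow τ0.le hd.le]
        apply Real.rpow_le_rpow (norm_nonneg _) _ ha0.le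
        rw [norm_sub_rev]; exact hzz
      rw [← hdd, Real.rpow_add hd, Real.rpow_two] at h1
      have h3 : 0 < d ^ α := Real.rpow_pos_of_pos hd _
      have h4 : d ^ α * (‖D2 u x - D2 u z‖ * d ^ 2) ≤ d ^ α * (Q * τ ^ α) := by
        calc _ = d ^ 2 * d ^ α * ‖D2 u x - D2 u z‖ := by ring
          _ ≤ Q * ‖x - z‖ ^ α := h1
          _ ≤ Q * (τ ^ α * d ^ α) := by gcongr
          _ = _ := by ring
      exact le_of_mul_le_mul_left h4 h3) (fun z hzz => hb z (in_ball (by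
        have := hz z hzz; linarith)))
    calc d ^ 2 * ‖D2 u x‖ ≤ d ^ 2 * (Q * τ ^ α / d ^ 2 + C * M / (τ * d) ^ 2) := by gcongr
      _ = Q * τ ^ α + C * M / τ ^ 2 := by field_simp
      _ ≤ Q * (μ / 2) + C * M / τ ^ 2 := by gcongr
      _ = _ := by ring
  intro x hx
  have hd := dpos hx
  have c0 : 0 ≤ C * M / τ ^ 2 := by positivity
  have q0 : 0 ≤ μ * Q := by positivity
  constructor
  · have := key x hx
    linarith
  · set d := R - ‖x - x0‖ with hdd
    have k := interp1s hu x (τ := d / 2) (B := (μ / 2 * Q + C * M / τ ^ 2) * 4 / d ^ 2) (M := M) (by positivity)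
      (fun z hz => by
        rw [norm_sub_rev] at hz
        have hzb : z ∈ ball x0 R := in_ball (by linarith)
        have h1 := key z hzb
        have h2 := d_ge (x := x) (y := z) (x0 := x0) (R := R)
        set d' := R - ‖z - x0‖
        have h3 : d / 2 ≤ d' := by linarith
        rw [le_div_iff₀ (by positivity)]
        have : (d / 2) ^ 2 * ‖D2 u z‖ ≤ d' ^ 2 * ‖D2 u z‖ := by gcongr
        nlinarith) (fun z hz => hb z (in_ball (by rw [norm_sub_rev] at hz; linarith)))
    calc d * ‖fderiv ℝ u x‖ ≤ d * (d / 2 * ((μ / 2 * Q + C * M / τ ^ 2) * 4 / d ^ 2) + 2 * M / (d / 2)) := by gcongr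
      _ = μ * Q + (2 * (C * M / τ ^ 2) + 4 * M) := by field_simp; ring

lemma sqrt_bounds {a b l : ℝ} (ha : 0 ≤ a) (hb : 0 ≤ b) (hl : 0 ≤ l) :
    (l * a ^ 2 ≤ b ^ 2 → √l * a ≤ b) ∧ (b ^ 2 ≤ l * a ^ 2 → b ≤ √l * a) := by
  have e : (√l * a) ^ 2 = l * a ^ 2 := by rw [mul_pow, Real.sq_sqrt hl]
  constructor
  · intro h; rw [← e] at h; exact le_of_sq_le_sq h hb
  · intro h; rw [← e] at h; exact le_of_sq_le_sq h (by positivity)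
end schauder

section schauder2
variable {n : ℕ}

lemma seg_bound {u : ES n → ℝ} (hu : ContDiff ℝ 2 u) {x : ES n} {t B1 B2 : ℝ}
    (h1 : ∀ z, ‖x - z‖ ≤ t → ‖fderiv ℝ u z‖ ≤ B1) (h2 : ∀ z, ‖x - z‖ ≤ t → ‖D2 u z‖ ≤ B2)
    {y : ES n} (hy : ‖x - y‖ ≤ t) :
    |u x - u y| ≤ B1 * ‖x - y‖ ∧ ‖fderiv ℝ u x - fderiv ℝ u y‖ ≤ B2 * ‖x - y‖ := by
  have hm : ∀ z ∈ closedBall x t, ‖x - z‖ ≤ t := fun z hz => by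
    rw [mem_closedBall, dist_eq_norm, norm_sub_rev] at hz; exact hz
  have hy' : y ∈ closedBall x t := by rw [mem_closedBall, dist_eq_norm, norm_sub_rev]; exact hy
  have hx' : x ∈ closedBall x t := mem_closedBall_self ((norm_nonneg _).trans hy)
  constructor
  · exact (convex_closedBall x t).norm_image_sub_le_of_norm_fderiv_le (𝕜 := ℝ) (f := u)
      (fun z _ => (hu.differentiable (by norm_num)) z) (fun z hz => h1 z (hm z hz)) hy' hx'
  · exact (convex_closedBall x t).norm_image_sub_le_of_norm_fderiv_le (𝕜 := ℝ) (f := fderiv ℝ u)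
      (fun z _ => diff_fderiv hu.contDiffAt) (fun z hz => h2 z (hm z hz)) hy' hx'

set_option maxHeartbeats 1000000 in
lemma sch_near (hn : 0 < n) {α lam Lam A0 F0 F1 θ' : ℝ} (ha0 : 0 < α) (ha1 : α < 1)
    (hl : 0 < lam) (hL : lam ≤ Lam) (hA0 : 0 ≤ A0) (hF0 : 0 ≤ F0) (hF1 : 0 ≤ F1) (hθ' : 0 < θ') :
    ∃ N C, 2 ≤ N ∧ 0 ≤ C ∧ ∀ (M : ℝ) (x0 : ES n) (R : ℝ) (a : ES n → Fin n → Fin n → ℝ)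
      (f u : ES n → ℝ), SchHyp α lam Lam A0 F0 F1 M x0 R a f u → ∀ Q, 0 ≤ Q → PQ α x0 R u Q →
      ∀ G, 0 ≤ G → (∀ x ∈ ball x0 R, (R - ‖x - x0‖) ^ 2 * ‖D2 u x‖ ≤ G ∧
        (R - ‖x - x0‖) * ‖fderiv ℝ u x‖ ≤ G) →
      ∀ x ∈ ball x0 R, ∀ y, N * ‖x - y‖ ≤ R - ‖x - x0‖ →
       (R - ‖x - x0‖) ^ (2 + α) * ‖D2 u x - D2 u y‖ ≤ (θ' * Q + C * (G + 1)) * ‖x - y‖ ^ α := by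
  have hLp : 0 < Lam := lt_of_lt_of_le hl hL
  set s := √lam with hs
  set S := √Lam with hS
  have sp : 0 < s := Real.sqrt_pos.mpr hl
  have Sp : 0 < S := Real.sqrt_pos.mpr hLp
  have sS : s ≤ S := Real.sqrt_le_sqrt hL
  obtain ⟨h0, h0p, h01, Cc, hCc, hcore⟩ := core hn (α := α)
    (θ := θ' * s ^ 2 * s ^ α / (2 * S ^ 2 * S ^ α)) ha0 ha1 (by positivity)
  set N := 16 * S / (s * h0) with hN
  have hN2 : 16 ≤ N := by
    rw [hN, le_div_iff₀ (by positivity)]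
    have := mul_le_mul_of_nonneg_left h01 sp.le
    linarith
  set C' : ℝ := 2 * (n ^ 2 * A0) + 2 * F0 + 4 * F1 with hC'
  have hC0 : 0 ≤ C' := by positivity
  clear_value s S N C'
  refine ⟨N, Cc * C' * N ^ α / s ^ 2, by linarith, by positivity, ?_⟩
  intro M x0 R a f u H Q hQ hP G hG hGb x hx y hNr
  have hd := dpos hx
  have hd1 : R - ‖x - x0‖ ≤ 1 := by have := H.R1; have := norm_nonneg (x - x0); linarith
  set d := R - ‖x - x0‖ with hdd
  rcases eq_or_ne x y with rfl | hxy
  · simp [Real.zero_rpow ha0.ne']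
  set r := ‖x - y‖ with hr
  have rp : 0 < r := norm_pos_iff.mpr (sub_ne_zero.mpr hxy)
  clear_value d r
  obtain ⟨σ, hσ1, hσ2⟩ := sqrt_exists (a x) lam Lam hl (H.ell x hx).1 (H.ell x hx).2
  have hσl : ∀ ξ, s * ‖ξ‖ ≤ ‖σ ξ‖ := fun ξ => hs ▸
    (sqrt_bounds (norm_nonneg _) (norm_nonneg _) hl.le).1 (hσ2 ξ).1
  have hσu : ∀ ξ, ‖σ ξ‖ ≤ S * ‖ξ‖ := fun ξ => hS ▸
    (sqrt_bounds (norm_nonneg _) (norm_nonneg _) hLp.le).2 (hσ2 ξ).2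
  set ζ := σ.symm (y - x) with hζ
  have hζσ : σ ζ = y - x := by simp [hζ]
  have ζu : s * ‖ζ‖ ≤ r := by
    have := hσl ζ; rwa [hζσ, norm_sub_rev, ← hr] at this
  have ζp : 0 < ‖ζ‖ := by
    have := hσu ζ
    rw [hζσ, norm_sub_rev] at this
    by_contra hc
    have h9 : ‖ζ‖ = 0 := le_antisymm (not_lt.mp hc) (norm_nonneg _)
    rw [h9, mul_zero] at this; linarith
  set ρ := ‖ζ‖ / h0 with hρ
  have ρp : 0 < ρ := by positivity
  have hρh : ρ * h0 = ‖ζ‖ := by rw [hρ]; field_simp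
  clear_value ρ
  set e := ρ⁻¹ • ζ with he
  have hen : ‖e‖ = h0 := by
    rw [he, norm_smul, Real.norm_eq_abs, abs_of_pos (by positivity), ← hρh]; field_simp
  have hρN : 2 * ρ * S ≤ N * r / 8 := by
    have : ρ ≤ r / (s * h0) := by
      rw [le_div_iff₀ (by positivity)]
      calc ρ * (s * h0) = s * (ρ * h0) := by ring
        _ ≤ r := by rw [hρh]; exact ζu
    calc 2 * ρ * S ≤ 2 * (r / (s * h0)) * S := by gcongr
      _ = N * r / 8 := by rw [hN]; field_simp; norm_num
  set t := N * r with ht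
  have tp : 0 < t := by positivity
  have t1 : t ≤ 1 := hNr.trans hd1
  clear_value t
  set Sg : ES n →L[ℝ] ES n := ρ • (σ : ES n →L[ℝ] ES n) with hSg
  have hSga : ∀ z, Sg z = ρ • σ z := fun z => rfl
  have hSgn : ∀ z, ‖Sg z‖ ≤ ρ * S * ‖z‖ := fun z => by
    rw [hSga, norm_smul, Real.norm_eq_abs, abs_of_pos ρp, mul_assoc]
    exact mul_le_mul_of_nonneg_left (hσu z) ρp.le
  obtain ⟨v1, v2, v3⟩ := D2_affine H.cd x Sg
  set v := fun z => u (x + Sg z) with hv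
  have hXt : ∀ z, ‖z‖ ≤ 2 → ‖x - (x + Sg z)‖ ≤ t / 8 := fun z hz => by
    have e1 : x - (x + Sg z) = - Sg z := by abel
    rw [e1, norm_neg]
    calc _ ≤ ρ * S * ‖z‖ := hSgn z
      _ ≤ ρ * S * 2 := by gcongr
      _ ≤ t / 8 := by linarith
  have hXb : ∀ z, ‖z‖ ≤ 2 → (x + Sg z) ∈ ball x0 R := fun z hz => in_ball (by
    have := hXt z hz; rw [← hdd]; linarith)
  have near_b : ∀ X, ‖x - X‖ ≤ t / 8 → X ∈ ball x0 R ∧ 7 / 8 * d ≤ R - ‖X - x0‖ := fun X hX => by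
    refine ⟨in_ball (by rw [← hdd]; linarith), ?_⟩
    have := d_ge (x := x) (y := X) (x0 := x0) (R := R)
    rw [← hdd] at this; linarith
  have hXd : ∀ z, ‖z‖ ≤ 2 → 7 / 8 * d ≤ R - ‖(x + Sg z) - x0‖ := fun z hz =>
    (near_b _ (hXt z hz)).2
  have g2 : ∀ X, ‖x - X‖ ≤ t / 8 → ‖D2 u X‖ ≤ 2 * G / d ^ 2 := fun X hX => by
    obtain ⟨hb, hdX⟩ := near_b X hX
    rw [le_div_iff₀ (by positivity)]
    have := (hGb X hb).1
    have h3 : (7 / 8 * d) ^ 2 * ‖D2 u X‖ ≤ (R - ‖X - x0‖) ^ 2 * ‖D2 u X‖ := by gcongr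
    have h4 : (7 / 8 * d) ^ 2 * ‖D2 u X‖ = 49 / 64 * (‖D2 u X‖ * d ^ 2) := by ring
    linarith [mul_nonneg (norm_nonneg (D2 u X)) (sq_nonneg d)]
  have g1 : ∀ X, ‖x - X‖ ≤ t / 8 → ‖fderiv ℝ u X‖ ≤ 2 * G / d := fun X hX => by
    obtain ⟨hb, hdX⟩ := near_b X hX
    rw [le_div_iff₀ (by positivity)]
    have := (hGb X hb).2
    have h3 : (7 / 8 * d) * ‖fderiv ℝ u X‖ ≤ (R - ‖X - x0‖) * ‖fderiv ℝ u X‖ := by gcongr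
    have h4 : (7 / 8 * d) * ‖fderiv ℝ u X‖ = 7 / 8 * (‖fderiv ℝ u X‖ * d) := by ring
    linarith [mul_nonneg (norm_nonneg (fderiv ℝ u X)) hd.le]
  set D := d ^ (2 + α) with hD
  have Dp : 0 < D := Real.rpow_pos_of_pos hd _
  clear_value D
  have hH : ∀ z w, ‖z‖ ≤ 2 → ‖w‖ ≤ 2 →
      ‖D2 v z - D2 v w‖ ≤ ((ρ * S) ^ 2 * (2 * Q * (ρ * S) ^ α / D)) * ‖z - w‖ ^ α := by
    intro z w hz hw
    set X := x + Sg z with hX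
    set Y := x + Sg w with hY
    have XY : X - Y = Sg (z - w) := by rw [hX, hY, map_sub]; abel
    have hXYn : ‖X - Y‖ ≤ ρ * S * ‖z - w‖ := by rw [XY]; exact hSgn _
    have hXYd : ‖X - Y‖ ≤ t / 4 := by
      have e1 : X - Y = (x - Y) - (x - X) := by abel
      rw [e1]
      have := norm_sub_le (x - Y) (x - X)
      linarith [hXt z hz, hXt w hw]
    have dX := hXd z hz
    have p1 := hP X (hXb z hz) Y (by linarith)
    have p2 : D / 2 ≤ (R - ‖X - x0‖) ^ (2 + α) := by
      calc D / 2 ≤ (7 / 8 : ℝ) ^ (2 + α) * D := by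
            have : (7 / 8 : ℝ) ^ (3 : ℝ) ≤ (7 / 8 : ℝ) ^ (2 + α) :=
              Real.rpow_le_rpow_of_exponent_ge (by norm_num) (by norm_num) (by linarith)
            have h3 : (7 / 8 : ℝ) ^ (3 : ℝ) = (7 / 8 : ℝ) ^ 3 := by norm_cast
            rw [h3] at this
            have : (1 / 2 : ℝ) ≤ (7 / 8 : ℝ) ^ (2 + α) := le_trans (by norm_num) this
            have := mul_le_mul_of_nonneg_right this Dp.le
            linarith
        _ = (7 / 8 * d) ^ (2 + α) := by rw [hD, Real.mul_rpow (by norm_num) hd.le]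
        _ ≤ _ := Real.rpow_le_rpow (by positivity) dX (by linarith)
    have p3 : ‖D2 u X - D2 u Y‖ ≤ 2 * Q * (ρ * S) ^ α / D * ‖z - w‖ ^ α := by
      have q1 : D / 2 * ‖D2 u X - D2 u Y‖ ≤ Q * ((ρ * S) ^ α * ‖z - w‖ ^ α) := by
        calc _ ≤ (R - ‖X - x0‖) ^ (2 + α) * ‖D2 u X - D2 u Y‖ := by gcongr
          _ ≤ _ := p1
          _ ≤ _ := by
            rw [← Real.mul_rpow (by positivity) (norm_nonneg _)]
            gcongr
      calc ‖D2 u X - D2 u Y‖ = (D / 2 * ‖D2 u X - D2 u Y‖) * (2 / D) := by field_simp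
        _ ≤ (Q * ((ρ * S) ^ α * ‖z - w‖ ^ α)) * (2 / D) := by gcongr
        _ = _ := by ring
    apply opnorm2 (by positivity)
    intro ξ η
    rw [sub_apply, sub_apply, v3, v3, ← sub_apply, ← sub_apply]
    calc _ ≤ ‖D2 u X - D2 u Y‖ * ‖Sg ξ‖ * ‖Sg η‖ := abs_H_le _ _ _
      _ ≤ (2 * Q * (ρ * S) ^ α / D * ‖z - w‖ ^ α) * (ρ * S * ‖ξ‖) * (ρ * S * ‖η‖) := by
        gcongr
        · exact hSgn ξ
        · exact hSgn η
      _ = _ := by ring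
  have hlap : ∀ z, lap v z = ρ ^ 2 * tr (a x) (D2 u (x + Sg z)) := by
    intro z
    rw [lap, hσ1, Finset.mul_sum]
    refine Finset.sum_congr rfl fun k _ => ?_
    rw [v3, hSga (ee k), ContinuousLinearMap.map_smul, ContinuousLinearMap.map_smul,
      ContinuousLinearMap.smul_apply, smul_eq_mul, smul_eq_mul]; ring
  have tα : t ≤ t ^ α := by
    calc t = t ^ (1:ℝ) := by simp
      _ ≤ t ^ α := Real.rpow_le_rpow_of_exponent_ge tp t1 ha1.le
  have hF : ∀ z, ‖z‖ ≤ 2 → |lap v z - lap v 0| ≤ ρ ^ 2 * (t ^ α * C' * (G + 1) / d ^ 2) := by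
    intro z hz
    have hX8 := hXt z hz
    have hXb' := hXb z hz
    rw [hlap, hlap, map_zero, add_zero, ← mul_sub, abs_mul, abs_of_pos (by positivity)]
    set X := x + Sg z with hX
    have e1 : tr (a x) (D2 u X) - tr (a x) (D2 u x)
        = tr (fun i j => a x i j - a X i j) (D2 u X) - (f x - f X) := by
      rw [tr_subA, H.eq x hx, H.eq X hXb']; ring
    have n1 : ‖x - X‖ ^ α ≤ t ^ α :=
      Real.rpow_le_rpow (norm_nonneg _) (by linarith) ha0.le
    have b1 : |tr (fun i j => a x i j - a X i j) (D2 u X)| ≤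
        n ^ 2 * (A0 * t ^ α) * (2 * G / d ^ 2) := by
      have := abs_tr_le (fun i j => a x i j - a X i j) (A0 * t ^ α) (fun i j =>
        (H.hol x hx X hXb' i j).trans (by gcongr)) (D2 u X)
      exact this.trans (by have := g2 X hX8; gcongr)
    obtain ⟨w1, w2⟩ := seg_bound H.cd g1 g2 hX8
    have id : 1 / d ≤ 1 / d ^ 2 := by
      apply one_div_le_one_div_of_le (by positivity)
      rw [sq]; exact mul_le_of_le_one_left hd.le hd1
    have hG2 : 2 * G / d ≤ 2 * G / d ^ 2 := by
      have : 2 * G * (1 / d) ≤ 2 * G * (1 / d ^ 2) := by gcongr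
      simpa [div_eq_mul_inv] using this
    have o1 : 1 ≤ 1 / d ^ 2 := by
      rw [le_div_iff₀ (by positivity), one_mul]; exact pow_le_one₀ hd.le hd1
    have w1' : |u x - u X| ≤ 2 * G / d ^ 2 * t ^ α := by
      refine w1.trans ?_
      gcongr
      linarith
    have w2' : ‖fderiv ℝ u x - fderiv ℝ u X‖ ≤ 2 * G / d ^ 2 * t ^ α := by
      refine w2.trans ?_
      gcongr
      linarith
    have w3 : 1 + ‖fderiv ℝ u x‖ ≤ 2 * (G + 1) / d ^ 2 := by
      have := g1 x (by simp; positivity)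
      have e2 : 2 * (G + 1) / d ^ 2 = 2 * G / d ^ 2 + 2 * (1 / d ^ 2) := by ring
      rw [e2]; linarith
    have b2 : |f x - f X| ≤ F0 * t ^ α * (2 * (G + 1) / d ^ 2) + F1 * (2 * G / d ^ 2 * t ^ α)
        + F1 * (2 * G / d ^ 2 * t ^ α) := by
      refine (H.fh x hx X hXb').trans ?_
      gcongr
    have b3 : |tr (a x) (D2 u X) - tr (a x) (D2 u x)| ≤ t ^ α * C' * (G + 1) / d ^ 2 := by
      rw [e1]
      refine (abs_sub _ _).trans ?_
      refine (add_le_add b1 b2).trans ?_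
      have e3 : t ^ α * C' * (G + 1) / d ^ 2 - (n ^ 2 * (A0 * t ^ α) * (2 * G / d ^ 2)
        + (F0 * t ^ α * (2 * (G + 1) / d ^ 2) + F1 * (2 * G / d ^ 2 * t ^ α)
        + F1 * (2 * G / d ^ 2 * t ^ α))) = t ^ α * (2 * n ^ 2 * A0 + 4 * F1) / d ^ 2 := by
        rw [hC']; ring
      have : 0 ≤ t ^ α * (2 * n ^ 2 * A0 + 4 * F1) / d ^ 2 := by positivity
      linarith
    gcongr
  have main := hcore v v1 _ _ (by positivity) (by positivity) e hen.le hH hF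
  have hSge : x + Sg e = y := by
    rw [hSga, he, map_smul, hζσ, smul_smul, mul_inv_cancel₀ ρp.ne', one_smul]; abel
  set W := θ' * s ^ 2 * s ^ α / (2 * S ^ 2 * S ^ α) * h0 ^ α * ((ρ * S) ^ 2 * (2 * Q * (ρ * S) ^ α / D)) + Cc * (ρ ^ 2 * (t ^ α * C' * (G + 1) / d ^ 2)) with hW
  have W0 : 0 ≤ W := by positivity
  have fin : ‖D2 u x - D2 u y‖ ≤ W / (ρ * s) ^ 2 := by
    apply opnorm2 (by positivity)
    intro ξ η
    have inv : ∀ ξ, ∃ ξ', Sg ξ' = ξ ∧ ‖ξ'‖ ≤ ‖ξ‖ / (ρ * s) := by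
      intro ξ
      refine ⟨ρ⁻¹ • σ.symm ξ, ?_, ?_⟩
      · rw [hSga, map_smul, smul_smul, mul_inv_cancel₀ ρp.ne', one_smul]; simp
      · rw [norm_smul, Real.norm_eq_abs, abs_of_pos (by positivity), le_div_iff₀ (by positivity)]
        have := hσl (σ.symm ξ)
        rw [ContinuousLinearEquiv.apply_symm_apply] at this
        calc _ = s * ‖σ.symm ξ‖ := by field_simp
          _ ≤ _ := this
    obtain ⟨ξ', h1, h2⟩ := inv ξ
    obtain ⟨η', h3, h4⟩ := inv η
    have e5 : (D2 u x - D2 u y) ξ η = (D2 v 0 - D2 v e) ξ' η' := by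
      rw [sub_apply, sub_apply, sub_apply, sub_apply, v3, v3, h1, h3, hSge, map_zero, add_zero]
    rw [e5]
    calc _ ≤ ‖D2 v 0 - D2 v e‖ * ‖ξ'‖ * ‖η'‖ := abs_H_le _ _ _
      _ ≤ W * (‖ξ‖ / (ρ * s)) * (‖η‖ / (ρ * s)) := by gcongr
      _ = _ := by field_simp
  have hDd : D = d ^ α * d ^ 2 := by rw [hD, Real.rpow_add hd, Real.rpow_two, mul_comm]
  calc D * ‖D2 u x - D2 u y‖ ≤ D * (W / (ρ * s) ^ 2) := by gcongr
    _ = θ' * Q * ((s * (ρ * h0)) ^ α) + Cc * C' / s ^ 2 * (G + 1) * t ^ α * d ^ α := by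
      rw [hW, hDd]
      have m1 : (ρ * S) ^ α = ρ ^ α * S ^ α := Real.mul_rpow ρp.le Sp.le
      have m2 : (s * (ρ * h0)) ^ α = s ^ α * (ρ ^ α * h0 ^ α) := by
        rw [Real.mul_rpow sp.le (by positivity), Real.mul_rpow ρp.le h0p.le]
      rw [m1, m2]
      have : 0 < S ^ α := by positivity
      have : 0 < d ^ α := by positivity
      field_simp
    _ ≤ θ' * Q * r ^ α + Cc * C' / s ^ 2 * (G + 1) * t ^ α * 1 := by
      have : d ^ α ≤ 1 := Real.rpow_le_one hd.le hd1 ha0.le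
      rw [hρh]
      gcongr
    _ = (θ' * Q + Cc * C' * N ^ α / s ^ 2 * (G + 1)) * r ^ α := by
      rw [ht, Real.mul_rpow (by positivity) rp.le]; ring
end schauder2

section schauder3
variable {n : ℕ}

lemma sch_step (hn : 0 < n) {α lam Lam A0 F0 F1 M : ℝ} (ha0 : 0 < α) (ha1 : α < 1)
    (hl : 0 < lam) (hL : lam ≤ Lam) (hA0 : 0 ≤ A0) (hF0 : 0 ≤ F0) (hF1 : 0 ≤ F1) (hM : 0 ≤ M) :
    ∃ C, 0 ≤ C ∧ ∀ (x0 : ES n) (R : ℝ) (a : ES n → Fin n → Fin n → ℝ)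
      (f u : ES n → ℝ), SchHyp α lam Lam A0 F0 F1 M x0 R a f u → ∀ Q, 0 ≤ Q → PQ α x0 R u Q →
      PQ α x0 R u (Q / 2 + C) := by
  obtain ⟨N, C1, hN, hC1, hnear⟩ := sch_near hn (θ' := 1 / 4) ha0 ha1 hl hL hA0 hF0 hF1 (by norm_num)
  have Np : 0 < N ^ α := Real.rpow_pos_of_pos (by linarith) _
  obtain ⟨μ, hμp, hμ1, hμ2⟩ : ∃ μ : ℝ, 0 < μ ∧ C1 * μ ≤ 1 / 4 ∧ 5 * N ^ α * μ ≤ 1 / 2 := by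
    refine ⟨1 / (4 * (C1 + 1) + 10 * N ^ α), by positivity, ?_, ?_⟩
    · rw [mul_one_div, div_le_iff₀ (by positivity)]; linarith
    · rw [mul_one_div, div_le_iff₀ (by positivity)]; linarith
  obtain ⟨C2, hC2, hInterp⟩ := sch_interp hn ha0 hM hμp
  refine ⟨C1 * (C2 + 1) + 5 * N ^ α * C2, by positivity, ?_⟩
  intro x0 R a f u H Q hQ hP x hx y hy
  have G := hInterp x0 R u H.cd H.bd Q hQ hP
  have hd := dpos hx
  rcases le_or_gt (N * ‖x - y‖) (R - ‖x - x0‖) with h | h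
  · refine (hnear M x0 R a f u H Q hQ hP (μ * Q + C2) (by positivity) G x hx y h).trans ?_
    have h1 : 0 ≤ ‖x - y‖ ^ α := Real.rpow_nonneg (norm_nonneg _) _
    apply mul_le_mul_of_nonneg_right _ h1
    have h2 : C1 * μ * Q ≤ 1 / 4 * Q := mul_le_mul_of_nonneg_right hμ1 hQ
    have h3 : 0 ≤ 5 * N ^ α * C2 := by positivity
    linarith
  · have gx := (G x hx).1
    have gy := (G y (in_ball (by linarith))).1
    have dy := d_ge (x := x) (y := y) (x0 := x0) (R := R)
    generalize R - ‖y - x0‖ = d' at *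
    generalize R - ‖x - x0‖ = d at *
    have hd' : d / 2 ≤ d' := by linarith
    have gy' : d ^ 2 * ‖D2 u y‖ ≤ 4 * (μ * Q + C2) := by
      have h1 : (d / 2) ^ 2 * ‖D2 u y‖ ≤ d' ^ 2 * ‖D2 u y‖ := by gcongr
      linarith
    have tri := norm_sub_le (D2 u x) (D2 u y)
    have k : d ^ 2 * ‖D2 u x - D2 u y‖ ≤ 5 * (μ * Q + C2) := by
      have := mul_le_mul_of_nonneg_left tri (sq_nonneg d)
      linarith
    have dα : d ^ α ≤ N ^ α * ‖x - y‖ ^ α := by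
      rw [← Real.mul_rpow (by linarith) (norm_nonneg _)]
      exact Real.rpow_le_rpow hd.le h.le ha0.le
    have h1 : 0 ≤ ‖x - y‖ ^ α := Real.rpow_nonneg (norm_nonneg _) _
    rw [Real.rpow_add hd, Real.rpow_two]
    calc d ^ 2 * d ^ α * ‖D2 u x - D2 u y‖ = d ^ α * (d ^ 2 * ‖D2 u x - D2 u y‖) := by ring
      _ ≤ (N ^ α * ‖x - y‖ ^ α) * (5 * (μ * Q + C2)) := by gcongr
      _ = (5 * N ^ α * μ * Q + 5 * N ^ α * C2) * ‖x - y‖ ^ α := by ring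
      _ ≤ _ := by
        apply mul_le_mul_of_nonneg_right _ h1
        have h2 : 5 * N ^ α * μ * Q ≤ 1 / 2 * Q := mul_le_mul_of_nonneg_right hμ2 hQ
        have h3 : 0 ≤ C1 * (C2 + 1) := by positivity
        linarith

lemma schauder (hn : 0 < n) {α lam Lam A0 F0 F1 M : ℝ} (ha0 : 0 < α) (ha1 : α < 1)
    (hl : 0 < lam) (hL : lam ≤ Lam) (hA0 : 0 ≤ A0) (hF0 : 0 ≤ F0) (hF1 : 0 ≤ F1) (hM : 0 ≤ M) :
    ∃ C, 0 ≤ C ∧ ∀ (x0 : ES n) (R : ℝ) (a : ES n → Fin n → Fin n → ℝ)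
      (f u : ES n → ℝ), SchHyp α lam Lam A0 F0 F1 M x0 R a f u →
      (∃ Q0, 0 ≤ Q0 ∧ ∀ x y, ‖D2 u x - D2 u y‖ ≤ Q0 * ‖x - y‖ ^ α) →
      PQ α x0 R u C ∧ ∀ x ∈ ball x0 R, (R - ‖x - x0‖) ^ 2 * ‖D2 u x‖ ≤ C ∧
        (R - ‖x - x0‖) * ‖fderiv ℝ u x‖ ≤ C := by
  obtain ⟨C, hC, hst⟩ := sch_step hn ha0 ha1 hl hL hA0 hF0 hF1 hM
  obtain ⟨C2, hC2, hInterp⟩ := sch_interp hn ha0 hM one_pos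
  refine ⟨2 * C + C2, by positivity, ?_⟩
  rintro x0 R a f u H ⟨Q0, hQ0, hQ⟩
  have h0 : PQ α x0 R u Q0 := by
    intro x hx y hy
    have hd := dpos hx
    have hd1 : R - ‖x - x0‖ ≤ 1 := by have := H.R1; have := norm_nonneg (x - x0); linarith
    have h1 : (R - ‖x - x0‖) ^ (2 + α) ≤ 1 := Real.rpow_le_one hd.le hd1 (by linarith)
    calc _ ≤ 1 * ‖D2 u x - D2 u y‖ := by gcongr
      _ ≤ _ := by rw [one_mul]; exact hQ x y
  have hk : ∀ k : ℕ, PQ α x0 R u (Q0 / 2 ^ k + 2 * C) := by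
    intro k
    induction k with
    | zero =>
      intro x hx y hy
      refine (h0 x hx y hy).trans ?_
      have h1 : 0 ≤ ‖x - y‖ ^ α := Real.rpow_nonneg (norm_nonneg _) _
      apply mul_le_mul_of_nonneg_right _ h1
      simp; linarith
    | succ k ih =>
      have := hst x0 R a f u H _ (by positivity) ih
      convert this using 1
      rw [pow_succ]; field_simp; ring
  have hP : PQ α x0 R u (2 * C) := by
    intro x hx y hy
    have lim : Tendsto (fun k : ℕ => (Q0 / 2 ^ k + 2 * C) * ‖x - y‖ ^ α) atTop
        (nhds ((0 + 2 * C) * ‖x - y‖ ^ α)) := by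
      apply Tendsto.mul_const
      apply Tendsto.add_const
      have := (tendsto_pow_atTop_nhds_zero_of_lt_one (r := (1/2:ℝ)) (by norm_num) (by norm_num)).const_mul Q0
      simpa [div_eq_mul_inv] using this
    rw [zero_add] at lim
    exact ge_of_tendsto' lim (fun k => hk k x hx y hy)
  refine ⟨?_, fun x hx => ?_⟩
  · intro x hx y hy
    refine (hP x hx y hy).trans ?_
    have h1 : 0 ≤ ‖x - y‖ ^ α := Real.rpow_nonneg (norm_nonneg _) _
    apply mul_le_mul_of_nonneg_right _ h1
    linarith
  · have := hInterp x0 R u H.cd H.bd (2 * C) (by positivity) hP x hx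
    simpa using this
end schauder3

section maxpr
variable {n : ℕ}

noncomputable def drift (b : Fin n → ℝ) (ℓ : ES n →L[ℝ] ℝ) : ℝ := ∑ i, b i * ℓ (ee i)

noncomputable def LL (a : ES n → Fin n → Fin n → ℝ) (b : ES n → Fin n → ℝ) (c : ES n → ℝ)
    (u : ES n → ℝ) (x : ES n) : ℝ :=
  tr (a x) (D2 u x) + drift (b x) (fderiv ℝ u x) - c x * u x

lemma drift_sub (b : Fin n → ℝ) (l l' : ES n →L[ℝ] ℝ) : drift b (l - l') = drift b l - drift b l' := by
  simp [drift, mul_sub, Finset.sum_sub_distrib]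

lemma drift_subA (b b' : Fin n → ℝ) (l : ES n →L[ℝ] ℝ) :
    drift (fun i => b i - b' i) l = drift b l - drift b' l := by
  simp [drift, sub_mul, Finset.sum_sub_distrib]

lemma drift_add (b : Fin n → ℝ) (l l' : ES n →L[ℝ] ℝ) : drift b (l + l') = drift b l + drift b l' := by
  simp [drift, mul_add, Finset.sum_add_distrib]

lemma drift_smul (b : Fin n → ℝ) (r : ℝ) (l : ES n →L[ℝ] ℝ) : drift b (r • l) = r * drift b l := by
  simp only [drift, Finset.mul_sum]
  refine Finset.sum_congr rfl fun i _ => ?_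
  simp; ring

lemma abs_drift_le {b : Fin n → ℝ} {B : ℝ} (hb : ∀ i, |b i| ≤ B) (l : ES n →L[ℝ] ℝ) :
    |drift b l| ≤ n * B * ‖l‖ := by
  unfold drift
  refine (Finset.abs_sum_le_sum_abs _ _).trans ?_
  have : ∀ i ∈ Finset.univ, |b i * l (ee i)| ≤ B * ‖l‖ := by
    intro i _
    rw [abs_mul]
    have h1 := l.le_opNorm (ee i)
    rw [norm_ee, mul_one, Real.norm_eq_abs] at h1
    exact mul_le_mul (hb i) h1 (abs_nonneg _) ((abs_nonneg _).trans (hb i))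
  refine (Finset.sum_le_sum this).trans ?_
  simp; linarith

lemma abs_tr_ell {A : Fin n → Fin n → ℝ} {lam Lam : ℝ} (hl : 0 < lam) (h : Ell A lam Lam)
    (H : ES n →L[ℝ] ES n →L[ℝ] ℝ) : |tr A H| ≤ n * Lam * ‖H‖ := by
  obtain ⟨σ, h1, h2⟩ := sqrt_exists A lam Lam hl h.1 h.2
  rw [h1]
  refine (Finset.abs_sum_le_sum_abs _ _).trans ?_
  have : ∀ i ∈ Finset.univ, |H (σ (ee i)) (σ (ee i))| ≤ Lam * ‖H‖ := by
    intro i _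
    refine (abs_H_le _ _ _).trans ?_
    have := (h2 (ee i)).2
    rw [norm_ee] at this
    have h3 := norm_nonneg H
    nlinarith
  refine (Finset.sum_le_sum this).trans ?_
  simp; linarith

lemma sq_norm_facts : ContDiff ℝ 2 (fun y : ES n => ‖y‖ ^ 2) ∧
    (∀ y ξ : ES n, fderiv ℝ (fun y : ES n => ‖y‖ ^ 2) y ξ = 2 * inner ℝ y ξ) ∧
    (∀ y ξ η : ES n, D2 (fun y : ES n => ‖y‖ ^ 2) y ξ η = 2 * inner ℝ ξ η) := by
  have := quad_D2 (n := n) (ContinuousLinearMap.id ℝ (ES n)) 0 0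
  simp only [sub_zero, ContinuousLinearMap.coe_id', id_eq, add_zero] at this
  obtain ⟨h1, h2, h3⟩ := this
  exact ⟨h1.of_le two_le_infty, h2, h3⟩

lemma fderiv_sub' {u v : ES n → ℝ} (hu : ContDiff ℝ 2 u) (hv : ContDiff ℝ 2 v) (x : ES n) :
    fderiv ℝ (fun y => u y - v y) x = fderiv ℝ u x - fderiv ℝ v x :=
  fderiv_fun_sub (hu.differentiable (by norm_num) x) (hv.differentiable (by norm_num) x)

lemma D2_sub' {u v : ES n → ℝ} (hu : ContDiff ℝ 2 u) (hv : ContDiff ℝ 2 v) (x : ES n) :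
    D2 (fun y => u y - v y) x = D2 u x - D2 v x := by
  have : fderiv ℝ (fun y => u y - v y) = fun x => fderiv ℝ u x - fderiv ℝ v x := by
    ext1 x; exact fderiv_sub' hu hv x
  rw [D2, this, fderiv_fun_sub (diff_fderiv hu.contDiffAt) (diff_fderiv hv.contDiffAt)]
  rfl

lemma fderiv_smul' {u : ES n → ℝ} (hu : ContDiff ℝ 2 u) (r : ℝ) (x : ES n) :
    fderiv ℝ (fun y => r * u y) x = r • fderiv ℝ u x :=
  fderiv_const_mul (hu.differentiable (by norm_num) x) r

lemma D2_smul' {u : ES n → ℝ} (hu : ContDiff ℝ 2 u) (r : ℝ) (x : ES n) :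
    D2 (fun y => r * u y) x = r • D2 u x := by
  have : fderiv ℝ (fun y => r * u y) = fun x => r • fderiv ℝ u x := by
    ext1 x; exact fderiv_smul' hu r x
  rw [D2, this, fderiv_fun_const_smul (diff_fderiv hu.contDiffAt)]
  rfl

lemma maxp {a : ES n → Fin n → Fin n → ℝ} {b : ES n → Fin n → ℝ} {u : ES n → ℝ}
    {lam Lam A0 B M δ : ℝ} (hl : 0 < lam) (hL : lam ≤ Lam) (hA : 0 ≤ A0) (hδ : 0 < δ) (hM : 0 ≤ M)
    (hell : ∀ x, Ell (a x) lam Lam) (hb : ∀ x i, |b x i| ≤ A0)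
    (hu : ContDiff ℝ 2 u) (hB : ∀ x, u x ≤ B)
    (h : ∀ x, 0 < u x → δ * u x ≤ tr (a x) (D2 u x) + drift (b x) (fderiv ℝ u x) + M) :
    ∀ x, δ * u x ≤ M := by
  intro x
  obtain ⟨q1, q2, q3⟩ := sq_norm_facts (n := n)
  set q : ES n → ℝ := fun y => ‖y‖ ^ 2 with hq
  set T := B - u 0 with hT
  have T0 : 0 ≤ T := by linarith [hB 0]
  -- main inequality for each t
  have key : ∀ t : ℝ, 0 < t → δ * u x ≤ M + t * (2 * n * Lam * t + 2 * n * A0 * (T + 1) + δ * t * ‖x‖ ^ 2) := by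
    intro t ht
    set w : ES n → ℝ := fun y => u y - t ^ 2 * q y with hw
    have cq : ContDiff ℝ 2 (fun y => t ^ 2 * q y) := contDiff_const.mul q1
    have cw : ContDiff ℝ 2 w := hu.sub cq
    set R := (T + 1) / t with hR
    have R0 : 0 < R := by positivity
    have hRt : t * R = T + 1 := by rw [hR]; field_simp
    obtain ⟨m, hm, hmax⟩ := (isCompact_closedBall (0 : ES n) R).exists_isMaxOn
      ⟨0, mem_closedBall_self R0.le⟩ cw.continuous.continuousOn
    have w0 : w 0 = u 0 := by simp [hw, hq]
    have hglob : ∀ y, w y ≤ w m := by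
      intro y
      rcases le_or_gt ‖y‖ R with hy | hy
      · exact hmax (by simpa using hy)
      · have h0 : w 0 ≤ w m := hmax (mem_closedBall_self R0.le)
        refine le_trans ?_ h0
        rw [w0]
        have h1 : (T + 1) ^ 2 ≤ t ^ 2 * ‖y‖ ^ 2 := by
          rw [← mul_pow, ← hRt]; gcongr
        have h2 : w y = u y - t ^ 2 * ‖y‖ ^ 2 := rfl
        have h3 := hB y
        nlinarith
    have hloc : IsLocalMax w m := Filter.Eventually.of_forall hglob
    obtain ⟨d1, d2⟩ := max_test cw.contDiffAt hloc
    have fw : fderiv ℝ u m = t ^ 2 • fderiv ℝ q m := by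
      rw [hw, fderiv_sub' hu cq, fderiv_smul' q1] at d1
      exact sub_eq_zero.mp d1
    have Dw : D2 w m = D2 u m - t ^ 2 • D2 q m := by
      rw [hw, D2_sub' hu cq, D2_smul' q1]
    have trw : tr (a m) (D2 u m) ≤ t ^ 2 * tr (a m) (D2 q m) := by
      have := tr_nonpos hl (hell m).1 (hell m).2 d2
      rw [Dw, tr_sub, tr_smul] at this
      linarith
    have nq : ‖D2 q m‖ ≤ 2 := by
      apply opnorm2 (by norm_num)
      intro ξ η
      rw [q3, abs_mul]
      have := abs_real_inner_le_norm ξ η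
      norm_num; exact this
    have nq1 : ‖fderiv ℝ q m‖ ≤ 2 * ‖m‖ := by
      apply ContinuousLinearMap.opNorm_le_bound _ (by positivity)
      intro ξ
      rw [q2, norm_mul]
      have := abs_real_inner_le_norm m ξ
      rw [Real.norm_eq_abs, Real.norm_eq_abs]
      norm_num; linarith
    have L0 : 0 < Lam := lt_of_lt_of_le hl hL
    have b1 : tr (a m) (D2 q m) ≤ 2 * n * Lam := by
      have := (le_abs_self _).trans (abs_tr_ell hl (hell m) (D2 q m))
      have h2 : n * Lam * ‖D2 q m‖ ≤ n * Lam * 2 := by gcongr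
      linarith
    have hm' : ‖m‖ ≤ R := by simpa using hm
    have b2 : drift (b m) (fderiv ℝ u m) ≤ t * (2 * n * A0 * (T + 1)) := by
      rw [fw, drift_smul]
      have := (le_abs_self _).trans (abs_drift_le (hb m) (fderiv ℝ q m))
      calc t ^ 2 * drift (b m) (fderiv ℝ q m) ≤ t ^ 2 * (n * A0 * (2 * R)) := by
            gcongr
            refine this.trans ?_
            have : ‖fderiv ℝ q m‖ ≤ 2 * R := by linarith
            gcongr
        _ = t * (2 * n * A0 * (t * R)) := by ring
        _ = _ := by rw [hRt]
    have um : u x ≤ u m + t ^ 2 * ‖x‖ ^ 2 := by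
      have := hglob x
      simp only [hw, hq] at this
      have : 0 ≤ t ^ 2 * ‖m‖ ^ 2 := by positivity
      linarith
    have um' : δ * u x ≤ δ * u m + δ * (t ^ 2 * ‖x‖ ^ 2) := by
      rw [← mul_add]; gcongr
    rcases le_or_gt (u m) 0 with hneg | hpos
    · have : δ * u m ≤ 0 := mul_nonpos_of_nonneg_of_nonpos hδ.le hneg
      have : 0 ≤ t * (2 * n * Lam * t + 2 * n * A0 * (T + 1)) := by positivity
      linarith
    · have := h m hpos
      have h5 : t ^ 2 * tr (a m) (D2 q m) ≤ t ^ 2 * (2 * n * Lam) := by gcongr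
      linarith
  have lim : Tendsto (fun t : ℝ => M + t * (2 * n * Lam * t + 2 * n * A0 * (T + 1) + δ * t * ‖x‖ ^ 2))
      (nhdsWithin 0 (Ioi 0)) (nhds (M + 0 * (2 * n * Lam * 0 + 2 * n * A0 * (T + 1) + δ * 0 * ‖x‖ ^ 2))) := by
    apply Tendsto.mono_left _ nhdsWithin_le_nhds
    apply Continuous.tendsto
    fun_prop
  have := ge_of_tendsto lim (by filter_upwards [self_mem_nhdsWithin] with t ht using key t ht)
  simpa using this
end maxpr

section apriori
variable {n : ℕ}

def N0 (α : ℝ) (f : ES n → ℝ) (M : ℝ) : Prop :=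
  (∀ x, |f x| ≤ M) ∧ ∀ x y, |f x - f y| ≤ M * ‖x - y‖ ^ α

structure N2 (α : ℝ) (u : ES n → ℝ) (M : ℝ) : Prop where
  cd : ContDiff ℝ 2 u
  b0 : ∀ x, |u x| ≤ M
  b1 : ∀ x, ‖fderiv ℝ u x‖ ≤ M
  b2 : ∀ x, ‖D2 u x‖ ≤ M
  h2 : ∀ x y, ‖D2 u x - D2 u y‖ ≤ M * ‖x - y‖ ^ α

structure Cf (α lam Lam A0 δ : ℝ) (a : ES n → Fin n → Fin n → ℝ) (b : ES n → Fin n → ℝ)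
    (c : ES n → ℝ) : Prop where
  ell : ∀ x, Ell (a x) lam Lam
  ha : ∀ x y i j, |a x i j - a y i j| ≤ A0 * ‖x - y‖ ^ α
  bb : ∀ x i, |b x i| ≤ A0
  hb : ∀ x y i, |b x i - b y i| ≤ A0 * ‖x - y‖ ^ α
  cl : ∀ x, δ ≤ c x
  cu : ∀ x, |c x| ≤ A0
  hc : ∀ x y, |c x - c y| ≤ A0 * ‖x - y‖ ^ α

lemma schHyp_mk {α lam Lam A0 G0 G1 M R : ℝ} {x0 : ES n} {a : ES n → Fin n → Fin n → ℝ}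
    {b : ES n → Fin n → ℝ} {c g u : ES n → ℝ} (R1 : R ≤ 1)
    (ell : ∀ x ∈ ball x0 R, Ell (a x) lam Lam)
    (hol : ∀ x ∈ ball x0 R, ∀ y ∈ ball x0 R, ∀ i j, |a x i j - a y i j| ≤ A0 * ‖x - y‖ ^ α)
    (cd : ContDiff ℝ 2 u)
    (bb : ∀ x ∈ ball x0 R, ∀ i, |b x i| ≤ A0)
    (hb : ∀ x ∈ ball x0 R, ∀ y ∈ ball x0 R, ∀ i, |b x i - b y i| ≤ A0 * ‖x - y‖ ^ α)
    (cb : ∀ x ∈ ball x0 R, |c x| ≤ A0)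
    (hc : ∀ x ∈ ball x0 R, ∀ y ∈ ball x0 R, |c x - c y| ≤ A0 * ‖x - y‖ ^ α)
    (heq : ∀ x ∈ ball x0 R, LL a b c u x = g x) (hA0 : 0 ≤ A0) (hG0 : 0 ≤ G0) (hG1 : 0 ≤ G1)
    (hM : 0 ≤ M)
    (hg : ∀ x ∈ ball x0 R, ∀ y ∈ ball x0 R, |g x - g y| ≤ G0 * ‖x - y‖ ^ α + G1 * |u x - u y|)
    (bd : ∀ x ∈ ball x0 R, |u x| ≤ M) :
    SchHyp α lam Lam A0 (G0 + n * A0 + A0 * M) (n * A0 + A0 + G1) M x0 R a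
      (fun x => g x - drift (b x) (fderiv ℝ u x) + c x * u x) u := by
  refine ⟨R1, ell, hol, cd, ?_, ?_, bd⟩
  · intro x hx
    have := heq x hx
    rw [LL] at this
    linarith
  · intro x hx y hy
    have h1 : |drift (b x) (fderiv ℝ u x) - drift (b y) (fderiv ℝ u y)| ≤
        n * (A0 * ‖x - y‖ ^ α) * ‖fderiv ℝ u x‖ + n * A0 * ‖fderiv ℝ u x - fderiv ℝ u y‖ := by
      have e : drift (b x) (fderiv ℝ u x) - drift (b y) (fderiv ℝ u y) =
          drift (fun i => b x i - b y i) (fderiv ℝ u x) +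
          drift (b y) (fderiv ℝ u x - fderiv ℝ u y) := by
        rw [drift_subA, drift_sub]; ring
      rw [e]
      exact (abs_add_le _ _).trans (add_le_add (abs_drift_le (hb x hx y hy) _)
        (abs_drift_le (bb y hy) _))
    have h2 : |c x * u x - c y * u y| ≤ (A0 * ‖x - y‖ ^ α) * M + A0 * |u x - u y| := by
      have e : c x * u x - c y * u y = (c x - c y) * u x + c y * (u x - u y) := by ring
      rw [e]
      refine (abs_add_le _ _).trans ?_
      rw [abs_mul, abs_mul]
      have := bd x hx
      have := hc x hx y hy
      have := cb y hy
      gcongr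
    have h3 := hg x hx y hy
    have e : (g x - drift (b x) (fderiv ℝ u x) + c x * u x) -
      (g y - drift (b y) (fderiv ℝ u y) + c y * u y) = (g x - g y) -
      (drift (b x) (fderiv ℝ u x) - drift (b y) (fderiv ℝ u y)) + (c x * u x - c y * u y) := by ring
    rw [e]
    have h4 := abs_add_le ((g x - g y) -
      (drift (b x) (fderiv ℝ u x) - drift (b y) (fderiv ℝ u y))) (c x * u x - c y * u y)
    have h5 := abs_sub (g x - g y) (drift (b x) (fderiv ℝ u x) - drift (b y) (fderiv ℝ u y))
    have hp : 0 ≤ ‖x - y‖ ^ α := by positivity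
    generalize ‖x - y‖ ^ α = P at *
    have hd := norm_nonneg (fderiv ℝ u x)
    generalize ‖fderiv ℝ u x‖ = d1 at *
    have hd' := norm_nonneg (fderiv ℝ u x - fderiv ℝ u y)
    generalize ‖fderiv ℝ u x - fderiv ℝ u y‖ = d2 at *
    have hw := abs_nonneg (u x - u y)
    generalize |u x - u y| = w at *
    have q1 : 0 ≤ G0 * P * d1 := by positivity
    have q2 : 0 ≤ n * A0 * P := by positivity
    have q3 : 0 ≤ A0 * M * P * d1 := by positivity
    have q4 : 0 ≤ n * A0 * w := by positivity
    have q5 : 0 ≤ A0 * d2 := by positivity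
    have q6 : 0 ≤ G1 * d2 := by positivity
    calc _ ≤ _ := h4
      _ ≤ (G0 * P + G1 * w) + (n * (A0 * P) * d1 + n * A0 * d2) + (A0 * P * M + A0 * w) := by
        linarith
      _ ≤ _ := by linarith

/-- global a priori estimate for semilinear equations with bounded solution -/
lemma apriori_nl (hn : 0 < n) {α lam Lam A0 G0 G1 M δ : ℝ} (ha0 : 0 < α) (ha1 : α < 1)
    (hl : 0 < lam) (hL : lam ≤ Lam) (hA0 : 0 ≤ A0) (hG0 : 0 ≤ G0) (hG1 : 0 ≤ G1) (hM : 0 ≤ M) :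
    ∃ C, 0 ≤ C ∧ ∀ (a : ES n → Fin n → Fin n → ℝ) (b : ES n → Fin n → ℝ) (c g u : ES n → ℝ),
      Cf α lam Lam A0 δ a b c → (∃ Q0, N2 α u Q0) → (∀ x, |u x| ≤ M) →
      (∀ x, LL a b c u x = g x) →
      (∀ x y, |g x - g y| ≤ G0 * ‖x - y‖ ^ α + G1 * |u x - u y|) → N2 α u C := by
  obtain ⟨C, hC, hsch⟩ := schauder (n := n) (F0 := G0 + n * A0 + A0 * M) (F1 := n * A0 + A0 + G1)
    hn ha0 ha1 hl hL hA0 (by positivity) (by positivity) hM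
  have hp : (1 / 2 : ℝ) ^ α ≤ 1 := Real.rpow_le_one (by norm_num) (by norm_num) ha0.le
  have hp0 : 0 < (1 / 2 : ℝ) ^ α := by positivity
  refine ⟨M + C + 2 * C / (1 / 2 : ℝ) ^ α, by positivity, ?_⟩
  rintro a b c g u hcf ⟨Q0, hN⟩ hb heq hg
  have hQ0 : 0 ≤ Q0 := (abs_nonneg _).trans (hN.b0 0)
  have main : ∀ x0, PQ α x0 1 u C ∧ ‖D2 u x0‖ ≤ C ∧ ‖fderiv ℝ u x0‖ ≤ C := by
    intro x0
    have S := schHyp_mk (n := n) (x0 := x0) (R := 1) (α := α) (lam := lam) (Lam := Lam) (A0 := A0)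
      (G0 := G0) (G1 := G1) (M := M) (a := a) (b := b) (c := c) (g := g) (u := u) le_rfl
      (fun x _ => hcf.ell x) (fun x _ y _ => hcf.ha x y) hN.cd (fun x _ => hcf.bb x)
      (fun x _ y _ => hcf.hb x y) (fun x _ => hcf.cu x) (fun x _ y _ => hcf.hc x y)
      (fun x _ => heq x) hA0 hG0 hG1 hM (fun x _ y _ => hg x y) (fun x _ => hb x)
    obtain ⟨h1, h2⟩ := hsch x0 1 a _ u S ⟨Q0, hQ0, hN.h2⟩
    have := h2 x0 (mem_ball_self one_pos)
    simp only [sub_self, norm_zero, sub_zero, one_pow, one_mul] at this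
    exact ⟨h1, this⟩
  have hC' : C ≤ M + C + 2 * C / (1 / 2 : ℝ) ^ α := by
    have : 0 ≤ 2 * C / (1 / 2 : ℝ) ^ α := by positivity
    linarith
  refine ⟨hN.cd, fun x => (hb x).trans ?_, fun x => (main x).2.2.trans hC',
    fun x => (main x).2.1.trans hC', ?_⟩
  · have : 0 ≤ 2 * C / (1 / 2 : ℝ) ^ α := by positivity
    linarith
  · intro x y
    rcases le_or_gt ‖x - y‖ (1 / 2) with h | h
    · have := (main x).1 x (mem_ball_self one_pos) y (by simpa using h)
      simp only [sub_self, norm_zero, sub_zero, one_rpow, one_mul] at this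
      refine this.trans ?_
      gcongr
    · have h1 : ‖D2 u x - D2 u y‖ ≤ 2 * C := by
        have := norm_sub_le (D2 u x) (D2 u y)
        have := (main x).2.1
        have := (main y).2.1
        linarith
      have h2 : (1 / 2 : ℝ) ^ α ≤ ‖x - y‖ ^ α := Real.rpow_le_rpow (by norm_num) h.le ha0.le
      calc _ ≤ 2 * C := h1
        _ = 2 * C / (1 / 2 : ℝ) ^ α * (1 / 2 : ℝ) ^ α := by field_simp
        _ ≤ _ := by
          gcongr
          linarith

lemma N2.smul {α M : ℝ} {u : ES n → ℝ} (h : N2 α u M) {r : ℝ} (hr : 0 ≤ r) : N2 α (fun y => r * u y) (r * M) := by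
  refine ⟨contDiff_const.mul h.cd, ?_, ?_, ?_, ?_⟩
  · intro x; rw [abs_mul, abs_of_nonneg hr]; gcongr; exact h.b0 x
  · intro x; rw [fderiv_smul' h.cd, norm_smul, Real.norm_of_nonneg hr]; gcongr; exact h.b1 x
  · intro x; rw [D2_smul' h.cd, norm_smul, Real.norm_of_nonneg hr]; gcongr; exact h.b2 x
  · intro x y
    rw [D2_smul' h.cd, D2_smul' h.cd, ← smul_sub, norm_smul, Real.norm_of_nonneg hr, mul_assoc]
    gcongr; exact h.h2 x y

lemma N2.mono {α M M' : ℝ} {u : ES n → ℝ} (h : N2 α u M) (hM : M ≤ M') : N2 α u M' :=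
  ⟨h.cd, fun x => (h.b0 x).trans hM, fun x => (h.b1 x).trans hM, fun x => (h.b2 x).trans hM,
    fun x y => (h.h2 x y).trans (by gcongr)⟩

lemma N0.mono {α M M' : ℝ} {u : ES n → ℝ} (h : N0 α u M) (hM : M ≤ M') : N0 α u M' :=
  ⟨fun x => (h.1 x).trans hM, fun x y => (h.2 x y).trans (by gcongr)⟩

lemma N2.sub {α M M' : ℝ} {u v : ES n → ℝ} (h : N2 α u M) (h' : N2 α v M') :
    N2 α (fun y => u y - v y) (M + M') := by
  refine ⟨h.cd.sub h'.cd, ?_, ?_, ?_, ?_⟩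
  · intro x; exact (abs_sub _ _).trans (add_le_add (h.b0 x) (h'.b0 x))
  · intro x; rw [fderiv_sub' h.cd h'.cd]
    exact (norm_sub_le _ _).trans (add_le_add (h.b1 x) (h'.b1 x))
  · intro x; rw [D2_sub' h.cd h'.cd]
    exact (norm_sub_le _ _).trans (add_le_add (h.b2 x) (h'.b2 x))
  · intro x y
    rw [D2_sub' h.cd h'.cd, D2_sub' h.cd h'.cd, add_mul]
    have e : D2 u x - D2 v x - (D2 u y - D2 v y) = (D2 u x - D2 u y) - (D2 v x - D2 v y) := by abel
    rw [e]
    exact (norm_sub_le _ _).trans (add_le_add (h.h2 x y) (h'.h2 x y))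

lemma LL_smul {a : ES n → Fin n → Fin n → ℝ} {b : ES n → Fin n → ℝ} {c u : ES n → ℝ}
    (hu : ContDiff ℝ 2 u) (r : ℝ) (x : ES n) : LL a b c (fun y => r * u y) x = r * LL a b c u x := by
  rw [LL, LL, D2_smul' hu, fderiv_smul' hu, tr_smul, drift_smul]; ring

lemma LL_sub {a : ES n → Fin n → Fin n → ℝ} {b : ES n → Fin n → ℝ} {c u v : ES n → ℝ}
    (hu : ContDiff ℝ 2 u) (hv : ContDiff ℝ 2 v) (x : ES n) :
    LL a b c (fun y => u y - v y) x = LL a b c u x - LL a b c v x := by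
  rw [LL, LL, LL, D2_sub' hu hv, fderiv_sub' hu hv, tr_sub, drift_sub]; ring

/-- sup bound from the maximum principle -/
lemma supbound {α lam Lam A0 δ M Q : ℝ} {a : ES n → Fin n → Fin n → ℝ} {b : ES n → Fin n → ℝ}
    {c u : ES n → ℝ} (hl : 0 < lam) (hL : lam ≤ Lam) (hδ : 0 < δ) (hM : 0 ≤ M)
    (h : Cf α lam Lam A0 δ a b c) (hu : ContDiff ℝ 2 u) (hQ : ∀ x, |u x| ≤ Q)
    (hf : ∀ x, |LL a b c u x| ≤ M) : ∀ x, |u x| ≤ M / δ := by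
  have hA0 : 0 ≤ A0 := (abs_nonneg _).trans (h.cu 0)
  have one : ∀ r : ℝ, |r| = 1 → ∀ x, δ * (r * u x) ≤ M := by
    intro r hr
    refine maxp (a := a) (b := b) (u := fun y => r * u y) (B := Q) hl hL hA0 hδ hM h.ell h.bb
      (contDiff_const.mul hu) ?_ ?_
    · intro x; refine (le_abs_self _).trans ?_; rw [abs_mul, hr, one_mul]; exact hQ x
    · intro x hx
      have h1 := LL_smul (a := a) (b := b) (c := c) hu r x
      have h2 : |r * LL a b c u x| ≤ M := by rw [abs_mul, hr, one_mul]; exact hf x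
      rw [← h1, LL] at h2
      have h3 := (abs_le.mp h2).1
      have h4 : δ * (r * u x) ≤ c x * (r * u x) := by
        gcongr; exact h.cl x
      linarith
  intro x
  rw [le_div_iff₀ hδ, mul_comm]
  rcases abs_choice (u x) with h1 | h1 <;> rw [h1]
  · simpa using one 1 (by simp) x
  · simpa using one (-1) (by simp) x

lemma apriori (hn : 0 < n) {α lam Lam A0 δ : ℝ} (ha0 : 0 < α) (ha1 : α < 1)
    (hl : 0 < lam) (hL : lam ≤ Lam) (hA0 : 0 ≤ A0) (hδ : 0 < δ) :
    ∃ C, 0 ≤ C ∧ ∀ (a : ES n → Fin n → Fin n → ℝ) (b : ES n → Fin n → ℝ) (c u : ES n → ℝ) (M : ℝ),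
      Cf α lam Lam A0 δ a b c → (∃ Q0, N2 α u Q0) → 0 < M → N0 α (LL a b c u) M → N2 α u (C * M) := by
  obtain ⟨C, hC, h⟩ := apriori_nl (n := n) (α := α) (lam := lam) (Lam := Lam) (A0 := A0) (G0 := 1)
    (G1 := 0) (M := 1 / δ) (δ := δ) hn ha0 ha1 hl hL hA0 zero_le_one le_rfl (by positivity)
  refine ⟨C, hC, ?_⟩
  rintro a b c u M hcf ⟨Q0, hN⟩ hM hf
  have hs := supbound hl hL hδ hM.le hcf hN.cd hN.b0 hf.1
  have hMi : 0 ≤ M⁻¹ := by positivity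
  have := h a b c (LL a b c (fun y => M⁻¹ * u y)) (fun y => M⁻¹ * u y) hcf ⟨_, hN.smul hMi⟩ ?_
    (fun _ => rfl) ?_
  · have h2 := this.smul hM.le
    have e : (fun y => M * (M⁻¹ * u y)) = u := by ext y; field_simp
    rw [e, mul_comm] at h2
    exact h2
  · intro x
    rw [abs_mul, abs_of_nonneg hMi]
    calc M⁻¹ * |u x| ≤ M⁻¹ * (M / δ) := by gcongr; exact hs x
      _ = 1 / δ := by field_simp
  · intro x y
    rw [LL_smul hN.cd, LL_smul hN.cd, ← mul_sub, abs_mul, abs_of_nonneg hMi]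
    calc _ ≤ M⁻¹ * (M * ‖x - y‖ ^ α) := by gcongr; exact hf.2 x y
      _ = _ := by field_simp; ring
end apriori

section compactness
variable {n : ℕ}

noncomputable abbrev UF : Ultrafilter ℕ := Filter.hyperfilter ℕ

lemma UF_le : (UF : Filter ℕ) ≤ atTop := by
  rw [← Nat.cofinite_eq_atTop]; exact hyperfilter_le_cofinite

lemma ulim {F : Type*} [NormedAddCommGroup F] [ProperSpace F] {f : ℕ → F} {C : ℝ}
    (h : ∀ᶠ k in (UF : Filter ℕ), ‖f k‖ ≤ C) : ∃ L, Tendsto f UF (nhds L) := by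
  obtain ⟨L, -, hL⟩ := (isCompact_closedBall (0 : F) C).ultrafilter_le_nhds (UF.map f) (by
    rw [le_principal_iff]
    have h' : ∀ᶠ k in (UF : Filter ℕ), f k ∈ closedBall (0 : F) C := h.mono fun k hk => by simpa using hk
    exact h')
  exact ⟨L, hL⟩

lemma taylor_lim {F : Type*} [NormedAddCommGroup F] [NormedSpace ℝ F] {f : ℕ → ES n → F}
    {g : ES n → F} {g' : ES n → ES n →L[ℝ] F} {x : ES n} {r C β : ℝ} (hβ : 0 < β) (hC : 0 ≤ C)
    (hd : ∀ k, Differentiable ℝ (f k))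
    (hh : ∀ᶠ k in (UF : Filter ℕ), ∀ y ∈ ball x r, ∀ z ∈ ball x r,
      ‖fderiv ℝ (f k) z - fderiv ℝ (f k) y‖ ≤ C * ‖z - y‖ ^ β)
    (h0 : ∀ y ∈ ball x r, Tendsto (fun k => f k y) UF (nhds (g y)))
    (h1 : ∀ y ∈ ball x r, Tendsto (fun k => fderiv ℝ (f k) y) UF (nhds (g' y))) :
    ∀ y ∈ ball x r, HasFDerivAt g (g' y) y := by
  intro y hy
  have key : ∀ z ∈ ball x r, ‖g z - g y - g' y (z - y)‖ ≤ C * ‖z - y‖ ^ β * ‖z - y‖ := by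
    intro z hz
    have lim : Tendsto (fun k => f k z - f k y - fderiv ℝ (f k) y (z - y)) UF
        (nhds (g z - g y - g' y (z - y))) := by
      refine ((h0 z hz).sub (h0 y hy)).sub ?_
      exact ((ContinuousLinearMap.apply ℝ F (z - y)).continuous.tendsto _).comp (h1 y hy)
    refine le_of_tendsto lim.norm ?_
    filter_upwards [hh] with k hk
    have cv : Convex ℝ (ball x r ∩ closedBall y ‖z - y‖) :=
      (convex_ball x r).inter (convex_closedBall y _)
    refine cv.norm_image_sub_le_of_norm_fderiv_le' (𝕜 := ℝ) (f := f k) (fun w _ => hd k w) ?_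
      ⟨hy, mem_closedBall_self (norm_nonneg _)⟩ ⟨hz, by simp [dist_eq_norm]⟩
    intro w hw
    refine (hk y hy w hw.1).trans ?_
    have : ‖w - y‖ ≤ ‖z - y‖ := by simpa [dist_eq_norm] using hw.2
    gcongr
  rw [hasFDerivAt_iff_isLittleO]
  refine Asymptotics.IsLittleO.of_bound ?_
  intro c hc
  have lim : Tendsto (fun z : ES n => C * ‖z - y‖ ^ β) (nhds y) (nhds (C * ‖y - y‖ ^ β)) := by
    apply ContinuousAt.tendsto
    have : ContinuousAt (fun z : ES n => ‖z - y‖ ^ β) y :=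
      ContinuousAt.rpow_const (by fun_prop) (Or.inr hβ.le)
    exact this.const_mul C
  rw [sub_self, norm_zero, Real.zero_rpow hβ.ne', mul_zero] at lim
  filter_upwards [lim.eventually (gt_mem_nhds hc), isOpen_ball.mem_nhds hy] with z hz hzb
  exact (key z hzb).trans (by gcongr)

lemma compact_loc {α : ℝ} (ha0 : 0 < α) {Ω : Set (ES n)} (hΩ : IsOpen Ω) {u : ℕ → ES n → ℝ}
    (hu : ∀ k, ContDiff ℝ 2 (u k))
    (hb : ∀ x ∈ Ω, ∃ r > 0, ∃ C, ∀ᶠ k in (UF : Filter ℕ), ∀ y ∈ ball x r, |u k y| ≤ C ∧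
      ‖fderiv ℝ (u k) y‖ ≤ C ∧ ‖D2 (u k) y‖ ≤ C ∧
      ∀ z ∈ ball x r, ‖D2 (u k) z - D2 (u k) y‖ ≤ C * ‖z - y‖ ^ α) :
    ∃ v : ES n → ℝ, ∀ x ∈ Ω, ContDiffAt ℝ 2 v x ∧ Tendsto (fun k => u k x) UF (nhds (v x)) ∧
      Tendsto (fun k => fderiv ℝ (u k) x) UF (nhds (fderiv ℝ v x)) ∧
      Tendsto (fun k => D2 (u k) x) UF (nhds (D2 v x)) := by
  classical
  haveI : ProperSpace (ES n →L[ℝ] ℝ) := FiniteDimensional.proper ℝ _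
  haveI : ProperSpace (ES n →L[ℝ] ES n →L[ℝ] ℝ) := FiniteDimensional.proper ℝ _
  have l0 : ∀ x, ∃ L, x ∈ Ω → Tendsto (fun k => u k x) UF (nhds L) := by
    intro x
    by_cases hx : x ∈ Ω
    · obtain ⟨r, hr, C, h⟩ := hb x hx
      obtain ⟨L, hL⟩ := ulim (f := fun k => u k x) (C := C)
        (h.mono fun k hk => (hk x (mem_ball_self hr)).1)
      exact ⟨L, fun _ => hL⟩
    · exact ⟨0, fun h => absurd h hx⟩
  have l1 : ∀ x, ∃ L, x ∈ Ω → Tendsto (fun k => fderiv ℝ (u k) x) UF (nhds L) := by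
    intro x
    by_cases hx : x ∈ Ω
    · obtain ⟨r, hr, C, h⟩ := hb x hx
      obtain ⟨L, hL⟩ := ulim (f := fun k => fderiv ℝ (u k) x) (C := C)
        (h.mono fun k hk => (hk x (mem_ball_self hr)).2.1)
      exact ⟨L, fun _ => hL⟩
    · exact ⟨0, fun h => absurd h hx⟩
  have l2 : ∀ x, ∃ L, x ∈ Ω → Tendsto (fun k => D2 (u k) x) UF (nhds L) := by
    intro x
    by_cases hx : x ∈ Ω
    · obtain ⟨r, hr, C, h⟩ := hb x hx
      obtain ⟨L, hL⟩ := ulim (f := fun k => D2 (u k) x) (C := C)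
        (h.mono fun k hk => (hk x (mem_ball_self hr)).2.2.1)
      exact ⟨L, fun _ => hL⟩
    · exact ⟨0, fun h => absurd h hx⟩
  choose v hv using l0
  choose v1 hv1 using l1
  choose v2 hv2 using l2
  have loc : ∀ x ∈ Ω, (∃ r > 0, (∀ y ∈ ball x r, HasFDerivAt v (v1 y) y) ∧
      (∀ y ∈ ball x r, HasFDerivAt v1 (v2 y) y)) ∧ ContinuousAt v2 x := by
    intro x hx
    obtain ⟨r1, hr1, hrO⟩ := Metric.isOpen_iff.mp hΩ x hx
    obtain ⟨r, hr, C, h⟩ := hb x hx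
    have hC : 0 ≤ C := by
      obtain ⟨k, hk⟩ := h.exists
      exact (abs_nonneg _).trans (hk x (mem_ball_self hr)).1
    set ρ := min r r1
    have hρ : 0 < ρ := lt_min hr hr1
    have sub1 : ball x ρ ⊆ ball x r := ball_subset_ball (min_le_left _ _)
    have sub2 : ball x ρ ⊆ Ω := (ball_subset_ball (min_le_right _ _)).trans hrO
    refine ⟨⟨ρ, hρ, ?_, ?_⟩, ?_⟩
    · refine taylor_lim (f := u) (β := 1) (C := C) one_pos hC
        (fun k => (hu k).differentiable (by norm_num)) ?_ (fun y hy => hv y (sub2 hy))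
        (fun y hy => hv1 y (sub2 hy))
      filter_upwards [h] with k hk y hy z hz
      rw [Real.rpow_one]
      exact (convex_ball x ρ).norm_image_sub_le_of_norm_fderiv_le (𝕜 := ℝ)
        (fun w _ => diff_fderiv (hu k).contDiffAt) (fun w hw => (hk w (sub1 hw)).2.2.1) hy hz
    · refine taylor_lim (f := fun k => fderiv ℝ (u k)) (β := α) (C := C) ha0 hC
        (fun k w => diff_fderiv (hu k).contDiffAt) ?_ (fun y hy => hv1 y (sub2 hy))
        (fun y hy => hv2 y (sub2 hy))
      filter_upwards [h] with k hk y hy z hz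
      exact (hk y (sub1 hy)).2.2.2 z (sub1 hz)
    · have hol : ∀ z ∈ ball x ρ, ‖v2 z - v2 x‖ ≤ C * ‖z - x‖ ^ α := by
        intro z hz
        refine le_of_tendsto ((hv2 z (sub2 hz)).sub (hv2 x hx)).norm ?_
        filter_upwards [h] with k hk
        exact (hk x (mem_ball_self hr)).2.2.2 z (sub1 hz)
      rw [ContinuousAt, tendsto_iff_norm_sub_tendsto_zero]
      have lim : Tendsto (fun z : ES n => C * ‖z - x‖ ^ α) (nhds x) (nhds (C * ‖x - x‖ ^ α)) := by
        apply ContinuousAt.tendsto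
        have : ContinuousAt (fun z : ES n => ‖z - x‖ ^ α) x :=
          ContinuousAt.rpow_const (by fun_prop) (Or.inr ha0.le)
        exact this.const_mul C
      rw [sub_self, norm_zero, Real.zero_rpow ha0.ne', mul_zero] at lim
      refine tendsto_of_tendsto_of_tendsto_of_le_of_le' tendsto_const_nhds lim
        (Eventually.of_forall fun _ => norm_nonneg _) ?_
      filter_upwards [isOpen_ball.mem_nhds (mem_ball_self hρ)] with z hz using hol z hz
  have f1 : ∀ x ∈ Ω, HasFDerivAt v (v1 x) x := fun x hx => by
    obtain ⟨r, hr, h, -⟩ := (loc x hx).1; exact h x (mem_ball_self hr)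
  have f2 : ∀ x ∈ Ω, HasFDerivAt v1 (v2 x) x := fun x hx => by
    obtain ⟨r, hr, -, h⟩ := (loc x hx).1; exact h x (mem_ball_self hr)
  have e2 : ∀ x ∈ Ω, D2 v x = v2 x := by
    intro x hx
    have : fderiv ℝ v =ᶠ[nhds x] v1 := by
      filter_upwards [hΩ.mem_nhds hx] with y hy using (f1 y hy).fderiv
    rw [D2, this.fderiv_eq]
    exact (f2 x hx).fderiv
  refine ⟨v, fun x hx => ⟨?_, hv x hx, ?_, ?_⟩⟩
  · have c0 : ContDiffAt ℝ 0 v2 x := by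
      rw [contDiffAt_zero]
      exact ⟨Ω, hΩ.mem_nhds hx, fun y hy => (loc y hy).2.continuousWithinAt⟩
    have c1 : ContDiffAt ℝ ((0 : ℕ) + 1) v1 x := by
      rw [contDiffAt_succ_iff_hasFDerivAt (n := 0)]
      exact ⟨v2, ⟨Ω, hΩ.mem_nhds hx, f2⟩, c0⟩
    have c2 : ContDiffAt ℝ ((1 : ℕ) + 1) v x := by
      rw [contDiffAt_succ_iff_hasFDerivAt (n := 1)]
      exact ⟨v1, ⟨Ω, hΩ.mem_nhds hx, f1⟩, by simpa using c1⟩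
    convert c2 using 1
    norm_num
  · rw [(f1 x hx).fderiv]; exact hv1 x hx
  · rw [e2 x hx]; exact hv2 x hx

lemma compact_glob {α M : ℝ} (ha0 : 0 < α) {u : ℕ → ES n → ℝ}
    (hu : ∀ k, N2 α (u k) M) :
    ∃ v : ES n → ℝ, N2 α v M ∧ ∀ x, Tendsto (fun k => u k x) UF (nhds (v x)) ∧
      Tendsto (fun k => fderiv ℝ (u k) x) UF (nhds (fderiv ℝ v x)) ∧
      Tendsto (fun k => D2 (u k) x) UF (nhds (D2 v x)) := by
  obtain ⟨v, hv⟩ := compact_loc (n := n) ha0 isOpen_univ (fun k => (hu k).cd) (fun x _ =>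
    ⟨1, one_pos, M, Eventually.of_forall fun k y _ => ⟨(hu k).b0 y, (hu k).b1 y, (hu k).b2 y,
      fun z _ => (hu k).h2 z y⟩⟩)
  refine ⟨v, ⟨?_, ?_, ?_, ?_, ?_⟩, fun x => (hv x trivial).2⟩
  · exact contDiff_iff_contDiffAt.mpr fun x => (hv x trivial).1
  · exact fun x => le_of_tendsto (hv x trivial).2.1.abs (Eventually.of_forall fun k => (hu k).b0 x)
  · exact fun x => le_of_tendsto (hv x trivial).2.2.1.norm (Eventually.of_forall fun k => (hu k).b1 x)
  · exact fun x => le_of_tendsto (hv x trivial).2.2.2.norm (Eventually.of_forall fun k => (hu k).b2 x)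
  · exact fun x y => le_of_tendsto ((hv x trivial).2.2.2.sub (hv y trivial).2.2.2).norm
      (Eventually.of_forall fun k => (hu k).h2 x y)

lemma tr_cont (A : Fin n → Fin n → ℝ) : Continuous (fun H => tr A H) := by
  unfold tr; fun_prop

lemma drift_cont (b : Fin n → ℝ) : Continuous (fun l => drift b l) := by
  unfold drift; fun_prop

lemma LL_lim {a : ES n → Fin n → Fin n → ℝ} {b : ES n → Fin n → ℝ} {c v : ES n → ℝ}
    {u : ℕ → ES n → ℝ} {x : ES n} (h : Tendsto (fun k => u k x) UF (nhds (v x)) ∧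
      Tendsto (fun k => fderiv ℝ (u k) x) UF (nhds (fderiv ℝ v x)) ∧
      Tendsto (fun k => D2 (u k) x) UF (nhds (D2 v x))) :
    Tendsto (fun k => LL a b c (u k) x) UF (nhds (LL a b c v x)) := by
  refine Tendsto.sub (Tendsto.add ?_ ?_) (h.1.const_mul _)
  · exact ((tr_cont _).tendsto _).comp h.2.2
  · exact ((drift_cont _).tendsto _).comp h.2.1
end compactness

section schwartz
variable {n : ℕ}
open SchwartzMap Laplacian

lemma schwartz_solve (f : SchwartzMap (ES n) ℂ) : ∃ w : SchwartzMap (ES n) ℂ,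
    ∀ x, (Laplacian.laplacian (w : ES n → ℂ)) x - (2 * π) ^ 2 * w x = f x := by
  set g1 : ES n → ℝ := fun x => ‖x‖ ^ 2 with hg1
  set g2 : ES n → ℝ := fun x => (1 + ‖x‖ ^ 2) ^ (-1 : ℝ) with hg2
  have t1 : g1.HasTemperateGrowth := by rw [hg1]; fun_prop
  have t2 : g2.HasTemperateGrowth := Function.hasTemperateGrowth_one_add_norm_sq_rpow (ES n) (-1)
  set v := fourierMultiplierCLM ℂ g2 f with hv
  have hpi : (2 * π) ^ 2 ≠ 0 := by positivity
  refine ⟨-((2 * π) ^ 2)⁻¹ • v, fun x => ?_⟩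
  have key : fourierMultiplierCLM ℂ g1 v + v = f := by
    rw [hv, fourierMultiplierCLM_fourierMultiplierCLM_apply t1 t2, fourierMultiplierCLM_apply,
      fourierMultiplierCLM_apply, ← FourierTransform.fourierInv_add]
    have : smulLeftCLM ℂ (g1 * g2) (FourierTransform.fourier f) + smulLeftCLM ℂ g2 (FourierTransform.fourier f)
        = FourierTransform.fourier f := by
      ext ξ
      rw [add_apply, smulLeftCLM_apply_apply (t1.mul t2), smulLeftCLM_apply_apply t2, ← add_smul]
      have : (g1 * g2) ξ + g2 ξ = 1 := by
        have h0 : (1 + ‖ξ‖ ^ 2) ≠ 0 := by positivity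
        simp only [Pi.mul_apply, hg1, hg2, Real.rpow_neg_one]
        field_simp
        ring
      rw [this, one_smul]
    rw [this, FourierTransform.fourierInv_fourier_eq]
  rw [← laplacian_apply, laplacian_eq_fourierMultiplierCLM, map_smul]
  have kx := DFunLike.congr_fun key x
  rw [← kx]
  have hpi' : (π : ℂ) ≠ 0 := by simp [Real.pi_ne_zero]
  simp only [smul_apply, add_apply, Complex.real_smul, neg_smul, neg_apply]
  push_cast
  change _ = (fourierMultiplierCLM ℂ g1 v) x + v x
  change -((2 * (π:ℂ)) ^ 2 * -(((2 * (π:ℂ)) ^ 2)⁻¹ * (fourierMultiplierCLM ℂ g1 v) x)) - _ = _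
  field_simp
  ring

lemma lap_eq_laplacian {u : ES n → ℝ} (x : ES n) :
    Laplacian.laplacian u x = ∑ i, D2 u x (ee i) (ee i) := by
  rw [InnerProductSpace.laplacian_eq_iteratedFDeriv_orthonormalBasis u (EuclideanSpace.basisFun (Fin n) ℝ)]
  simp only [iteratedFDeriv_two_apply, EuclideanSpace.basisFun_apply]
  rfl

lemma holder_of_lip {F : Type*} [NormedAddCommGroup F] {g : ES n → F} {α B L : ℝ} (ha0 : 0 < α)
    (ha1 : α < 1) (hB : ∀ x, ‖g x‖ ≤ B) (hL : ∀ x y, ‖g x - g y‖ ≤ L * ‖x - y‖) :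
    ∀ x y, ‖g x - g y‖ ≤ (2 * B + |L|) * ‖x - y‖ ^ α := by
  intro x y
  have hB0 : 0 ≤ B := (norm_nonneg _).trans (hB x)
  rcases le_or_gt ‖x - y‖ 1 with h | h
  · have : ‖x - y‖ ≤ ‖x - y‖ ^ α := by
      rcases eq_or_lt_of_le (norm_nonneg (x - y)) with h0 | h0
      · rw [← h0]; positivity
      · conv_lhs => rw [← Real.rpow_one ‖x - y‖]
        exact Real.rpow_le_rpow_of_exponent_ge h0 h ha1.le
    calc _ ≤ L * ‖x - y‖ := hL x y
      _ ≤ |L| * ‖x - y‖ := by gcongr; exact le_abs_self L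
      _ ≤ (2 * B + |L|) * ‖x - y‖ ^ α := by gcongr; linarith
  · have : 1 ≤ ‖x - y‖ ^ α := Real.one_le_rpow h.le ha0.le
    calc _ ≤ ‖g x‖ + ‖g y‖ := norm_sub_le _ _
      _ ≤ (2 * B + |L|) * 1 := by linarith [hB x, hB y, abs_nonneg L]
      _ ≤ _ := by gcongr

lemma schwartz_N2 {α : ℝ} (ha0 : 0 < α) (ha1 : α < 1) (u : SchwartzMap (ES n) ℝ) :
    ∃ Q, N2 α u Q := by
  have hd : ∀ m : ℕ, ∃ C, ∀ x, ‖iteratedFDeriv ℝ m u x‖ ≤ C := by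
    intro m
    obtain ⟨C, -, h⟩ := u.decay 0 m
    exact ⟨C, fun x => by simpa using h x⟩
  obtain ⟨C0, h0⟩ := hd 0
  obtain ⟨C1, h1⟩ := hd 1
  obtain ⟨C2, h2⟩ := hd 2
  obtain ⟨C3, h3⟩ := hd 3
  have e2 : ∀ x, ‖D2 u x‖ ≤ C2 := by
    intro x
    rw [D2, ← norm_iteratedFDeriv_one, norm_iteratedFDeriv_fderiv]; exact h2 x
  have e3 : ∀ x, ‖fderiv ℝ (D2 u) x‖ ≤ C3 := by
    intro x
    have : D2 (u : ES n → ℝ) = fderiv ℝ (fderiv ℝ u) := rfl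
    rw [← norm_iteratedFDeriv_one, this, norm_iteratedFDeriv_fderiv, norm_iteratedFDeriv_fderiv]
    exact h3 x
  have sm := u.smooth'
  have cd : ContDiff ℝ 2 u := sm.of_le two_le_infty
  have dd : Differentiable ℝ (D2 (u : ES n → ℝ)) := by
    have : D2 (u : ES n → ℝ) = fderiv ℝ (fderiv ℝ u) := rfl
    rw [this]
    have c1 : ContDiff ℝ ∞ (fderiv ℝ u) := sm.fderiv_right (by simp)
    have c2 : ContDiff ℝ ∞ (fderiv ℝ (fderiv ℝ u)) := c1.fderiv_right (by simp)
    exact c2.differentiable (by simp)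
  have lip : ∀ x y, ‖D2 u x - D2 u y‖ ≤ C3 * ‖x - y‖ := fun x y =>
    convex_univ.norm_image_sub_le_of_norm_fderiv_le (𝕜 := ℝ) (fun w _ => dd w) (fun w _ => e3 w)
      trivial trivial
  have hh := holder_of_lip ha0 ha1 e2 lip
  have q0 : 0 ≤ C0 := (norm_nonneg _).trans (h0 0)
  have q1 : 0 ≤ C1 := (norm_nonneg _).trans (h1 0)
  have q2 : 0 ≤ C2 := (norm_nonneg _).trans (h2 0)
  have q3 : 0 ≤ |C3| := abs_nonneg _
  refine ⟨C0 + C1 + C2 + (2 * C2 + |C3|), cd, fun x => ?_, fun x => ?_, fun x => (e2 x).trans ?_,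
    fun x y => (hh x y).trans ?_⟩
  · have := h0 x
    rw [norm_iteratedFDeriv_zero, Real.norm_eq_abs] at this
    linarith
  · have := h1 x
    rw [norm_iteratedFDeriv_one] at this
    linarith
  · linarith
  · exact mul_le_mul_of_nonneg_right (by linarith) (by positivity)

def Iid : Fin n → Fin n → ℝ := fun i j => if i = j then 1 else 0

lemma tr_Iid (H : ES n →L[ℝ] ES n →L[ℝ] ℝ) : tr Iid H = ∑ i, H (ee i) (ee i) := by
  unfold tr Iid; simp

lemma Ell_Iid {lam Lam : ℝ} (h1 : lam ≤ 1) (h2 : 1 ≤ Lam) : Ell (n := n) Iid lam Lam := by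
  refine ⟨fun i j => by simp [Iid, eq_comm], fun ξ => ?_⟩
  have : ∑ i, ∑ j, Iid i j * ξ i * ξ j = ‖ξ‖ ^ 2 := by
    rw [EuclideanSpace.norm_sq_eq]
    simp [Iid, sq]
  rw [this]
  constructor <;> nlinarith [sq_nonneg ‖ξ‖]

lemma smooth_solve {α : ℝ} (ha0 : 0 < α) (ha1 : α < 1) {f : ES n → ℝ} (hf : ContDiff ℝ ∞ f)
    (hs : HasCompactSupport f) : ∃ u : ES n → ℝ, (∃ Q, N2 α u Q) ∧
    ∀ x, LL (fun _ => Iid) (fun _ _ => 0) (fun _ => (2 * π) ^ 2) u x = f x := by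
  set fc : ES n → ℂ := fun x => (f x : ℂ) with hfc
  have c1 : ContDiff ℝ ∞ fc := Complex.ofRealCLM.contDiff.comp hf
  have c2 : HasCompactSupport fc := hs.comp_left (g := fun r : ℝ => (r : ℂ)) (by simp)
  obtain ⟨w, hw⟩ := schwartz_solve (c2.toSchwartzMap c1)
  set u : SchwartzMap (ES n) ℝ := w.postcompCLM Complex.reCLM with hu
  refine ⟨u, schwartz_N2 ha0 ha1 u, fun x => ?_⟩
  have e1 : (u : ES n → ℝ) = Complex.reCLM ∘ (w : ES n → ℂ) := rfl
  have e2 : Laplacian.laplacian (u : ES n → ℝ) x = (Laplacian.laplacian (w : ES n → ℂ) x).re := by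
    rw [e1, ContDiffAt.laplacian_CLM_comp_left]
    · rfl
    · exact (w.smooth'.of_le two_le_infty).contDiffAt
  rw [LL, tr_Iid, ← lap_eq_laplacian, e2]
  have := congrArg Complex.re (hw x)
  have h3 : (c2.toSchwartzMap c1) x = (f x : ℂ) := rfl
  rw [h3, Complex.ofReal_re, Complex.sub_re] at this
  have h4 : ((2 * (π : ℂ)) ^ 2 * w x).re = (2 * π) ^ 2 * (w x).re := by
    have : (2 * (π : ℂ)) ^ 2 = (((2 * π) ^ 2 : ℝ) : ℂ) := by push_cast; ring
    rw [this, Complex.re_ofReal_mul]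
  rw [h4] at this
  have h5 : u x = (w x).re := rfl
  rw [h5, ← this]
  simp [drift]
end schwartz

section mollify
variable {n : ℕ}
open MeasureTheory

lemma N0.cont {α M : ℝ} (ha0 : 0 < α) {f : ES n → ℝ} (h : N0 α f M) : Continuous f := by
  rw [continuous_iff_continuousAt]
  intro x
  rw [ContinuousAt, tendsto_iff_norm_sub_tendsto_zero]
  have lim : Tendsto (fun z : ES n => M * ‖z - x‖ ^ α) (nhds x) (nhds (M * ‖x - x‖ ^ α)) := by
    apply ContinuousAt.tendsto
    have : ContinuousAt (fun z : ES n => ‖z - x‖ ^ α) x :=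
      ContinuousAt.rpow_const (by fun_prop) (Or.inr ha0.le)
    exact this.const_mul M
  rw [sub_self, norm_zero, Real.zero_rpow ha0.ne', mul_zero] at lim
  exact tendsto_of_tendsto_of_tendsto_of_le_of_le tendsto_const_nhds lim
    (fun _ => norm_nonneg _) (fun z => h.2 z x)

lemma mollify {α M ε : ℝ} (ha0 : 0 < α) {f : ES n → ℝ} (h : N0 α f M) (hε : 0 < ε) :
    ∃ g : ES n → ℝ, ContDiff ℝ ∞ g ∧ N0 α g M ∧ ∀ x, |g x - f x| ≤ M * ε ^ α := by
  have hM : 0 ≤ M := (abs_nonneg _).trans (h.1 0)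
  let φ : ContDiffBump (0 : ES n) := ⟨ε / 2, ε, by positivity, by linarith⟩
  set ψ : ES n → ℝ := φ.normed volume with hψ
  have cf := h.cont ha0
  have cψ : HasCompactSupport ψ := φ.hasCompactSupport_normed
  have sψ : Function.support ψ ⊆ ball 0 ε := by rw [hψ, φ.support_normed_eq]
  have nψ : ∀ x, 0 ≤ ψ x := φ.nonneg_normed
  have iψ : ∫ x, ψ x = 1 := φ.integral_normed
  have kψ : Continuous ψ := (φ.contDiff_normed (n := ⊤)).continuous
  have intg : ∀ x, Integrable (fun t => ψ t * f (x - t)) := fun x =>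
    (kψ.mul (cf.comp (continuous_const.sub continuous_id))).integrable_of_hasCompactSupport
      (cψ.mul_right)
  set g : ES n → ℝ := fun x => ∫ t, ψ t * f (x - t) with hg
  have bd : ∀ (x : ES n) (F : ES n → ℝ) (B : ℝ), (∀ t, ψ t ≠ 0 → |F t| ≤ B) → |∫ t, ψ t * F t| ≤ B := by
    intro x F B hF
    have h1 : ‖∫ t, ψ t * F t‖ ≤ ∫ t, ψ t * B := by
      refine norm_integral_le_of_norm_le ((kψ.integrable_of_hasCompactSupport cψ).mul_const B) ?_
      refine Eventually.of_forall fun t => ?_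
      rw [norm_mul, Real.norm_of_nonneg (nψ t), Real.norm_eq_abs]
      by_cases h0 : ψ t = 0
      · simp [h0]
      · exact mul_le_mul_of_nonneg_left (hF t h0) (nψ t)
    rwa [integral_mul_const, iψ, one_mul, Real.norm_eq_abs] at h1
  refine ⟨g, ?_, ⟨?_, ?_⟩, ?_⟩
  · have := cψ.contDiff_convolution_left (𝕜 := ℝ) (n := ⊤) (L := ContinuousLinearMap.lsmul ℝ ℝ) (μ := volume)
      (φ.contDiff_normed (n := ⊤)) cf.locallyIntegrable
    exact this
  · exact fun x => bd x _ _ (fun t _ => h.1 _)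
  · intro x y
    have e : g x - g y = ∫ t, ψ t * (f (x - t) - f (y - t)) := by
      simp only [hg, mul_sub]
      rw [integral_sub (intg x) (intg y)]
    rw [e]
    refine bd x _ _ (fun t _ => (h.2 _ _).trans_eq ?_)
    rw [sub_sub_sub_cancel_right]
  · intro x
    have e : g x - f x = ∫ t, ψ t * (f (x - t) - f x) := by
      simp only [hg, mul_sub]
      rw [integral_sub (intg x) ((kψ.integrable_of_hasCompactSupport cψ).mul_const _),
        integral_mul_const, iψ, one_mul]
    rw [e]
    refine bd x _ _ (fun t ht => (h.2 _ _).trans ?_)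
    have : ‖t‖ < ε := by simpa using sψ ht
    have e2 : ‖x - t - x‖ ≤ ε := by rw [sub_sub_cancel_left, norm_neg]; exact this.le
    gcongr

lemma N0.mul {α M M' : ℝ} {f g : ES n → ℝ} (h : N0 α f M) (h' : N0 α g M') :
    N0 α (fun x => f x * g x) (2 * M * M') := by
  have hM : 0 ≤ M := (abs_nonneg _).trans (h.1 0)
  have hM' : 0 ≤ M' := (abs_nonneg _).trans (h'.1 0)
  have hMM : 0 ≤ M * M' := by positivity
  constructor
  · intro x
    rw [abs_mul]
    calc _ ≤ M * M' := mul_le_mul (h.1 x) (h'.1 x) (abs_nonneg _) hM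
      _ ≤ _ := by linarith
  · intro x y
    have e : f x * g x - f y * g y = (f x - f y) * g x + f y * (g x - g y) := by ring
    rw [e]
    refine (abs_add_le _ _).trans ?_
    rw [abs_mul, abs_mul]
    calc _ ≤ (M * ‖x - y‖ ^ α) * M' + M * (M' * ‖x - y‖ ^ α) := by
          have := h.1 y; have := h'.1 x; have := h.2 x y; have := h'.2 x y
          gcongr
      _ = _ := by ring

lemma N0.add {α M M' : ℝ} {f g : ES n → ℝ} (h : N0 α f M) (h' : N0 α g M') :
    N0 α (fun x => f x + g x) (M + M') := by
  constructor
  · intro x; exact (abs_add_le _ _).trans (add_le_add (h.1 x) (h'.1 x))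
  · intro x y
    have e : f x + g x - (f y + g y) = (f x - f y) + (g x - g y) := by ring
    rw [e, add_mul]; exact (abs_add_le _ _).trans (add_le_add (h.2 x y) (h'.2 x y))

lemma N0.smul {α M : ℝ} {f : ES n → ℝ} (h : N0 α f M) (r : ℝ) :
    N0 α (fun x => r * f x) (|r| * M) := by
  constructor
  · intro x; rw [abs_mul]; gcongr; exact h.1 x
  · intro x y; rw [← mul_sub, abs_mul, mul_assoc]; gcongr; exact h.2 x y

lemma N0.sub {α M M' : ℝ} {f g : ES n → ℝ} (h : N0 α f M) (h' : N0 α g M') :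
    N0 α (fun x => f x - g x) (M + M') := by
  have := h.add (h'.smul (-1))
  simpa [sub_eq_add_neg] using this

/-- solvability for `Δ - 4π²` -/
lemma base_solve (hn : 0 < n) {α M : ℝ} (ha0 : 0 < α) (ha1 : α < 1) {f : ES n → ℝ} (h : N0 α f M) :
    ∃ u : ES n → ℝ, (∃ Q, N2 α u Q) ∧
    ∀ x, LL (fun _ => Iid) (fun _ _ => 0) (fun _ => (2 * π) ^ 2) u x = f x := by
  have hM : 0 ≤ M := (abs_nonneg _).trans (h.1 0)
  let ζ : ContDiffBump (0 : ES n) := ⟨1, 2, one_pos, one_lt_two⟩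
  have cζ : ContDiff ℝ ∞ (ζ : ES n → ℝ) := ζ.contDiff
  obtain ⟨Lz, hLz⟩ := cζ.lipschitzWith_of_hasCompactSupport ζ.hasCompactSupport (by simp)
  have lz : ∀ (k : ℕ) (x y : ES n), ‖ζ (((k : ℝ) + 1)⁻¹ • x) - ζ (((k : ℝ) + 1)⁻¹ • y)‖ ≤ Lz * ‖x - y‖ := by
    intro k x y
    have := hLz.dist_le_mul (((k : ℝ) + 1)⁻¹ • x) (((k : ℝ) + 1)⁻¹ • y)
    rw [dist_eq_norm, dist_eq_norm, ← smul_sub, norm_smul] at this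
    refine this.trans ?_
    have h1 : ‖((k : ℝ) + 1)⁻¹‖ ≤ 1 := by
      rw [Real.norm_of_nonneg (by positivity)]
      exact inv_le_one_of_one_le₀ (by linarith [Nat.cast_nonneg (α := ℝ) k])
    have h2 := mul_le_mul_of_nonneg_right h1 (norm_nonneg (x - y))
    rw [one_mul] at h2
    gcongr
  have nz : ∀ k : ℕ, N0 α (fun x => ζ (((k : ℝ) + 1)⁻¹ • x)) (2 * 1 + |(Lz : ℝ)|) := by
    intro k
    have b : ∀ x : ES n, ‖ζ (((k : ℝ) + 1)⁻¹ • x)‖ ≤ 1 := fun x => by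
      rw [Real.norm_of_nonneg (ζ.nonneg)]; exact ζ.le_one
    refine ⟨fun x => (b x).trans (by linarith [abs_nonneg (Lz : ℝ)]), fun x y => ?_⟩
    exact holder_of_lip ha0 ha1 b (lz k) x y
  set Z := 2 * 1 + |(Lz : ℝ)| with hZ
  have Z0 : 0 < Z := by positivity
  choose g hg1 hg2 hg3 using fun k : ℕ => mollify (ε := ((k : ℝ) + 1)⁻¹) ha0 h (by positivity)
  set F : ℕ → ES n → ℝ := fun k x => ζ (((k : ℝ) + 1)⁻¹ • x) * g k x with hF
  have nF : ∀ k, N0 α (F k) (2 * Z * M) := fun k => (nz k).mul (hg2 k)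
  have sF : ∀ k, ContDiff ℝ ∞ (F k) := fun k => (cζ.comp (contDiff_const_smul _)).mul (hg1 k)
  have kF : ∀ k, HasCompactSupport (F k) := by
    intro k
    have : HasCompactSupport (fun x : ES n => ζ (((k : ℝ) + 1)⁻¹ • x)) :=
      ζ.hasCompactSupport.comp_smul (by positivity)
    exact this.mul_right
  choose u hu1 hu2 using fun k => smooth_solve ha0 ha1 (sF k) (kF k)
  have h4 : (0 : ℝ) < (2 * π) ^ 2 := by positivity
  obtain ⟨C, hC, hap⟩ := apriori (n := n) (α := α) (lam := 1) (Lam := 1) (A0 := (2 * π) ^ 2)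
    (δ := (2 * π) ^ 2) hn ha0 ha1 one_pos le_rfl h4.le h4
  have hcf : Cf (n := n) α 1 1 ((2 * π) ^ 2) ((2 * π) ^ 2) (fun _ => Iid) (fun _ _ => 0) (fun _ => (2 * π) ^ 2) := by
    refine ⟨fun x => Ell_Iid le_rfl le_rfl, ?_, ?_, ?_, fun _ => le_rfl, fun _ => (abs_of_pos h4).le, ?_⟩
    · intro x y i j; simp only [sub_self, abs_zero]; positivity
    · intro x i; simp only [abs_zero]; positivity
    · intro x y i; simp only [sub_self, abs_zero]; positivity
    · intro x y; simp only [sub_self, abs_zero]; positivity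
  have nu : ∀ k, N2 α (u k) (C * (2 * Z * M + 1)) := by
    intro k
    refine hap _ _ _ (u k) _ hcf (hu1 k) (by positivity) ?_
    have : LL (fun _ => Iid) (fun _ _ => 0) (fun _ => (2 * π) ^ 2) (u k) = F k := funext (hu2 k)
    rw [this]
    exact (nF k).mono (by linarith)
  obtain ⟨v, hv, hlim⟩ := compact_glob ha0 nu
  refine ⟨v, ⟨_, hv⟩, fun x => ?_⟩
  have l1 := LL_lim (a := fun _ => Iid) (b := fun _ _ => 0) (c := fun _ => (2 * π) ^ 2) (hlim x)
  simp only [hu2] at l1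
  have l2 : Tendsto (fun k => F k x) atTop (nhds (f x)) := by
    have q1 : Tendsto (fun k => g k x) atTop (nhds (f x)) := by
      rw [tendsto_iff_norm_sub_tendsto_zero]
      have q : Tendsto (fun k : ℕ => M * (((k : ℝ) + 1)⁻¹) ^ α) atTop (nhds (M * 0 ^ α)) := by
        have := tendsto_one_div_add_atTop_nhds_zero_nat (𝕜 := ℝ)
        simp only [one_div] at this
        exact (this.rpow_const (Or.inr ha0.le)).const_mul M
      rw [Real.zero_rpow ha0.ne', mul_zero] at q
      exact tendsto_of_tendsto_of_tendsto_of_le_of_le tendsto_const_nhds q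
        (fun _ => norm_nonneg _) (fun k => hg3 k x)
    refine q1.congr' ?_
    obtain ⟨N, hN⟩ := exists_nat_ge ‖x‖
    filter_upwards [eventually_ge_atTop N] with k hk
    have : ζ (((k : ℝ) + 1)⁻¹ • x) = 1 := by
      apply ζ.one_of_mem_closedBall
      rw [mem_closedBall, dist_zero_right, norm_smul, Real.norm_of_nonneg (by positivity)]
      change _ ≤ (1 : ℝ)
      rw [inv_mul_le_iff₀ (by positivity)]
      have : (N : ℝ) ≤ k := by exact_mod_cast hk
      linarith
    simp [hF, this]
  exact tendsto_nhds_unique l1 (l2.mono_left UF_le)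
end mollify

section contmethod
variable {n : ℕ}

lemma N2_zero (α : ℝ) : N2 (n := n) α (fun _ => 0) 0 := by
  have e : fderiv ℝ (fun _ : ES n => (0:ℝ)) = fun _ => 0 := by ext1 x; simp
  have e2 : ∀ x, D2 (fun _ : ES n => (0:ℝ)) x = 0 := by intro x; rw [D2, e]; simp
  refine ⟨contDiff_const, by simp, by simp, ?_, ?_⟩
  · intro x; rw [e2]; simp
  · intro x y; rw [e2, e2]; simp

lemma N2.add {α M M' : ℝ} {u v : ES n → ℝ} (h : N2 α u M) (h' : N2 α v M') :
    N2 α (fun y => u y + v y) (M + M') := by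
  have := h.sub ((N2_zero α).sub h')
  simpa using this

lemma N2.nonneg {α M : ℝ} {u : ES n → ℝ} (h : N2 α u M) : 0 ≤ M := (abs_nonneg _).trans (h.b0 0)

lemma N2.lip0 {α M : ℝ} {u : ES n → ℝ} (h : N2 α u M) (x y : ES n) : |u x - u y| ≤ M * ‖x - y‖ :=
  convex_univ.norm_image_sub_le_of_norm_fderiv_le (𝕜 := ℝ)
    (fun w _ => h.cd.differentiable (by norm_num) w) (fun w _ => h.b1 w) trivial trivial

lemma N2.lip1 {α M : ℝ} {u : ES n → ℝ} (h : N2 α u M) (x y : ES n) :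
    ‖fderiv ℝ u x - fderiv ℝ u y‖ ≤ M * ‖x - y‖ :=
  convex_univ.norm_image_sub_le_of_norm_fderiv_le (𝕜 := ℝ)
    (fun w _ => diff_fderiv h.cd.contDiffAt) (fun w _ => h.b2 w) trivial trivial

lemma N2.h0 {α M : ℝ} (ha0 : 0 < α) (ha1 : α < 1) {u : ES n → ℝ} (h : N2 α u M) (x y : ES n) :
    |u x - u y| ≤ 3 * M * ‖x - y‖ ^ α := by
  have := holder_of_lip (g := u) ha0 ha1 h.b0 h.lip0 x y
  rw [abs_of_nonneg h.nonneg, Real.norm_eq_abs] at this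
  linarith

lemma N2.h1 {α M : ℝ} (ha0 : 0 < α) (ha1 : α < 1) {u : ES n → ℝ} (h : N2 α u M) (x y : ES n) :
    ‖fderiv ℝ u x - fderiv ℝ u y‖ ≤ 3 * M * ‖x - y‖ ^ α := by
  have := holder_of_lip (g := fderiv ℝ u) ha0 ha1 h.b1 h.lip1 x y
  rw [abs_of_nonneg h.nonneg] at this
  linarith

lemma LL_N0 {α lam Lam A0 δ M : ℝ} (ha0 : 0 < α) (ha1 : α < 1) (hl : 0 < lam) (hL : lam ≤ Lam)
    {a : ES n → Fin n → Fin n → ℝ} {b : ES n → Fin n → ℝ} {c u : ES n → ℝ}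
    (hc : Cf α lam Lam A0 δ a b c) (h : N2 α u M) :
    N0 α (LL a b c u) ((n ^ 2 * A0 + n * Lam + 4 * n * A0 + 4 * A0) * M) := by
  have hA0 : 0 ≤ A0 := (abs_nonneg _).trans (hc.cu 0)
  have hM := h.nonneg
  have L0 : 0 ≤ Lam := hl.le.trans hL
  constructor
  · intro x
    have h1 : |tr (a x) (D2 u x)| ≤ n * Lam * M := (abs_tr_ell hl (hc.ell x) _).trans (by
      gcongr; exact h.b2 x)
    have h2 : |drift (b x) (fderiv ℝ u x)| ≤ n * A0 * M := (abs_drift_le (hc.bb x) _).trans (by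
      gcongr; exact h.b1 x)
    have h3 : |c x * u x| ≤ A0 * M := by
      rw [abs_mul]; exact mul_le_mul (hc.cu x) (h.b0 x) (abs_nonneg _) hA0
    rw [LL]
    have h4 := abs_sub (tr (a x) (D2 u x) + drift (b x) (fderiv ℝ u x)) (c x * u x)
    have h5 := abs_add_le (tr (a x) (D2 u x)) (drift (b x) (fderiv ℝ u x))
    have q1 : 0 ≤ n ^ 2 * A0 * M := by positivity
    have q2 : 0 ≤ n * A0 * M := by positivity
    have q3 : 0 ≤ A0 * M := by positivity
    linarith
  · intro x y
    have hp : 0 ≤ ‖x - y‖ ^ α := by positivity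
    have h1 : |tr (a x) (D2 u x) - tr (a y) (D2 u y)| ≤
        n ^ 2 * (A0 * ‖x - y‖ ^ α) * M + n * Lam * (M * ‖x - y‖ ^ α) := by
      have e : tr (a x) (D2 u x) - tr (a y) (D2 u y) =
          tr (fun i j => a x i j - a y i j) (D2 u x) + tr (a y) (D2 u x - D2 u y) := by
        rw [tr_subA, tr_sub]; ring
      rw [e]
      refine (abs_add_le _ _).trans (add_le_add ((abs_tr_le _ _ (hc.ha x y) _).trans ?_)
        ((abs_tr_ell hl (hc.ell y) _).trans ?_))
      · gcongr; exact h.b2 x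
      · gcongr; exact h.h2 x y
    have h2 : |drift (b x) (fderiv ℝ u x) - drift (b y) (fderiv ℝ u y)| ≤
        n * (A0 * ‖x - y‖ ^ α) * M + n * A0 * (3 * M * ‖x - y‖ ^ α) := by
      have e : drift (b x) (fderiv ℝ u x) - drift (b y) (fderiv ℝ u y) =
          drift (fun i => b x i - b y i) (fderiv ℝ u x) +
          drift (b y) (fderiv ℝ u x - fderiv ℝ u y) := by
        rw [drift_subA, drift_sub]; ring
      rw [e]
      refine (abs_add_le _ _).trans (add_le_add ((abs_drift_le (hc.hb x y) _).trans ?_)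
        ((abs_drift_le (hc.bb y) _).trans ?_))
      · gcongr; exact h.b1 x
      · gcongr; exact h.h1 ha0 ha1 x y
    have h3 : |c x * u x - c y * u y| ≤ (A0 * ‖x - y‖ ^ α) * M + A0 * (3 * M * ‖x - y‖ ^ α) := by
      have e : c x * u x - c y * u y = (c x - c y) * u x + c y * (u x - u y) := by ring
      rw [e]
      refine (abs_add_le _ _).trans ?_
      rw [abs_mul, abs_mul]
      have := h.b0 x
      have := hc.hc x y
      have := hc.cu y
      have := h.h0 ha0 ha1 x y
      gcongr
    have e : LL a b c u x - LL a b c u y = (tr (a x) (D2 u x) - tr (a y) (D2 u y)) +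
      (drift (b x) (fderiv ℝ u x) - drift (b y) (fderiv ℝ u y)) - (c x * u x - c y * u y) := by
      rw [LL, LL]; ring
    rw [e]
    have h4 := abs_sub ((tr (a x) (D2 u x) - tr (a y) (D2 u y)) +
      (drift (b x) (fderiv ℝ u x) - drift (b y) (fderiv ℝ u y))) (c x * u x - c y * u y)
    have h5 := abs_add_le (tr (a x) (D2 u x) - tr (a y) (D2 u y))
      (drift (b x) (fderiv ℝ u x) - drift (b y) (fderiv ℝ u y))
    linarith

noncomputable def mixA (t : ℝ) (a : ES n → Fin n → Fin n → ℝ) : ES n → Fin n → Fin n → ℝ :=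
  fun x i j => (1 - t) * Iid i j + t * a x i j
noncomputable def mixB (t : ℝ) (b : ES n → Fin n → ℝ) : ES n → Fin n → ℝ := fun x i => t * b x i
noncomputable def mixC (t : ℝ) (c : ES n → ℝ) : ES n → ℝ := fun x => (1 - t) * (2 * π) ^ 2 + t * c x

lemma Ell.mix {A B : Fin n → Fin n → ℝ} {lam Lam t : ℝ} (hA : Ell A lam Lam) (hB : Ell B lam Lam)
    (t0 : 0 ≤ t) (t1 : t ≤ 1) : Ell (fun i j => (1 - t) * A i j + t * B i j) lam Lam := by
  refine ⟨fun i j => by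
    show (1 - t) * A i j + t * B i j = (1 - t) * A j i + t * B j i
    rw [hA.1 i j, hB.1 i j], fun ξ => ?_⟩
  have e : ∑ i, ∑ j, ((1 - t) * A i j + t * B i j) * ξ i * ξ j =
      (1 - t) * (∑ i, ∑ j, A i j * ξ i * ξ j) + t * ∑ i, ∑ j, B i j * ξ i * ξ j := by
    simp only [Finset.mul_sum, ← Finset.sum_add_distrib]
    refine Finset.sum_congr rfl fun i _ => Finset.sum_congr rfl fun j _ => ?_
    ring
  rw [e]
  have h1 := hA.2 ξ
  have h2 := hB.2 ξ
  have s0 : 0 ≤ 1 - t := by linarith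
  constructor
  · have := mul_le_mul_of_nonneg_left h1.1 s0
    have := mul_le_mul_of_nonneg_left h2.1 t0
    linarith
  · have := mul_le_mul_of_nonneg_left h1.2 s0
    have := mul_le_mul_of_nonneg_left h2.2 t0
    linarith

lemma Cf.mix {α lam Lam A0 δ t : ℝ} (l1 : lam ≤ 1) (L1 : 1 ≤ Lam) (d4 : δ ≤ (2 * π) ^ 2)
    (A4 : (2 * π) ^ 2 ≤ A0)
    {a : ES n → Fin n → Fin n → ℝ} {b : ES n → Fin n → ℝ} {c : ES n → ℝ}
    (h : Cf α lam Lam A0 δ a b c) (t0 : 0 ≤ t) (t1 : t ≤ 1) :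
    Cf α lam Lam A0 δ (mixA t a) (mixB t b) (mixC t c) := by
  have hA0 : 0 ≤ A0 := (abs_nonneg _).trans (h.cu 0)
  have s0 : 0 ≤ 1 - t := by linarith
  have small : ∀ P Q : ℝ, 0 ≤ Q → |P| ≤ Q → |t * P| ≤ Q := by
    intro P Q hQ hP
    rw [abs_mul, abs_of_nonneg t0]
    calc t * |P| ≤ 1 * Q := mul_le_mul t1 hP (abs_nonneg _) zero_le_one
      _ = Q := one_mul Q
  refine ⟨fun x => (Ell_Iid l1 L1).mix (h.ell x) t0 t1, ?_, ?_, ?_, ?_, ?_, ?_⟩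
  · intro x y i j
    have e : mixA t a x i j - mixA t a y i j = t * (a x i j - a y i j) := by simp only [mixA]; ring
    rw [e]; exact small _ _ (by positivity) (h.ha x y i j)
  · intro x i; exact small _ _ hA0 (h.bb x i)
  · intro x y i
    have e : mixB t b x i - mixB t b y i = t * (b x i - b y i) := by simp only [mixB]; ring
    rw [e]; exact small _ _ (by positivity) (h.hb x y i)
  · intro x
    have := mul_le_mul_of_nonneg_left d4 s0
    have := mul_le_mul_of_nonneg_left (h.cl x) t0
    simp only [mixC]; linarith
  · intro x
    have h1 : (1 - t) * (2 * π) ^ 2 ≤ (1 - t) * A0 := mul_le_mul_of_nonneg_left A4 s0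
    have h2 : |t * c x| ≤ t * A0 := by
      rw [abs_mul, abs_of_nonneg t0]; exact mul_le_mul_of_nonneg_left (h.cu x) t0
    have h3 : |(1 - t) * (2 * π) ^ 2| = (1 - t) * (2 * π) ^ 2 := abs_of_nonneg (by positivity)
    have h4 := abs_add_le ((1 - t) * (2 * π) ^ 2) (t * c x)
    simp only [mixC]; linarith
  · intro x y
    have e : mixC t c x - mixC t c y = t * (c x - c y) := by simp only [mixC]; ring
    rw [e]; exact small _ _ (by positivity) (h.hc x y)

lemma LL_mix {a : ES n → Fin n → Fin n → ℝ} {b : ES n → Fin n → ℝ} {c : ES n → ℝ} (u : ES n → ℝ) (t : ℝ)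
    (x : ES n) : LL (mixA t a) (mixB t b) (mixC t c) u x =
      (1 - t) * LL (fun _ => Iid) (fun _ _ => 0) (fun _ => (2 * π) ^ 2) u x + t * LL a b c u x := by
  have h1 : tr (mixA t a x) (D2 u x) = (1 - t) * tr Iid (D2 u x) + t * tr (a x) (D2 u x) := by
    have : mixA t a x = fun i j => (fun i j => (1 - t) * Iid i j) i j + (fun i j => t * a x i j) i j := rfl
    rw [this, tr_addA, tr_smulA, tr_smulA]
  have h2 : drift (mixB t b x) (fderiv ℝ u x) = t * drift (b x) (fderiv ℝ u x) := by
    simp only [drift, mixB, Finset.mul_sum]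
    refine Finset.sum_congr rfl fun i _ => by ring
  have h3 : drift (fun _ => 0) (fderiv ℝ u x) = 0 := by simp [drift]
  rw [LL, LL, LL, h1, h2, h3, mixC]
  ring

def Solv (α : ℝ) (a : ES n → Fin n → Fin n → ℝ) (b : ES n → Fin n → ℝ) (c : ES n → ℝ) : Prop :=
  ∀ f M, N0 α f M → ∃ u : ES n → ℝ, (∃ Q, N2 α u Q) ∧ ∀ x, LL a b c u x = f x

lemma cont_step (hn : 0 < n) {α lam Lam A0 δ : ℝ} (ha0 : 0 < α) (ha1 : α < 1)
    (hl : 0 < lam) (hL : lam ≤ Lam) (hδ : 0 < δ)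
    (l1 : lam ≤ 1) (L1 : 1 ≤ Lam) (d4 : δ ≤ (2 * π) ^ 2) (A4 : (2 * π) ^ 2 ≤ A0)
    {a : ES n → Fin n → Fin n → ℝ} {b : ES n → Fin n → ℝ} {c : ES n → ℝ}
    (h : Cf α lam Lam A0 δ a b c) : ∃ ε > 0, ∀ s t : ℝ, 0 ≤ s → s ≤ 1 → 0 ≤ t → t ≤ 1 → |s - t| ≤ ε →
    Solv α (mixA s a) (mixB s b) (mixC s c) → Solv α (mixA t a) (mixB t b) (mixC t c) := by
  have hA0 : 0 ≤ A0 := (abs_nonneg _).trans (h.cu 0)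
  have L0 : 0 ≤ Lam := by linarith
  obtain ⟨C, hC, hap⟩ := apriori (n := n) hn ha0 ha1 hl hL hA0 hδ
  set K : ℝ := n ^ 2 * A0 + n * Lam + 4 * n * A0 + 4 * A0 with hK
  have K0 : 0 ≤ K := by positivity
  have base : Cf α lam Lam A0 δ (fun _ : ES n => Iid) (fun _ _ => 0) (fun _ => (2 * π) ^ 2) := by
    have h4 : (0:ℝ) < (2 * π) ^ 2 := by positivity
    refine ⟨fun x => Ell_Iid l1 L1, ?_, ?_, ?_, fun _ => d4, fun _ => (abs_of_pos h4).trans_le A4, ?_⟩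
    · intro x y i j; simp only [sub_self, abs_zero]; positivity
    · intro x i; simp only [abs_zero]; positivity
    · intro x y i; simp only [sub_self, abs_zero]; positivity
    · intro x y; simp only [sub_self, abs_zero]; positivity
  refine ⟨1 / (4 * C * K + 4), by positivity, ?_⟩
  intro s t s0 s1 t0 t1 hst hS f M hf
  have cs := h.mix l1 L1 d4 A4 s0 s1
  have hε : C * (|s - t| * (2 * K)) ≤ 1 / 2 := by
    calc C * (|s - t| * (2 * K)) ≤ C * (1 / (4 * C * K + 4) * (2 * K)) := by gcongr
      _ = 2 * C * K / (4 * C * K + 4) := by ring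
      _ ≤ 1 / 2 := by
        rw [div_le_iff₀ (by positivity)]
        linarith
  have ct := h.mix l1 L1 d4 A4 t0 t1
  set Ls := LL (mixA s a) (mixB s b) (mixC s c) with hLs
  set Lt := LL (mixA t a) (mixB t b) (mixC t c) with hLt
  -- solver
  have solver : ∀ w : {w : ES n → ℝ // ∃ Q, N2 α w Q}, ∃ w' : {w : ES n → ℝ // ∃ Q, N2 α w Q},
      ∀ x, Ls w'.1 x = f x + (Ls w.1 x - Lt w.1 x) := by
    rintro ⟨w, Q, hw⟩
    obtain ⟨w', h1, h2⟩ := hS (fun x => f x + (Ls w x - Lt w x)) _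
      (hf.add ((LL_N0 ha0 ha1 hl hL cs hw).sub (LL_N0 ha0 ha1 hl hL ct hw)))
    exact ⟨⟨w', h1⟩, h2⟩
  choose T hT using solver
  let U : ℕ → {w : ES n → ℝ // ∃ Q, N2 α w Q} := fun j => T^[j] ⟨fun _ => 0, 0, N2_zero α⟩
  have hU : ∀ j, U (j + 1) = T (U j) := fun j => Function.iterate_succ_apply' T j _
  have cdU : ∀ j, ContDiff ℝ 2 (U j).1 := fun j => (U j).2.choose_spec.cd
  obtain ⟨B0, hB0⟩ := (U 1).2
  set B := B0 + 1 with hB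
  have Bp : 0 < B := by have := hB0.nonneg; linarith
  have U0 : (U 0).1 = fun _ => 0 := rfl
  have dif : ∀ j, N2 α (fun x => (U (j + 1)).1 x - (U j).1 x) (B / 2 ^ j) := by
    intro j
    induction j with
    | zero =>
      rw [U0]
      simpa using hB0.mono (M' := B) (by linarith)
    | succ j ih =>
      have ex : ∃ Q, N2 α (fun x => (U (j + 1 + 1)).1 x - (U (j + 1)).1 x) Q := by
        obtain ⟨Q1, h1⟩ := (U (j + 1 + 1)).2
        obtain ⟨Q2, h2⟩ := (U (j + 1)).2
        exact ⟨_, h1.sub h2⟩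
      set w : ES n → ℝ := fun x => (U (j + 1)).1 x - (U j).1 x with hw
      have e : Ls (fun x => (U (j + 1 + 1)).1 x - (U (j + 1)).1 x) = fun x =>
          (s - t) * (LL a b c w x - LL (fun _ => Iid) (fun _ _ => 0) (fun _ => (2 * π) ^ 2) w x) := by
        ext1 x
        have e1 := hT (U (j + 1)) x
        have e2 := hT (U j) x
        rw [← hU] at e1 e2
        have e3 : Ls w x = Ls (U (j + 1)).1 x - Ls (U j).1 x := LL_sub (cdU _) (cdU _) x
        have e4 : Lt w x = Lt (U (j + 1)).1 x - Lt (U j).1 x := LL_sub (cdU _) (cdU _) x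
        have e5 : Ls (fun x => (U (j + 1 + 1)).1 x - (U (j + 1)).1 x) x =
          Ls (U (j + 1 + 1)).1 x - Ls (U (j + 1)).1 x := LL_sub (cdU _) (cdU _) x
        have e6 : Ls w x = _ := LL_mix w s x
        have e7 : Lt w x = _ := LL_mix w t x
        have : Ls (fun x => (U (j + 1 + 1)).1 x - (U (j + 1)).1 x) x = Ls w x - Lt w x := by linarith
        rw [this, e6, e7]; ring
      have nn := ((LL_N0 ha0 ha1 hl hL h ih).sub (LL_N0 ha0 ha1 hl hL base ih)).smul (s - t)
      rw [← e] at nn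
      have pos : 0 < B / 2 ^ (j + 1) := by positivity
      rcases hC.eq_or_lt with hC0 | hC0
      · have := hap _ _ _ _ (|s - t| * (K * (B / 2 ^ j) + K * (B / 2 ^ j)) + 1) cs ex (by positivity)
          (nn.mono (by linarith))
        rw [← hC0, zero_mul] at this
        exact this.mono pos.le
      · have := hap _ _ _ _ (B / 2 ^ (j + 1) / C) cs ex (by positivity) (nn.mono ?_)
        · have e8 : C * (B / 2 ^ (j + 1) / C) = B / 2 ^ (j + 1) := by field_simp
          rwa [e8] at this
        · rw [le_div_iff₀ hC0]
          calc _ = C * (|s - t| * (2 * K)) * (B / 2 ^ j) := by rw [hK]; ring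
            _ ≤ 1 / 2 * (B / 2 ^ j) := by gcongr
            _ = _ := by rw [pow_succ]; field_simp
  have bdd : ∀ j, N2 α (U j).1 (2 * B - 2 * B / 2 ^ j) := by
    intro j
    induction j with
    | zero => rw [U0]; simpa using N2_zero α
    | succ j ih =>
      have := ih.add (dif j)
      have e : (fun y => (U j).1 y + ((U (j + 1)).1 y - (U j).1 y)) = (U (j + 1)).1 := by ext y; ring
      rw [e] at this
      convert this using 1
      rw [pow_succ]; field_simp; ring
  obtain ⟨v, hv, hlim⟩ := compact_glob ha0 (M := 2 * B) (u := fun j => (U j).1) (fun j => (bdd j).mono (by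
    have : 0 ≤ 2 * B / 2 ^ j := by positivity
    linarith))
  refine ⟨v, ⟨_, hv⟩, fun x => ?_⟩
  have l1 : Tendsto (fun j => Lt (U j).1 x) UF (nhds (Lt v x)) := LL_lim (hlim x)
  have l2 : Tendsto (fun j => Lt (U j).1 x) atTop (nhds (f x)) := by
    rw [tendsto_iff_norm_sub_tendsto_zero]
    have q : Tendsto (fun j : ℕ => K * (B * (1 / 2) ^ j)) atTop (nhds (K * (B * 0))) :=
      ((tendsto_pow_atTop_nhds_zero_of_lt_one (by norm_num) (by norm_num)).const_mul _).const_mul _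
    rw [mul_zero, mul_zero] at q
    refine tendsto_of_tendsto_of_tendsto_of_le_of_le tendsto_const_nhds q
        (fun _ => norm_nonneg _) (fun j => ?_)
    have e1 := hT (U j) x
    rw [← hU] at e1
    have e5 : Ls (fun x => (U (j + 1)).1 x - (U j).1 x) x =
          Ls (U (j + 1)).1 x - Ls (U j).1 x := LL_sub (cdU _) (cdU _) x
    have e6 : Lt (U j).1 x - f x = -Ls (fun x => (U (j + 1)).1 x - (U j).1 x) x := by linarith
    have := (LL_N0 ha0 ha1 hl hL cs (dif j)).1 x
    rw [← hK] at this
    simp only []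
    rw [e6, norm_neg, Real.norm_eq_abs]
    refine this.trans_eq ?_
    rw [div_pow, one_pow]; ring
  exact tendsto_nhds_unique l1 (l2.mono_left UF_le)

theorem lin_solve (hn : 0 < n) {α lam Lam A0 δ : ℝ} (ha0 : 0 < α) (ha1 : α < 1)
    (hl : 0 < lam) (hL : lam ≤ Lam) (hδ : 0 < δ)
    {a : ES n → Fin n → Fin n → ℝ} {b : ES n → Fin n → ℝ} {c : ES n → ℝ}
    (h : Cf α lam Lam A0 δ a b c) : Solv α a b c := by
  have h' : Cf α (min lam 1) (max Lam 1) (max A0 ((2 * π) ^ 2)) (min δ ((2 * π) ^ 2)) a b c := by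
    have hm : A0 ≤ max A0 ((2 * π) ^ 2) := le_max_left _ _
    refine ⟨fun x => ⟨(h.ell x).1, fun ξ => ⟨?_, ?_⟩⟩, ?_, ?_, ?_, ?_, ?_, ?_⟩
    · refine le_trans ?_ ((h.ell x).2 ξ).1; gcongr; exact min_le_left _ _
    · refine ((h.ell x).2 ξ).2.trans ?_; gcongr; exact le_max_left _ _
    · intro x y i j; refine (h.ha x y i j).trans ?_; gcongr
    · intro x i; exact (h.bb x i).trans hm
    · intro x y i; refine (h.hb x y i).trans ?_; gcongr
    · intro x; exact (min_le_left _ _).trans (h.cl x)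
    · intro x; exact (h.cu x).trans hm
    · intro x y; refine (h.hc x y).trans ?_; gcongr
  obtain ⟨ε, hε, hst⟩ := cont_step hn ha0 ha1 (lt_min hl one_pos)
    ((min_le_left _ _).trans (hL.trans (le_max_left _ _))) (lt_min hδ (by positivity))
    (min_le_right _ _) (le_max_right _ _) (min_le_right _ _) (le_max_right _ _) h'
  obtain ⟨N, hN⟩ := exists_nat_gt (1 / ε)
  have Np : (0 : ℝ) < N := lt_trans (by positivity) hN
  have key : ∀ j : ℕ, j ≤ N → Solv α (mixA (j / N : ℝ) a) (mixB (j / N : ℝ) b) (mixC (j / N : ℝ) c) := by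
    intro j
    induction j with
    | zero =>
      intro _ f M hf
      obtain ⟨u, h1, h2⟩ := base_solve hn ha0 ha1 hf
      refine ⟨u, h1, fun x => ?_⟩
      rw [LL_mix, ← h2 x]; simp
    | succ j ih =>
      intro hj
      have hj' : (j : ℝ) + 1 ≤ N := by exact_mod_cast hj
      refine hst (j / N) _ (by positivity) ?_ (by positivity) ?_ ?_ (ih (by omega))
      · rw [div_le_one Np]; linarith
      · rw [div_le_one Np]; push_cast; exact hj'
      · push_cast
        rw [← sub_div, sub_add_cancel_left, abs_div, abs_neg, abs_one, abs_of_pos Np]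
        rw [div_le_iff₀ Np]
        rw [div_lt_iff₀ hε] at hN
        linarith
  have := key N le_rfl
  rw [div_self Np.ne'] at this
  intro f M hf
  obtain ⟨u, h1, h2⟩ := this f M hf
  refine ⟨u, h1, fun x => ?_⟩
  rw [← h2 x, LL_mix]; ring
end contmethod

section semilinear
variable {n : ℕ}

lemma Cf.addc {α lam Lam A0 δ μ : ℝ} {a : ES n → Fin n → Fin n → ℝ} {b : ES n → Fin n → ℝ}
    {c : ES n → ℝ} (h : Cf α lam Lam A0 δ a b c) (hμ : 0 ≤ μ) :
    Cf α lam Lam (A0 + μ) (δ + μ) a b (fun x => c x + μ) := by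
  have m : A0 ≤ A0 + μ := by linarith
  refine ⟨h.ell, ?_, ?_, ?_, ?_, ?_, ?_⟩
  · intro x y i j; refine (h.ha x y i j).trans ?_; gcongr
  · intro x i; exact (h.bb x i).trans m
  · intro x y i; refine (h.hb x y i).trans ?_; gcongr
  · intro x; have := h.cl x; linarith
  · intro x
    refine (abs_add_le _ _).trans ?_
    rw [abs_of_nonneg hμ]
    have := h.cu x; linarith
  · intro x y
    have : c x + μ - (c y + μ) = c x - c y := by ring
    rw [this]
    refine (h.hc x y).trans ?_; gcongr

theorem semi_solve (hn : 0 < n) {α lam Lam A0 δ : ℝ} (ha0 : 0 < α) (ha1 : α < 1)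
    (hl : 0 < lam) (hL : lam ≤ Lam) (hδ : 0 < δ)
    {a : ES n → Fin n → Fin n → ℝ} {b : ES n → Fin n → ℝ} {c : ES n → ℝ}
    (h : Cf α lam Lam A0 δ a b c) {f : ES n → ℝ} {H : ℝ} (hf : N0 α f H) {G : ℝ → ℝ} {μ : ℝ}
    (hμ : 0 < μ) (G0 : G 0 = 0) (hG : ∀ s t, |G s - G t| ≤ μ * |s - t|) :
    ∃ u : ES n → ℝ, (∃ Q, N2 α u Q) ∧ (∀ x, |u x| ≤ H / δ) ∧
      ∀ x, LL a b c u x = G (u x) + μ * u x + f x := by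
  have hA0 : 0 ≤ A0 := (abs_nonneg _).trans (h.cu 0)
  have hH : 0 ≤ H := (abs_nonneg _).trans (hf.1 0)
  have cs := h.addc hμ.le
  have hd : 0 < δ + μ := by linarith
  obtain ⟨C, hC, hap⟩ := apriori (n := n) hn ha0 ha1 hl hL (A0 := A0 + μ) (by linarith) hd
  have sol := lin_solve hn ha0 ha1 hl hL hd cs
  have Gs : ∀ s, |G s| ≤ μ * |s| := by intro s; have := hG s 0; simpa [G0] using this
  set Ls := LL a b (fun x => c x + μ) with hLs
  have solver : ∀ w : {w : ES n → ℝ // ∃ Q, N2 α w Q}, ∃ w' : {w : ES n → ℝ // ∃ Q, N2 α w Q},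
      ∀ x, Ls w'.1 x = G (w.1 x) + f x := by
    rintro ⟨w, Q, hw⟩
    have hQ := hw.nonneg
    have : N0 α (fun x => G (w x)) (μ * (3 * Q)) := by
      constructor
      · intro x; refine (Gs _).trans ?_; gcongr; have := hw.b0 x; linarith
      · intro x y; refine (hG _ _).trans ?_; rw [mul_assoc]; gcongr; exact hw.h0 ha0 ha1 x y
    obtain ⟨w', h1, h2⟩ := sol _ _ (this.add hf)
    exact ⟨⟨w', h1⟩, h2⟩
  choose T hT using solver
  let U : ℕ → {w : ES n → ℝ // ∃ Q, N2 α w Q} := fun j => T^[j] ⟨fun _ => 0, 0, N2_zero α⟩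
  have hU : ∀ j, U (j + 1) = T (U j) := fun j => Function.iterate_succ_apply' T j _
  have cdU : ∀ j, ContDiff ℝ 2 (U j).1 := fun j => (U j).2.choose_spec.cd
  have U0 : (U 0).1 = fun _ => 0 := rfl
  have eq : ∀ j x, Ls (U (j + 1)).1 x = G ((U j).1 x) + f x := by
    intro j x; rw [hU]; exact hT _ x
  clear_value U
  set S := H / δ with hS
  have S0 : 0 ≤ S := by positivity
  have sup : ∀ j x, |(U j).1 x| ≤ S := by
    intro j
    induction j with
    | zero => intro x; rw [U0]; simpa using S0
    | succ j ih =>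
      have := supbound (M := μ * S + H) hl hL hd (by positivity) cs (cdU (j + 1))
        (U (j + 1)).2.choose_spec.b0 (fun x => by
          rw [← hLs, eq]
          refine (abs_add_le _ _).trans (add_le_add ((Gs _).trans ?_) (hf.1 x))
          gcongr; exact ih x)
      intro x
      refine (this x).trans_eq ?_
      rw [hS]; field_simp; ring
  set r := μ / (δ + μ) with hr
  have r0 : 0 ≤ r := by positivity
  have r1 : r < 1 := by rw [hr, div_lt_one hd]; linarith
  have dif : ∀ j x, |(U (j + 1)).1 x - (U j).1 x| ≤ S * r ^ j := by
    intro j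
    induction j with
    | zero => intro x; rw [U0]; simpa using sup 1 x
    | succ j ih =>
      obtain ⟨Q1, h1⟩ := (U (j + 1 + 1)).2
      obtain ⟨Q2, h2⟩ := (U (j + 1)).2
      have := supbound (M := μ * (S * r ^ j)) hl hL hd (by positivity) cs (h1.sub h2).cd
        (h1.sub h2).b0 (fun x => by
          rw [LL_sub (cdU _) (cdU _) x, ← hLs, eq, eq]
          have e : G ((U (j + 1)).1 x) + f x - (G ((U j).1 x) + f x) =
            G ((U (j + 1)).1 x) - G ((U j).1 x) := by ring
          rw [e]
          refine (hG _ _).trans ?_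
          gcongr; exact ih x)
      intro x
      refine (this x).trans_eq ?_
      rw [pow_succ, hr]; field_simp
  obtain ⟨τ, τ0, hτ⟩ : ∃ τ > 0, C * μ * τ ≤ 1 / 2 := by
    refine ⟨1 / (2 * (C * μ) + 1), by positivity, ?_⟩
    rw [mul_one_div, div_le_iff₀ (by positivity)]; linarith
  set N := 2 * (C * (μ * (2 * S + 2 * S / τ) + H + 1)) with hN
  have N0' : 0 ≤ N := by positivity
  have bdd : ∀ j, N2 α (U j).1 N := by
    intro j
    induction j with
    | zero => rw [U0]; exact (N2_zero α).mono N0'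
    | succ j ih =>
      have lip : ∀ x y, |(U j).1 x - (U j).1 y| ≤ (τ * N + 2 * S / τ) * ‖x - y‖ := fun x y =>
        convex_univ.norm_image_sub_le_of_norm_fderiv_le (𝕜 := ℝ)
          (fun w _ => (cdU j).differentiable (by norm_num) w)
          (fun w _ => interp1s (cdU j) w τ0 (fun z _ => ih.b2 z) (fun z _ => sup j z)) trivial trivial
      have hol := holder_of_lip (g := (U j).1) ha0 ha1 (sup j) lip
      have nn : 0 ≤ τ * N + 2 * S / τ := by positivity
      rw [abs_of_nonneg nn] at hol
      have rhs : N0 α (Ls (U (j + 1)).1) (μ * (2 * S + (τ * N + 2 * S / τ)) + H + 1) := by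
        have e : Ls (U (j + 1)).1 = fun x => G ((U j).1 x) + f x := funext (eq j)
        rw [e]
        refine N0.mono (N0.add (M := μ * (2 * S + (τ * N + 2 * S / τ))) ⟨fun x => ?_, fun x y => ?_⟩ hf) (by linarith)
        · refine (Gs _).trans ?_
          gcongr
          have := sup j x; linarith
        · refine (hG _ _).trans ?_
          rw [mul_assoc]; gcongr; exact hol x y
      refine (hap _ _ _ _ _ cs (U (j + 1)).2 (by positivity) rhs).mono ?_
      have e : C * (μ * (2 * S + (τ * N + 2 * S / τ)) + H + 1) = C * μ * τ * N + N / 2 := by rw [hN]; ring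
      rw [e]
      have := mul_le_mul_of_nonneg_right hτ N0'
      linarith
  obtain ⟨v, hv, hlim⟩ := compact_glob ha0 (M := N) (u := fun j => (U (j + 1)).1) (fun j => bdd (j + 1))
  refine ⟨v, ⟨_, hv⟩, fun x => ?_, fun x => ?_⟩
  · exact le_of_tendsto ((hlim x).1.abs) (Eventually.of_forall fun j => sup (j + 1) x)
  have l1 : Tendsto (fun j => Ls (U (j + 1)).1 x) UF (nhds (Ls v x)) := LL_lim (hlim x)
  have d0 : Tendsto (fun j => (U (j + 1)).1 x - (U j).1 x) atTop (nhds 0) := by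
    have q : Tendsto (fun j : ℕ => S * r ^ j) atTop (nhds (S * 0)) :=
      (tendsto_pow_atTop_nhds_zero_of_lt_one r0 r1).const_mul _
    rw [mul_zero] at q
    exact squeeze_zero_norm (fun j => dif j x) q
  have l2 : Tendsto (fun j => (U j).1 x) UF (nhds (v x)) := by
    have := (hlim x).1.sub (d0.mono_left UF_le)
    simpa using this
  have Gc : Continuous G := by
    refine LipschitzWith.continuous (K := μ.toNNReal) (LipschitzWith.of_dist_le_mul fun s t => ?_)
    rw [Real.coe_toNNReal _ hμ.le]; exact hG s t
  have l3 : Tendsto (fun j => Ls (U (j + 1)).1 x) UF (nhds (G (v x) + f x)) := by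
    simp only [eq]
    exact ((Gc.tendsto _).comp l2).add_const _
  have := tendsto_nhds_unique l1 l3
  rw [hLs, LL] at this
  rw [LL]
  linarith
end semilinear

section pow
variable {n : ℕ}

lemma pw_deriv {κ A B r D t : ℝ} (h : 0 < A + B * t) :
    ContDiffAt ℝ 2 (fun t => κ * (A + B * t) ^ r + D) t ∧
    deriv (fun t => κ * (A + B * t) ^ r + D) t = κ * r * B * (A + B * t) ^ (r - 1) ∧
    deriv (deriv (fun t => κ * (A + B * t) ^ r + D)) t =
      κ * r * (r - 1) * B ^ 2 * (A + B * t) ^ (r - 2) := by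
  have hd : ∀ (r κ D s : ℝ), 0 < A + B * s →
      HasDerivAt (fun t => κ * (A + B * t) ^ r + D) (κ * r * B * (A + B * s) ^ (r - 1)) s := by
    intro r κ D s hs
    have h1 : HasDerivAt (fun t => A + B * t) B s := by
      simpa using ((hasDerivAt_id s).const_mul B).const_add A
    have h2 := ((h1.rpow_const (p := r) (Or.inl hs.ne')).const_mul κ).add_const D
    refine h2.congr_deriv ?_; ring
  have hev : ∀ᶠ s in nhds t, 0 < A + B * s :=
    (Continuous.continuousAt (by fun_prop)).eventually (lt_mem_nhds h)
  refine ⟨?_, (hd r κ D t h).deriv, ?_⟩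
  · refine ContDiffAt.add (contDiffAt_const.mul (ContDiffAt.rpow_const_of_ne (by fun_prop) h.ne')) contDiffAt_const
  · have e : deriv (fun t => κ * (A + B * t) ^ r + D) =ᶠ[nhds t]
        fun s => (κ * r * B) * (A + B * s) ^ (r - 1) + 0 := by
      filter_upwards [hev] with s hs
      rw [(hd r κ D s hs).deriv, add_zero]
    rw [e.deriv_eq, (hd (r - 1) _ 0 t h).deriv]
    have : r - 1 - 1 = r - 2 := by ring
    rw [this]; ring

lemma rpow_lip {p M s t : ℝ} (hp : 1 < p) (hs0 : 0 ≤ s) (hs : s ≤ M) (ht0 : 0 ≤ t) (ht : t ≤ M) :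
    |s ^ p - t ^ p| ≤ p * M ^ (p - 1) * |s - t| := by
  refine Convex.norm_image_sub_le_of_norm_hasDerivWithin_le (f := fun x => x ^ p)
    (f' := fun x => p * x ^ (p - 1)) (s := Icc 0 M) (C := p * M ^ (p - 1))
    (fun x hx => (Real.hasDerivAt_rpow_const (Or.inr hp.le)).hasDerivWithinAt) ?_ (convex_Icc _ _)
    ⟨ht0, ht⟩ ⟨hs0, hs⟩
  intro x hx
  have h0 := hx.1
  rw [Real.norm_eq_abs, abs_of_nonneg (by positivity)]
  have := Real.rpow_le_rpow hx.1 hx.2 (z := p - 1) (by linarith)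
  gcongr

/-- solvability of the penalised problem on the whole space -/
theorem approx_solve (hn : 0 < n) {α lam Lam A0 δ : ℝ} (ha0 : 0 < α) (ha1 : α < 1)
    (hl : 0 < lam) (hL : lam ≤ Lam) (hδ : 0 < δ)
    {a : ES n → Fin n → Fin n → ℝ} {b : ES n → Fin n → ℝ} {c : ES n → ℝ}
    (h : Cf α lam Lam A0 δ a b c) {f : ES n → ℝ} {H p : ℝ} (hp : 1 < p) (hf : N0 α f H)
    (f0 : ∀ x, 0 ≤ f x) :
    ∃ u : ES n → ℝ, (∃ Q, N2 α u Q) ∧ (∀ x, 0 ≤ u x) ∧ ∀ x, LL a b c u x = u x ^ p - f x := by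
  have hA0 : 0 ≤ A0 := (abs_nonneg _).trans (h.cu 0)
  have hH : 0 ≤ H := (abs_nonneg _).trans (hf.1 0)
  set M := H / δ + 1 with hM
  have M0 : 0 < M := by positivity
  set μ := p * M ^ (p - 1) with hμ
  have μ0 : 0 < μ := by positivity
  let cl : ℝ → ℝ := fun t => min (max t 0) M
  have cl0 : ∀ t, 0 ≤ cl t := fun t => le_min (le_max_right _ _) M0.le
  have clM : ∀ t, cl t ≤ M := fun t => min_le_right _ _
  have clm : ∀ s t, s ≤ t → cl s ≤ cl t := fun s t hst => min_le_min_right _ (max_le_max_right _ hst)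
  have cll : ∀ s t, s ≤ t → cl t - cl s ≤ t - s := by
    intro s t hst
    simp only [cl]
    rcases max_cases s 0 with h1 | h1 <;> rcases max_cases t 0 with h2 | h2 <;>
    rcases min_cases (max s 0) M with h3 | h3 <;> rcases min_cases (max t 0) M with h4 | h4 <;> linarith
  have Gm : ∀ s t, s ≤ t → |((cl t) ^ p - μ * t) - ((cl s) ^ p - μ * s)| ≤ μ * |t - s| := by
    intro s t hst
    have h1 := rpow_lip hp (cl0 t) (clM t) (cl0 s) (clM s)
    have h2 := Real.rpow_le_rpow (cl0 s) (clm s t hst) (z := p) (by linarith)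
    have h3 := mul_le_mul_of_nonneg_left (cll s t hst) μ0.le
    have h4 := clm s t hst
    rw [abs_of_nonneg (by linarith), abs_of_nonneg (by linarith), ← hμ] at h1
    rw [abs_of_nonneg (by linarith : 0 ≤ t - s), abs_le]
    constructor <;> linarith
  obtain ⟨u, ⟨Q, hu⟩, hb, he⟩ := semi_solve hn ha0 ha1 hl hL hδ h (f := fun x => (-1) * f x) (H := H)
    (by simpa using hf.smul (-1)) (G := fun t => (cl t) ^ p - μ * t) μ0
    (by
      have : cl 0 = 0 := by simp [cl, M0.le]
      simp only [this, mul_zero, sub_zero]; exact Real.zero_rpow (by linarith))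
    (fun s t => by
      rcases le_total s t with q | q
      · rw [abs_sub_comm, abs_sub_comm s t]; exact Gm s t q
      · exact Gm t s q)
  have he' : ∀ x, LL a b c u x = (cl (u x)) ^ p - f x := by intro x; rw [he]; ring
  have pos : ∀ x, 0 ≤ u x := by
    have := maxp (a := a) (b := b) (u := fun y => (-1) * u y) (B := Q) hl hL hA0 hδ le_rfl h.ell h.bb
      (contDiff_const.mul hu.cd) (fun x => by have := abs_le.mp (hu.b0 x); linarith) (fun x hx => by
        have h1 := LL_smul (a := a) (b := b) (c := c) hu.cd (-1) x
        have h2 : cl (u x) = 0 := by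
          have : max (u x) 0 = 0 := max_eq_right (by linarith)
          simp [cl, this, M0.le]
        rw [he', h2, Real.zero_rpow (by linarith), LL] at h1
        have h3 := f0 x
        have h4 := mul_le_mul_of_nonneg_right (h.cl x) hx.le
        linarith)
    intro x
    have := this x
    by_contra hc
    push Not at hc
    have := mul_neg_of_pos_of_neg hδ hc
    linarith
  refine ⟨u, ⟨Q, hu⟩, pos, fun x => ?_⟩
  rw [he']
  have h1 := (abs_le.mp (hb x)).2
  have : cl (u x) = u x := by
    simp only [cl]; rw [max_eq_left (pos x), min_eq_left (by linarith)]
  rw [this]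

lemma sub_at {u v : ES n → ℝ} {x : ES n} (hu : ContDiffAt ℝ 2 u x) (hv : ContDiffAt ℝ 2 v x) :
    fderiv ℝ (fun y => u y - v y) x = fderiv ℝ u x - fderiv ℝ v x ∧
    D2 (fun y => u y - v y) x = D2 u x - D2 v x := by
  have h1 : ∀ᶠ y in nhds x, ContDiffAt ℝ 2 u y := hu.eventually (by simp)
  have h2 : ∀ᶠ y in nhds x, ContDiffAt ℝ 2 v y := hv.eventually (by simp)
  have e : fderiv ℝ (fun y => u y - v y) =ᶠ[nhds x] fun y => fderiv ℝ u y - fderiv ℝ v y := by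
    filter_upwards [h1, h2] with y a1 a2
    exact fderiv_fun_sub (a1.differentiableAt (by norm_num)) (a2.differentiableAt (by norm_num))
  refine ⟨e.self_of_nhds, ?_⟩
  rw [D2, e.fderiv_eq, fderiv_fun_sub (diff_fderiv hu) (diff_fderiv hv)]
  rfl

lemma quad_id (x0 : ES n) : ContDiff ℝ 2 (fun y : ES n => ‖y - x0‖ ^ 2) ∧
    (∀ y ξ : ES n, fderiv ℝ (fun y : ES n => ‖y - x0‖ ^ 2) y ξ = 2 * inner ℝ (y - x0) ξ) ∧
    (∀ y ξ η : ES n, D2 (fun y : ES n => ‖y - x0‖ ^ 2) y ξ η = 2 * inner ℝ ξ η) := by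
  have := quad_D2 (n := n) (ContinuousLinearMap.id ℝ (ES n)) x0 0
  simp only [ContinuousLinearMap.coe_id', id_eq, add_zero] at this
  obtain ⟨h1, h2, h3⟩ := this
  exact ⟨h1.of_le two_le_infty, h2, h3⟩

/-- Keller–Osserman bound -/
theorem KO {p lam Lam A0 : ℝ} (hp : 1 < p) (hl : 0 < lam) (hL : lam ≤ Lam) (hA0 : 0 ≤ A0) :
    ∃ K, 0 ≤ K ∧ ∀ (x0 : ES n) (ρ : ℝ) (a : ES n → Fin n → Fin n → ℝ) (b : ES n → Fin n → ℝ)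
      (c u : ES n → ℝ), 0 < ρ → ρ ≤ 1 → ContDiff ℝ 2 u → (∀ x, 0 ≤ u x) →
      (∀ x ∈ ball x0 ρ, Ell (a x) lam Lam ∧ (∀ i, |b x i| ≤ A0) ∧ 0 ≤ c x ∧
        LL a b c u x = u x ^ p) → (ρ ^ 2) ^ (2 / (p - 1)) * u x0 ≤ K := by
  have hp1 : 0 < p - 1 := by linarith
  set m := 2 / (p - 1) with hm
  have m0 : 0 < m := by positivity
  have mp : m * p = m + 2 := by rw [hm]; field_simp; ring
  set C : ℝ := n * Lam * (4 * (m * (m + 1)) + 2 * m) + n * A0 * (2 * m) with hC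
  have L0 : 0 ≤ Lam := by linarith
  have C0 : 0 ≤ C := by positivity
  refine ⟨C ^ (1 / (p - 1)), by positivity, ?_⟩
  intro x0 ρ a b c u hρ hρ1 hu u0 heq
  obtain ⟨q1, q2, q3⟩ := quad_id x0
  have contu := hu.continuous
  obtain ⟨y0, hy0, hmax⟩ := (isCompact_closedBall x0 ρ).exists_isMaxOn ⟨x0, mem_closedBall_self hρ.le⟩
    (f := fun y => (ρ ^ 2 - ‖y - x0‖ ^ 2) ^ m * u y)
    ((Continuous.rpow_const (by fun_prop) (fun _ => Or.inr m0.le)).mul contu).continuousOn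
  set κ := (ρ ^ 2 - ‖y0 - x0‖ ^ 2) ^ m * u y0 with hκ
  have hx0 : (ρ ^ 2) ^ m * u x0 ≤ κ := by
    have := hmax (mem_closedBall_self hρ.le)
    simpa using this
  refine hx0.trans ?_
  rcases le_or_gt κ 0 with hk | hk
  · exact hk.trans (by positivity)
  rw [mem_closedBall, dist_eq_norm] at hy0
  have φ0 : 0 ≤ ρ ^ 2 - ‖y0 - x0‖ ^ 2 := by
    have := pow_le_pow_left₀ (norm_nonneg _) hy0 2; linarith
  have φp : 0 < ρ ^ 2 - ‖y0 - x0‖ ^ 2 := by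
    rcases φ0.eq_or_lt with e | e
    · rw [hκ, ← e, Real.zero_rpow m0.ne'] at hk; simp at hk
    · exact e
  have hyb : y0 ∈ ball x0 ρ := by
    rw [mem_ball, dist_eq_norm]
    exact lt_of_pow_lt_pow_left₀ 2 hρ.le (by linarith)
  have pw := pw_deriv (κ := κ) (A := ρ ^ 2) (B := -1) (r := -m) (D := 0) (t := ‖y0 - x0‖ ^ 2) (by linarith)
  obtain ⟨c1, c2, c3⟩ := D2_comp (q := fun y => ‖y - x0‖ ^ 2)
    (F := fun t => κ * (ρ ^ 2 + (-1) * t) ^ (-m) + 0) (x := y0) q1.contDiffAt pw.1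
  rw [pw.2.1] at c2 c3
  rw [pw.2.2] at c3
  set U : ES n → ℝ := fun y => κ * (ρ ^ 2 + (-1) * ‖y - x0‖ ^ 2) ^ (-m) + 0 with hU
  set φ := ρ ^ 2 + (-1) * ‖y0 - x0‖ ^ 2 with hφ
  have eφ : ρ ^ 2 - ‖y0 - x0‖ ^ 2 = φ := by rw [hφ]; ring
  rw [eφ] at φp hκ
  have φ1 : φ ≤ 1 := by
    have : ρ ^ 2 ≤ 1 := pow_le_one₀ hρ.le hρ1
    have := sq_nonneg ‖y0 - x0‖
    linarith
  have Uy0 : U y0 = u y0 := by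
    simp only [hU]
    rw [← hφ, hκ, Real.rpow_neg φp.le, add_zero]
    have : 0 < φ ^ m := by positivity
    field_simp
  have lm : IsLocalMax (fun y => u y - U y) y0 := by
    filter_upwards [isOpen_ball.mem_nhds hyb] with y hy
    rw [Uy0, sub_self, sub_nonpos]
    have h1 := hmax (ball_subset_closedBall hy)
    have h1 : (ρ ^ 2 - ‖y - x0‖ ^ 2) ^ m * u y ≤ κ := by rw [hκ, ← eφ]; exact h1
    have e : ρ ^ 2 + (-1) * ‖y - x0‖ ^ 2 = ρ ^ 2 - ‖y - x0‖ ^ 2 := by ring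
    have hp : 0 < ρ ^ 2 - ‖y - x0‖ ^ 2 := by
      rw [mem_ball, dist_eq_norm] at hy
      have := pow_lt_pow_left₀ hy (norm_nonneg _) two_ne_zero
      linarith
    simp only [hU]
    rw [e, Real.rpow_neg hp.le, add_zero, ← div_eq_mul_inv, le_div_iff₀ (by positivity), mul_comm]
    exact h1
  have mt := max_test (hu.contDiffAt.sub c1) lm
  obtain ⟨s1, s2⟩ := sub_at hu.contDiffAt c1
  obtain ⟨hE, hb, hc, hLL⟩ := heq y0 hyb
  have t1 := tr_nonpos hl hE.1 hE.2 mt.2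
  have d1 : fderiv ℝ u y0 = fderiv ℝ U y0 := by rw [← sub_eq_zero, ← s1]; exact mt.1
  have t1 : tr (a y0) (D2 u y0) ≤ tr (a y0) (D2 U y0) := by
    have e : D2 (fun y => u y - U y) y0 = _ := s2
    have t1' : tr (a y0) (D2 (fun y => u y - U y) y0) ≤ 0 := t1
    rw [e, tr_sub] at t1'; linarith
  have yn : ‖y0 - x0‖ ≤ 1 := hy0.trans hρ1
  have i1 : ∀ ξ, |inner ℝ (y0 - x0) ξ| ≤ ‖ξ‖ := fun ξ =>
    (abs_real_inner_le_norm _ _).trans (by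
      have := mul_le_mul_of_nonneg_right yn (norm_nonneg ξ); linarith)
  have e1 : φ ^ (-m - 1) ≤ φ ^ (-m - 2) := Real.rpow_le_rpow_of_exponent_ge φp φ1 (by linarith)
  set P := φ ^ (-m - 2) with hP
  have P0 : 0 < P := by positivity
  have P1 : 0 < φ ^ (-m - 1) := by positivity
  set P' := φ ^ (-m - 1) with hP'
  have nD : ‖fderiv ℝ U y0‖ ≤ 2 * m * κ * P := by
    refine ContinuousLinearMap.opNorm_le_bound _ (by positivity) fun ξ => ?_
    rw [c2, ContinuousLinearMap.smul_apply, q2, smul_eq_mul, Real.norm_eq_abs, abs_mul, abs_mul 2]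
    have h1 : |κ * -m * -1 * P'| ≤ κ * m * P := by
      have : κ * -m * -1 * P' = κ * m * P' := by ring
      rw [this, abs_of_nonneg (by positivity)]; gcongr
    have h2 : |(2:ℝ)| = 2 := abs_of_pos two_pos
    rw [h2]
    calc _ ≤ κ * m * P * (2 * ‖ξ‖) := by gcongr; exact i1 ξ
      _ = _ := by ring
  have nH : ‖D2 U y0‖ ≤ (4 * (m * (m + 1)) + 2 * m) * κ * P := by
    refine ContinuousLinearMap.opNorm_le_bound₂ _ (by positivity) fun ξ η => ?_
    rw [c3, q2, q2, q3, Real.norm_eq_abs]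
    have h1 : |κ * -m * (-m - 1) * (-1) ^ 2 * P| = κ * (m * (m + 1)) * P := by
      have : κ * -m * (-m - 1) * (-1) ^ 2 * P = κ * (m * (m + 1)) * P := by ring
      rw [this, abs_of_nonneg (by positivity)]
    have h2 : |κ * -m * -1 * P'| ≤ κ * m * P := by
      have : κ * -m * -1 * P' = κ * m * P' := by ring
      rw [this, abs_of_nonneg (by positivity)]; gcongr
    have h3 : |2 * inner ℝ (y0 - x0) ξ * (2 * inner ℝ (y0 - x0) η)| ≤ 2 * ‖ξ‖ * (2 * ‖η‖) := by
      rw [abs_mul, abs_mul, abs_mul, abs_of_pos (two_pos (α := ℝ))]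
      gcongr
      · exact i1 ξ
      · exact i1 η
    have h4 : |2 * inner ℝ ξ η| ≤ 2 * (‖ξ‖ * ‖η‖) := by
      rw [abs_mul, abs_of_pos (two_pos (α := ℝ))]
      gcongr; exact abs_real_inner_le_norm _ _
    refine (abs_add_le _ _).trans ?_
    rw [abs_mul (κ * -m * (-m - 1) * (-1) ^ 2 * P), h1, abs_mul (κ * -m * -1 * P')]
    calc _ ≤ κ * (m * (m + 1)) * P * (2 * ‖ξ‖ * (2 * ‖η‖)) + κ * m * P * (2 * (‖ξ‖ * ‖η‖)) := by gcongr
      _ = _ := by ring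
  have f1 : u y0 ^ p ≤ C * κ * P := by
    rw [← hLL, LL, d1]
    have g1 := (le_abs_self _).trans (abs_tr_ell hl hE (D2 U y0))
    have g2 := (le_abs_self _).trans (abs_drift_le hb (fderiv ℝ U y0))
    have g3 := mul_nonneg hc (u0 y0)
    have g4 : n * Lam * ‖D2 U y0‖ ≤ n * Lam * ((4 * (m * (m + 1)) + 2 * m) * κ * P) := by gcongr
    have g5 : n * A0 * ‖fderiv ℝ U y0‖ ≤ n * A0 * (2 * m * κ * P) := by gcongr
    have g6 : C * κ * P = n * Lam * ((4 * (m * (m + 1)) + 2 * m) * κ * P) + n * A0 * (2 * m * κ * P) := by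
      rw [hC]; ring
    rw [g6]; linarith
  have f2 : u y0 ^ p = κ ^ p * P := by
    rw [← Uy0]; simp only [hU]
    rw [← hφ, add_zero, Real.mul_rpow hk.le (by positivity), ← Real.rpow_mul φp.le, hP]
    congr 2; linarith
  rw [f2] at f1
  have f3 : κ ^ p ≤ C * κ := le_of_mul_le_mul_right f1 P0
  have f4 : κ ^ (p - 1) ≤ C := by
    rw [Real.rpow_sub_one hk.ne', div_le_iff₀ hk]; exact f3
  have f5 := Real.rpow_le_rpow (by positivity) f4 (z := 1 / (p - 1)) (by positivity)
  rwa [← Real.rpow_mul hk.le, mul_one_div_cancel hp1.ne', Real.rpow_one] at f5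
end pow

section barrier
variable {n : ℕ}

lemma bar {A : Fin n → Fin n → ℝ} {lam Lam s e k0 D : ℝ} (hl : 0 < lam) (hE : Ell A lam Lam)
    (x0 : ES n) (s0 : 0 < s) (e0 : 0 < e) (k00 : 0 < k0) : ∃ w Q : ES n → ℝ, ContDiff ℝ 2 w ∧ ∀ x,
    e ≤ Q x ∧ ‖x - x0‖ ^ 2 ≤ Lam * (Q x - e) ∧ lam * (Q x - e) ≤ ‖x - x0‖ ^ 2 ∧
    w x = k0 * Q x ^ (-s) + D ∧
    ‖fderiv ℝ w x‖ ≤ 2 * k0 * s * Q x ^ (-s - 1) * (√(Q x) * (√lam)⁻¹) ∧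
    ‖D2 w x‖ ≤ k0 * s * Q x ^ (-s - 1) * (lam⁻¹ * (4 * s + 6)) ∧
    tr A (D2 w x) = k0 * s * Q x ^ (-s - 1) * (4 * (s + 1) * (1 - e / Q x) - 2 * n) := by
  obtain ⟨σ, σ1, σ2⟩ := sqrt_exists A lam Lam hl hE.1 hE.2
  set S : ES n →L[ℝ] ES n := (σ.symm : ES n →L[ℝ] ES n) with hS
  have Sσ : ∀ ξ, S (σ ξ) = ξ := fun ξ => by simp [hS]
  have S1 : ∀ η, lam * ‖S η‖ ^ 2 ≤ ‖η‖ ^ 2 ∧ ‖η‖ ^ 2 ≤ Lam * ‖S η‖ ^ 2 := by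
    intro η
    have := σ2 (S η)
    have e : σ (S η) = η := by simp [hS]
    rwa [e] at this
  have S2 : ∀ η, ‖S η‖ ≤ (√lam)⁻¹ * ‖η‖ := by
    intro η
    have sl : 0 < √lam := Real.sqrt_pos.mpr hl
    rw [inv_mul_eq_div, le_div_iff₀ sl]
    refine le_of_sq_le_sq ?_ (norm_nonneg _)
    rw [mul_pow, Real.sq_sqrt hl.le]
    linarith [(S1 η).1]
  obtain ⟨q1, q2, q3⟩ := quad_D2 (n := n) S x0 0
  simp only [add_zero] at q1 q2 q3
  set q : ES n → ℝ := fun y => ‖S (y - x0)‖ ^ 2 with hq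
  have qn : ∀ x, 0 ≤ q x := fun x => by positivity
  have Qp : ∀ x, 0 < e + 1 * q x := fun x => by have := qn x; linarith
  have comp : ∀ x, _ := fun x => D2_comp (q := q) (F := fun t => k0 * (e + 1 * t) ^ (-s) + D) (x := x)
    (q1.of_le two_le_infty).contDiffAt (pw_deriv (Qp x)).1
  refine ⟨fun y => k0 * (e + 1 * q y) ^ (-s) + D, fun y => e + 1 * q y,
    contDiff_iff_contDiffAt.mpr fun x => (comp x).1, fun x => ?_⟩
  obtain ⟨-, c2, c3⟩ := comp x
  have pw := pw_deriv (κ := k0) (r := -s) (D := D) (Qp x)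
  rw [pw.2.1] at c2 c3
  rw [pw.2.2] at c3
  have hs := S1 (x - x0)
  have qx : q x = ‖S (x - x0)‖ ^ 2 := rfl
  have qQ : q x ≤ e + 1 * q x := by linarith
  have Qx := Qp x
  set Q := e + 1 * q x with hQ
  have nS : ‖S (x - x0)‖ ≤ √Q := Real.le_sqrt_of_sq_le (by rw [← qx]; exact qQ)
  have Pe : Q ^ (-s - 2) = Q ^ (-s - 1) / Q := by rw [← Real.rpow_sub_one Qx.ne']; congr 1; ring
  set P := Q ^ (-s - 1) with hP
  have P0 : 0 < P := by positivity
  have Qe : Q - e = ‖S (x - x0)‖ ^ 2 := by rw [hQ, qx]; ring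
  have sl : 0 < √lam := Real.sqrt_pos.mpr hl
  have sl2 : (√lam)⁻¹ * (√lam)⁻¹ = lam⁻¹ := by rw [← mul_inv, Real.mul_self_sqrt hl.le]
  have ii : ∀ ξ, |inner ℝ (S (x - x0)) (S ξ)| ≤ √Q * ((√lam)⁻¹ * ‖ξ‖) := fun ξ =>
    (abs_real_inner_le_norm _ _).trans (mul_le_mul nS (S2 ξ) (norm_nonneg _) (Real.sqrt_nonneg _))
  refine ⟨by linarith [qn x], by rw [Qe]; exact hs.2, by rw [Qe]; exact hs.1, rfl, ?_, ?_, ?_⟩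
  · refine ContinuousLinearMap.opNorm_le_bound _ (by positivity) fun ξ => ?_
    rw [c2, ContinuousLinearMap.smul_apply, q2, smul_eq_mul, Real.norm_eq_abs, abs_mul, abs_mul 2]
    have h1 : |k0 * -s * 1 * P| = k0 * s * P := by
      have : k0 * -s * 1 * P = -(k0 * s * P) := by ring
      rw [this, abs_neg, abs_of_nonneg (by positivity)]
    rw [h1, abs_of_pos (two_pos (α := ℝ))]
    calc _ ≤ k0 * s * P * (2 * (√Q * ((√lam)⁻¹ * ‖ξ‖))) := by gcongr; exact ii ξ
      _ = _ := by ring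
  · refine opnorm2 (by positivity) fun ξ η => ?_
    rw [c3, q2, q2, q3]
    have h1 : |k0 * -s * 1 * P| = k0 * s * P := by
      have : k0 * -s * 1 * P = -(k0 * s * P) := by ring
      rw [this, abs_neg, abs_of_nonneg (by positivity)]
    have h2 : |k0 * -s * (-s - 1) * 1 ^ 2 * (P / Q)| = k0 * (s * (s + 1)) * (P / Q) := by
      have : k0 * -s * (-s - 1) * 1 ^ 2 * (P / Q) = k0 * (s * (s + 1)) * (P / Q) := by ring
      rw [this, abs_of_nonneg (by positivity)]
    have h3 : |2 * inner ℝ (S (x - x0)) (S ξ) * (2 * inner ℝ (S (x - x0)) (S η))| ≤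
        2 * (√Q * ((√lam)⁻¹ * ‖ξ‖)) * (2 * (√Q * ((√lam)⁻¹ * ‖η‖))) := by
      rw [abs_mul, abs_mul, abs_mul, abs_of_pos (two_pos (α := ℝ))]
      gcongr
      · exact ii ξ
      · exact ii η
    have h4 : |2 * inner ℝ (S ξ) (S η)| ≤ 2 * (((√lam)⁻¹ * ‖ξ‖) * ((√lam)⁻¹ * ‖η‖)) := by
      rw [abs_mul, abs_of_pos (two_pos (α := ℝ))]
      gcongr
      exact (abs_real_inner_le_norm _ _).trans (mul_le_mul (S2 ξ) (S2 η) (norm_nonneg _) (by positivity))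
    refine (abs_add_le _ _).trans ?_
    rw [Pe, abs_mul (k0 * -s * (-s - 1) * 1 ^ 2 * (P / Q)), h2, abs_mul (k0 * -s * 1 * P), h1]
    calc _ ≤ k0 * (s * (s + 1)) * (P / Q) * (2 * (√Q * ((√lam)⁻¹ * ‖ξ‖)) * (2 * (√Q * ((√lam)⁻¹ * ‖η‖)))) +
          k0 * s * P * (2 * (((√lam)⁻¹ * ‖ξ‖) * ((√lam)⁻¹ * ‖η‖))) := by gcongr
      _ = 4 * (k0 * (s * (s + 1)) * ((P / Q) * (√Q * √Q)) * (((√lam)⁻¹ * (√lam)⁻¹) * (‖ξ‖ * ‖η‖))) +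
          k0 * s * P * (2 * (((√lam)⁻¹ * (√lam)⁻¹) * (‖ξ‖ * ‖η‖))) := by ring
      _ = _ := by
        rw [Real.mul_self_sqrt Qx.le, sl2, div_mul_cancel₀ _ Qx.ne']; ring
  · rw [σ1]
    have h1 : ∀ k, D2 (fun y => k0 * (e + 1 * q y) ^ (-s) + D) x (σ (ee k)) (σ (ee k)) =
        k0 * (s * (s + 1)) * (P / Q) * 4 * (S (x - x0) k) ^ 2 - k0 * s * P * 2 := by
      intro k
      rw [c3, q2, q3, Sσ, inner_ee, Pe, real_inner_self_eq_norm_sq, norm_ee]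
      ring
    simp only [h1]
    rw [Finset.sum_sub_distrib, ← Finset.mul_sum, Finset.sum_const, Finset.card_univ, Fintype.card_fin]
    have h2 : ∑ i, (S (x - x0) i) ^ 2 = Q - e := by
      rw [Qe, EuclideanSpace.norm_sq_eq]
      simp
    rw [h2, nsmul_eq_mul]
    change _ = k0 * s * P * (4 * (s + 1) * (1 - e / Q) - 2 * n)
    field_simp

theorem lower {p lam Lam A0 : ℝ} (hn : 0 < n) (hp : 1 < p) (hl : 0 < lam) (hL : lam ≤ Lam) (hA0 : 0 ≤ A0)
    (hγ : 0 < 4 * (1 / (p - 1) + 1) - 2 * n) :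
    ∃ κ > 0, ∃ θ > 0, ∃ k0 > 0, ∃ R0 > 0, ∀ R, 0 < R → R ≤ R0 → ∃ Cb, 0 ≤ Cb ∧
    ∀ (a : ES n → Fin n → Fin n → ℝ) (b : ES n → Fin n → ℝ) (c u f : ES n → ℝ) (x0 : ES n)
      (A : Fin n → Fin n → ℝ) (δ e : ℝ), 0 < δ → 0 < e →
      (∀ x, Ell (a x) lam Lam ∧ (∀ i, |b x i| ≤ A0) ∧ δ ≤ c x ∧ c x ≤ A0) → Ell A lam Lam →
      ContDiff ℝ 2 u → (∀ x, 0 ≤ u x) → (∀ x, LL a b c u x = u x ^ p - f x) →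
      (∀ x, ‖x - x0‖ ^ 2 ≤ Lam * R → (e * Lam ≤ θ * ‖x - x0‖ ^ 2 ∧ (∀ i j, |a x i j - A i j| ≤ κ) ∧ 0 ≤ f x) ∨
        Cb * e ^ (-(1 / (p - 1)) - 1) ≤ f x) →
      ∀ x, k0 * (e + ‖x - x0‖ ^ 2 / lam) ^ (-(1 / (p - 1))) - k0 * R ^ (-(1 / (p - 1))) ≤ u x := by
  have hp1 : 0 < p - 1 := by linarith
  set s := 1 / (p - 1) with hs
  have s0 : 0 < s := by positivity
  have sp : s * p = s + 1 := by rw [hs]; field_simp; ring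
  set γ := 4 * (s + 1) - 2 * n with hγd
  have Lp : 0 < Lam := by linarith
  have n0 : (0:ℝ) < n := by exact_mod_cast hn
  have sl : 0 < √lam := Real.sqrt_pos.mpr hl
  obtain ⟨θ, θ0, hθ⟩ : ∃ θ > 0, 4 * (s + 1) * θ ≤ γ / 5 := ⟨γ / 5 / (4 * (s + 1)), by positivity, by
    field_simp; rfl⟩
  obtain ⟨κ, κ0, hκ⟩ : ∃ κ > 0, n ^ 2 * κ * (lam⁻¹ * (4 * s + 6)) ≤ γ / 5 :=
    ⟨γ / 5 / (n ^ 2 * (lam⁻¹ * (4 * s + 6))), by positivity, by field_simp; rfl⟩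
  obtain ⟨k0, k00, hk0⟩ : ∃ k0 > 0, k0 ^ (p - 1) ≤ s * γ / 5 := by
    refine ⟨(s * γ / 5) ^ s, by positivity, ?_⟩
    rw [← Real.rpow_mul (by positivity), hs, one_div_mul_cancel hp1.ne', Real.rpow_one]
  obtain ⟨R0, R00, hR1, hR2⟩ : ∃ R0 > 0, 2 * n * A0 * (√R0 * (√lam)⁻¹) ≤ γ / 5 ∧ A0 * R0 ≤ s * γ / 5 := by
    set r := γ / 5 / (2 * n * A0 * (√lam)⁻¹ + 1) with hr
    have r0 : 0 < r := by positivity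
    refine ⟨min (r ^ 2) (s * γ / 5 / (A0 + 1)), by positivity, ?_, ?_⟩
    · have h1 : √(min (r ^ 2) (s * γ / 5 / (A0 + 1))) ≤ r :=
        (Real.sqrt_le_sqrt (min_le_left _ _)).trans_eq (Real.sqrt_sq r0.le)
      calc _ ≤ 2 * n * A0 * (r * (√lam)⁻¹) := by gcongr
        _ = γ / 5 * ((2 * n * A0 * (√lam)⁻¹) / (2 * n * A0 * (√lam)⁻¹ + 1)) := by rw [hr]; ring
        _ ≤ γ / 5 * 1 := by
          gcongr
          rw [div_le_one (by positivity)]; linarith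
        _ = _ := mul_one _
    · calc _ ≤ A0 * (s * γ / 5 / (A0 + 1)) := by gcongr; exact min_le_right _ _
        _ = s * γ / 5 * (A0 / (A0 + 1)) := by ring
        _ ≤ s * γ / 5 * 1 := by
          gcongr
          rw [div_le_one (by positivity)]; linarith
        _ = _ := mul_one _
  refine ⟨κ, κ0, θ, θ0, k0, k00, R0, R00, fun R Rp hR => ?_⟩
  refine ⟨k0 * s * (n * Lam * (lam⁻¹ * (4 * s + 6)) + 2 * n * A0 * (√R * (√lam)⁻¹)) + A0 * (k0 * R) + k0 ^ p,
    by positivity, ?_⟩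
  intro a b c u f x0 A δ e δ0 e0 hco hE hu u0 heq hreg
  obtain ⟨w, Q, cw, hw⟩ := bar (D := -(k0 * R ^ (-s))) hl hE x0 s0 e0 k00
  have key : ∀ x, 0 < w x → w x ^ p - f x ≤ LL a b c w x := by
    intro x wx
    obtain ⟨w1, w2, w3, w4, w5, w6, w7⟩ := hw x
    obtain ⟨ce, cb, cl, cu⟩ := hco x
    have Qp : 0 < Q x := by linarith
    have QR : Q x < R := by
      by_contra hc
      push Not at hc
      have := Real.rpow_le_rpow_of_nonpos Rp hc (z := -s) (by linarith)
      have := mul_le_mul_of_nonneg_left this k00.le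
      linarith
    have xR : ‖x - x0‖ ^ 2 ≤ Lam * R := w2.trans (by gcongr; linarith)
    have wle : w x ≤ k0 * Q x ^ (-s) := by
      have : 0 ≤ k0 * R ^ (-s) := by positivity
      linarith
    have Pe : Q x ^ (-s) = Q x * Q x ^ (-s - 1) := by
      rw [Real.rpow_sub_one Qp.ne']; field_simp
    have wp : w x ^ p ≤ k0 ^ p * Q x ^ (-s - 1) := by
      refine (Real.rpow_le_rpow wx.le wle (by linarith)).trans_eq ?_
      rw [Real.mul_rpow k00.le (by positivity), ← Real.rpow_mul Qp.le]
      congr 2; linarith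
    have Pb : Q x ^ (-s - 1) ≤ e ^ (-s - 1) := Real.rpow_le_rpow_of_nonpos e0 w1 (by linarith)
    set P := Q x ^ (-s - 1) with hP
    have P0 : 0 < P := by positivity
    have sq : √(Q x) ≤ √R := Real.sqrt_le_sqrt QR.le
    have sR : √R ≤ √R0 := Real.sqrt_le_sqrt hR
    -- drift
    have dr := (abs_le.mp ((abs_drift_le cb (fderiv ℝ w x)).trans
      (mul_le_mul_of_nonneg_left w5 (by positivity)))).1
    have dr2 : n * A0 * (2 * k0 * s * P * (√(Q x) * (√lam)⁻¹)) ≤ k0 * s * P * (2 * n * A0 * (√R * (√lam)⁻¹)) := by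
      calc _ = k0 * s * P * (2 * n * A0 * (√(Q x) * (√lam)⁻¹)) := by ring
        _ ≤ _ := by gcongr
    have cw : c x * w x ≤ A0 * (k0 * R) * P := by
      have : c x * w x ≤ A0 * (k0 * (R * P)) := by
        refine mul_le_mul cu (wle.trans ?_) wx.le hA0
        rw [Pe]; gcongr
      linarith
    rw [LL]
    rcases hreg x xR with ⟨g1, g2, g3⟩ | g
    · have d1 := tr_subA (a x) A (D2 w x)
      have d2 := (abs_le.mp ((abs_tr_le _ κ g2 (D2 w x)).trans
        (mul_le_mul_of_nonneg_left w6 (by positivity)))).1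
      rw [d1] at d2
      have m1 : e / Q x ≤ θ := by
        rw [div_le_iff₀ Qp]
        have h1 : e * Lam ≤ (θ * Q x) * Lam := by
          have h2 : θ * ‖x - x0‖ ^ 2 ≤ θ * (Lam * Q x) := by
            gcongr; exact w2.trans (by gcongr; linarith)
          linarith
        exact le_of_mul_le_mul_right h1 Lp
      have m2 : γ - γ / 5 ≤ 4 * (s + 1) * (1 - e / Q x) - 2 * n := by
        have := mul_le_mul_of_nonneg_left m1 (by positivity : 0 ≤ 4 * (s + 1))
        have h2 : 4 * (s + 1) * (1 - e / Q x) = 4 * (s + 1) - 4 * (s + 1) * (e / Q x) := by ring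
        rw [h2, hγd]
        linarith
      have ksP : 0 < k0 * s * P := by positivity
      have m3 := mul_le_mul_of_nonneg_left m2 ksP.le
      have m4 := mul_le_mul_of_nonneg_left hκ ksP.le
      have m5 : k0 * s * P * (2 * n * A0 * (√R * (√lam)⁻¹)) ≤ k0 * s * P * (γ / 5) := by
        gcongr; refine le_trans ?_ hR1; gcongr
      have m6 : A0 * (k0 * R) * P ≤ k0 * P * (s * γ / 5) := by
        calc _ = k0 * P * (A0 * R) := by ring
          _ ≤ _ := by gcongr; refine le_trans ?_ hR2; gcongr
      have m7 : k0 ^ p * P ≤ k0 * P * (s * γ / 5) := by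
        have : k0 ^ p = k0 * k0 ^ (p - 1) := by rw [Real.rpow_sub_one k00.ne']; field_simp
        rw [this]
        calc _ = k0 * P * (k0 ^ (p - 1)) := by ring
          _ ≤ _ := by gcongr
      have m8 : n ^ 2 * κ * (k0 * s * P * (lam⁻¹ * (4 * s + 6))) = k0 * s * P * (n ^ 2 * κ * (lam⁻¹ * (4 * s + 6))) := by ring
      have m9 : 0 ≤ k0 * P * (s * γ) := by positivity
      linarith
    · have d2 := (abs_le.mp ((abs_tr_ell hl ce (D2 w x)).trans
        (mul_le_mul_of_nonneg_left w6 (by positivity)))).1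
      have h1 : (k0 * s * (n * Lam * (lam⁻¹ * (4 * s + 6)) + 2 * n * A0 * (√R * (√lam)⁻¹)) + A0 * (k0 * R) + k0 ^ p) * P ≤ f x :=
        le_trans (by gcongr) g
      linarith
  have hpos : ∀ x, w x ≤ u x := by
    have := maxp (a := a) (b := b) (u := fun y => w y - u y) (B := k0 * e ^ (-s)) (M := 0) hl hL hA0 δ0 le_rfl
      (fun x => (hco x).1) (fun x => (hco x).2.1) (cw.sub hu) (fun x => by
        obtain ⟨w1, -, -, w4, -⟩ := hw x
        have h1 : k0 * Q x ^ (-s) ≤ k0 * e ^ (-s) :=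
          mul_le_mul_of_nonneg_left (Real.rpow_le_rpow_of_nonpos e0 w1 (by linarith)) k00.le
        have h2 : 0 ≤ k0 * R ^ (-s) := by positivity
        have := u0 x
        linarith) (fun x hx => by
        have h1 := LL_sub (a := a) (b := b) (c := c) cw hu x
        have h2 := u0 x
        have h3 := key x (by linarith)
        have h4 := Real.rpow_le_rpow h2 (by linarith : u x ≤ w x) (z := p) (by linarith)
        rw [heq x, LL] at h1
        have h5 := mul_le_mul_of_nonneg_right (hco x).2.2.1 hx.le
        linarith)
    intro x
    by_contra hc
    push Not at hc
    have := mul_pos δ0 (sub_pos.mpr hc)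
    linarith [this, ‹∀ x, δ * (w x - u x) ≤ 0› x]
  intro x
  refine le_trans ?_ (hpos x)
  obtain ⟨w1, w2, w3, w4, -⟩ := hw x
  have h1 : Q x ≤ e + ‖x - x0‖ ^ 2 / lam := by
    have : Q x - e ≤ ‖x - x0‖ ^ 2 / lam := by rw [le_div_iff₀ hl]; linarith
    linarith
  have h2 := mul_le_mul_of_nonneg_left
    (Real.rpow_le_rpow_of_nonpos (by linarith) h1 (z := -s) (by linarith)) k00.le
  linarith
end barrier

section assembly
variable {n : ℕ}

theorem interior_est (hn : 0 < n) {α lam Lam A0 M p r : ℝ} (ha0 : 0 < α) (ha1 : α < 1)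
    (hl : 0 < lam) (hL : lam ≤ Lam) (hA0 : 0 ≤ A0) (hM : 0 ≤ M) (hp : 1 < p) (r0 : 0 < r) (r1 : r ≤ 1) :
    ∃ C, ∀ (x0 : ES n) (a : ES n → Fin n → Fin n → ℝ) (b : ES n → Fin n → ℝ)
      (c u : ES n → ℝ), (∀ x ∈ ball x0 r, Ell (a x) lam Lam) →
      (∀ x ∈ ball x0 r, ∀ y ∈ ball x0 r, ∀ i j, |a x i j - a y i j| ≤ A0 * ‖x - y‖ ^ α) →
      (∀ x ∈ ball x0 r, ∀ i, |b x i| ≤ A0) →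
      (∀ x ∈ ball x0 r, ∀ y ∈ ball x0 r, ∀ i, |b x i - b y i| ≤ A0 * ‖x - y‖ ^ α) →
      (∀ x ∈ ball x0 r, |c x| ≤ A0) →
      (∀ x ∈ ball x0 r, ∀ y ∈ ball x0 r, |c x - c y| ≤ A0 * ‖x - y‖ ^ α) →
      (∃ Q, N2 α u Q) → (∀ x ∈ ball x0 r, 0 ≤ u x ∧ u x ≤ M) →
      (∀ x ∈ ball x0 r, LL a b c u x = u x ^ p) →
      ∀ y ∈ ball x0 (r / 8), |u y| ≤ C ∧ ‖fderiv ℝ u y‖ ≤ C ∧ ‖D2 u y‖ ≤ C ∧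
        ∀ z ∈ ball x0 (r / 8), ‖D2 u z - D2 u y‖ ≤ C * ‖z - y‖ ^ α := by
  have G1 : 0 ≤ p * M ^ (p - 1) := by positivity
  obtain ⟨C, hC, hsch⟩ := schauder (n := n) (F0 := 0 + n * A0 + A0 * M)
    (F1 := n * A0 + A0 + p * M ^ (p - 1)) hn ha0 ha1 hl hL hA0 (by positivity) (by positivity) hM
  refine ⟨M + C / (r / 2) + C / (r / 2) ^ 2 + C / (r / 2) ^ (2 + α), ?_⟩
  rintro x0 a b c u h1 h2 h3 h4 h5 h6 ⟨Q, hQ⟩ h7 h8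
  obtain ⟨pq, bd⟩ := hsch x0 r a _ u (schHyp_mk (g := fun x => u x ^ p) (G0 := 0) (G1 := p * M ^ (p - 1))
    r1 h1 h2 hQ.cd h3 h4 h5 h6 h8 hA0 le_rfl G1 hM (fun x hx y hy => by
      rw [zero_mul, zero_add]
      exact rpow_lip hp (h7 x hx).1 (h7 x hx).2 (h7 y hy).1 (h7 y hy).2)
    (fun x hx => by rw [abs_of_nonneg (h7 x hx).1]; exact (h7 x hx).2)) ⟨Q, hQ.nonneg, hQ.h2⟩
  have c1 : 0 ≤ C / (r / 2) := by positivity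
  have c2 : 0 ≤ C / (r / 2) ^ 2 := by positivity
  have c3 : 0 ≤ C / (r / 2) ^ (2 + α) := by positivity
  have sub : ∀ y ∈ ball x0 (r / 8), y ∈ ball x0 r ∧ r / 2 ≤ r - ‖y - x0‖ ∧ ‖y - x0‖ < r / 8 := by
    intro y hy
    have hy' := hy
    rw [mem_ball, dist_eq_norm] at hy'
    exact ⟨ball_subset_ball (by linarith) hy, by linarith, hy'⟩
  intro y hy
  obtain ⟨s1, s2, s3⟩ := sub y hy
  obtain ⟨b2, b1⟩ := bd y s1
  refine ⟨?_, ?_, ?_, ?_⟩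
  · rw [abs_of_nonneg (h7 y s1).1]; linarith [(h7 y s1).2]
  · have : ‖fderiv ℝ u y‖ ≤ C / (r / 2) := by
      rw [le_div_iff₀ (by positivity), mul_comm]
      exact le_trans (by gcongr) b1
    linarith
  · have : ‖D2 u y‖ ≤ C / (r / 2) ^ 2 := by
      rw [le_div_iff₀ (by positivity), mul_comm]
      exact le_trans (by gcongr) b2
    linarith
  · intro z hz
    obtain ⟨t1, t2, t3⟩ := sub z hz
    have hzy : ‖z - y‖ ≤ (r - ‖z - x0‖) / 2 := by
      have e : z - y = (z - x0) - (y - x0) := by abel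
      have := norm_sub_le (z - x0) (y - x0)
      rw [← e] at this
      linarith
    have h := pq z t1 y hzy
    have : ‖D2 u z - D2 u y‖ ≤ C / (r / 2) ^ (2 + α) * ‖z - y‖ ^ α := by
      rw [div_mul_eq_mul_div, le_div_iff₀ (by positivity), mul_comm]
      refine le_trans ?_ h
      gcongr
    refine this.trans ?_
    gcongr
    linarith

lemma entry_bd {A : Fin n → Fin n → ℝ} {lam Lam : ℝ} (hl : 0 < lam) (hL : lam ≤ Lam) (h : Ell A lam Lam) (i j : Fin n) :
    |A i j| ≤ n * Lam := by
  set H : ES n →L[ℝ] ES n →L[ℝ] ℝ := (innerSL ℝ (ee i : ES n)).smulRight (innerSL ℝ (ee j : ES n)) with hH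
  have e1 : tr A H = A i j := by
    have h0 : ∀ k l, H (ee k) (ee l) = (if k = i then 1 else 0) * (if l = j then 1 else 0) := by
      intro k l
      rw [hH, ContinuousLinearMap.smulRight_apply, ContinuousLinearMap.smul_apply, innerSL_apply_apply,
        innerSL_apply_apply, inner_ee, inner_ee, smul_eq_mul, ee_apply, ee_apply]
    simp [tr, h0, Finset.sum_ite_eq]
  have e2 : ‖H‖ ≤ 1 := by
    rw [hH, ContinuousLinearMap.norm_smulRight_apply, innerSL_apply_norm, innerSL_apply_norm, norm_ee, norm_ee, mul_one]
  have := abs_tr_ell hl h H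
  rw [e1] at this
  have L0 : 0 ≤ Lam := by linarith
  calc _ ≤ _ := this
    _ ≤ n * Lam * 1 := by gcongr
    _ = _ := mul_one _

lemma cut_holder {α B C K : ℝ} {Ω : Set (ES n)} {η f : ES n → ℝ} (η0 : ∀ x, 0 ≤ η x) (η1 : ∀ x, η x ≤ 1)
    (hη : ∀ x y, |η x - η y| ≤ K * ‖x - y‖ ^ α) (hz : ∀ x, x ∉ Ω → η x = 0) (hf : ∀ x, |f x| ≤ B)
    (hC : 0 ≤ C) (hh : ∀ x ∈ Ω, ∀ y ∈ Ω, |f x - f y| ≤ C * ‖x - y‖ ^ α) (x y : ES n) :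
    |η x * f x - η y * f y| ≤ (K * B + C) * ‖x - y‖ ^ α := by
  have hB : 0 ≤ B := (abs_nonneg _).trans (hf x)
  have e : η x * f x - η y * f y = (η x - η y) * f x + η y * (f x - f y) := by ring
  have e' : η x * f x - η y * f y = (η x - η y) * f y + η x * (f x - f y) := by ring
  have h1 : ∀ z, |(η x - η y) * f z| ≤ K * ‖x - y‖ ^ α * B := fun z => by
    rw [abs_mul]; exact mul_le_mul (hη x y) (hf z) (abs_nonneg _) ((abs_nonneg _).trans (hη x y))
  have h2 : 0 ≤ C * ‖x - y‖ ^ α := by positivity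
  by_cases hy : y ∈ Ω
  · by_cases hx : x ∈ Ω
    · rw [e]
      refine (abs_add_le _ _).trans ?_
      have h3 : |η y * (f x - f y)| ≤ 1 * (C * ‖x - y‖ ^ α) := by
        rw [abs_mul, abs_of_nonneg (η0 y)]
        exact mul_le_mul (η1 y) (hh x hx y hy) (abs_nonneg _) zero_le_one
      linarith [h1 x]
    · rw [e', hz x hx, zero_mul, add_zero, ← hz x hx]
      linarith [h1 y]
  · rw [e, hz y hy, zero_mul, add_zero, ← hz y hy]
    linarith [h1 x]

/-- hypotheses on the coefficients, relative to `Ω` -/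
structure Loc (α lam Lam A1 : ℝ) (Ω : Set (ES n)) (a : ES n → Fin n → Fin n → ℝ) (b : ES n → Fin n → ℝ)
    (c : ES n → ℝ) : Prop where
  ell : ∀ x, Ell (a x) lam Lam
  ha : ∀ x ∈ Ω, ∀ y ∈ Ω, ∀ i j, |a x i j - a y i j| ≤ A1 * ‖x - y‖ ^ α
  bb : ∀ x i, |b x i| ≤ A1
  hb : ∀ x ∈ Ω, ∀ y ∈ Ω, ∀ i, |b x i - b y i| ≤ A1 * ‖x - y‖ ^ α
  cl : ∀ x, 0 ≤ c x
  cu : ∀ x, c x ≤ A1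
  hc : ∀ x ∈ Ω, ∀ y ∈ Ω, |c x - c y| ≤ A1 * ‖x - y‖ ^ α

lemma Ell_lam {lam Lam : ℝ} (hl : 0 < lam) (hL : lam ≤ Lam) :
    Ell (n := n) (fun i j => lam * Iid i j) lam Lam := by
  have h := Ell_Iid (n := n) (le_refl 1) (le_refl 1)
  refine ⟨fun i j => by show lam * Iid i j = lam * Iid j i; rw [h.1 i j], fun ξ => ?_⟩
  have e : ∑ i, ∑ j, lam * Iid i j * ξ i * ξ j = lam * ∑ i, ∑ j, Iid i j * ξ i * ξ j := by
    simp only [Finset.mul_sum]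
    refine Finset.sum_congr rfl fun i _ => Finset.sum_congr rfl fun j _ => ?_
    ring
  have h2 := h.2 ξ
  have e2 : ∑ i, ∑ j, Iid i j * ξ i * ξ j = ‖ξ‖ ^ 2 := by linarith [h2.1, h2.2]
  rw [e, e2]
  exact ⟨le_rfl, by gcongr⟩

/-- approximate problem -/
theorem approx_k (hn : 0 < n) {α lam Lam A1 p : ℝ} (ha0 : 0 < α) (ha1 : α < 1)
    (hl : 0 < lam) (hL : lam ≤ Lam) (hp : 1 < p) {Ω : Set (ES n)} (hΩ : IsOpen Ω) (hne : (Ωᶜ).Nonempty)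
    {a : ES n → Fin n → Fin n → ℝ} {b : ES n → Fin n → ℝ} {c : ES n → ℝ}
    (h : Loc α lam Lam A1 Ω a b c) {N T : ℝ} (N1 : 1 ≤ N) (T0 : 0 ≤ T) :
    ∃ (a' : ES n → Fin n → Fin n → ℝ) (b' : ES n → Fin n → ℝ) (c' u f : ES n → ℝ),
      (∀ x, Ell (a' x) lam Lam ∧ (∀ i, |b' x i| ≤ A1) ∧ 1 / N ≤ c' x ∧ c' x ≤ A1 + 1) ∧
      (∃ Q, N2 α u Q) ∧ (∀ x, 0 ≤ u x) ∧ (∀ x, 0 ≤ f x) ∧ (∀ x, LL a' b' c' u x = u x ^ p - f x) ∧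
      (∀ x, infDist x Ωᶜ ≤ 1 / N → f x = T) ∧ (∀ x, 2 / N ≤ infDist x Ωᶜ → f x = 0) ∧
      (∀ x, 1 / N ≤ infDist x Ωᶜ → a' x = a x ∧ b' x = b x ∧ c' x = c x + 1 / N) := by
  have Np : 0 < N := by linarith
  have A1p : 0 ≤ A1 := (h.cl 0).trans (h.cu 0)
  have L0 : 0 ≤ Lam := by linarith
  set d : ES n → ℝ := fun x => infDist x Ωᶜ with hd
  have d0 : ∀ x, 0 ≤ d x := fun x => infDist_nonneg
  have dl : ∀ x y, |d x - d y| ≤ ‖x - y‖ := by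
    intro x y
    have h1 := infDist_le_infDist_add_dist (s := Ωᶜ) (x := x) (y := y)
    have h2 := infDist_le_infDist_add_dist (s := Ωᶜ) (x := y) (y := x)
    rw [dist_comm y x] at h2
    rw [dist_eq_norm] at h1 h2
    rw [abs_le]; constructor <;> simp only [hd] <;> linarith
  have dz : ∀ x, x ∉ Ω → d x = 0 := fun x hx => infDist_zero_of_mem hx
  set η : ES n → ℝ := fun x => min 1 (N * d x) with hη
  have η0 : ∀ x, 0 ≤ η x := fun x => le_min zero_le_one (mul_nonneg Np.le (d0 x))
  have η1 : ∀ x, η x ≤ 1 := fun x => min_le_left _ _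
  have ηz : ∀ x, x ∉ Ω → η x = 0 := fun x hx => by simp [hη, dz x hx]
  have ηo : ∀ x, 1 / N ≤ d x → η x = 1 := fun x hx => by
    have : 1 ≤ N * d x := by rw [div_le_iff₀ Np] at hx; linarith
    exact min_eq_left this
  have ηl : ∀ x y, |η x - η y| ≤ N * ‖x - y‖ := by
    intro x y
    have h1 := abs_min_sub_min_le_max 1 (N * d x) 1 (N * d y)
    rw [sub_self, abs_zero, max_eq_right (abs_nonneg _), ← mul_sub, abs_mul, abs_of_pos Np] at h1
    exact h1.trans (by gcongr; exact dl x y)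
  set K := 2 * 1 + |N| with hK
  have K0 : 0 ≤ K := by positivity
  have ηh : ∀ x y, |η x - η y| ≤ K * ‖x - y‖ ^ α := holder_of_lip (g := η) ha0 ha1
    (fun x => by rw [Real.norm_eq_abs, abs_of_nonneg (η0 x)]; exact η1 x) ηl
  set ψ : ES n → ℝ := fun x => max 0 (min 1 (2 - N * d x)) with hψ
  have ψ0 : ∀ x, 0 ≤ ψ x := fun x => le_max_left _ _
  have ψ1 : ∀ x, ψ x ≤ 1 := fun x => max_le zero_le_one (min_le_left _ _)
  have ψl : ∀ x y, |ψ x - ψ y| ≤ N * ‖x - y‖ := by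
    intro x y
    have h1 := abs_max_sub_max_le_max 0 (min 1 (2 - N * d x)) 0 (min 1 (2 - N * d y))
    have h2 := abs_min_sub_min_le_max 1 (2 - N * d x) 1 (2 - N * d y)
    have e : 2 - N * d x - (2 - N * d y) = - (N * (d x - d y)) := by ring
    rw [sub_self, abs_zero, max_eq_right (abs_nonneg (min 1 (2 - N * d x) - min 1 (2 - N * d y)))] at h1
    rw [sub_self, abs_zero, max_eq_right (abs_nonneg _), e, abs_neg, abs_mul, abs_of_pos Np] at h2
    exact (h1.trans h2).trans (by gcongr; exact dl x y)
  have ψN : N0 α ψ K := by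
    refine ⟨fun x => ?_, holder_of_lip (g := ψ) ha0 ha1
      (fun x => by rw [Real.norm_eq_abs, abs_of_nonneg (ψ0 x)]; exact ψ1 x) ψl⟩
    rw [abs_of_nonneg (ψ0 x)]
    have := ψ1 x; have := abs_nonneg N; linarith
  set a' : ES n → Fin n → Fin n → ℝ := fun x i j => (1 - η x) * (lam * Iid i j) + η x * a x i j with ha'
  set b' : ES n → Fin n → ℝ := fun x i => η x * b x i with hb'
  set c' : ES n → ℝ := fun x => η x * c x + 1 / N with hc'
  have N11 : 1 / N ≤ 1 := by rw [div_le_one Np]; exact N1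
  have N1p : 0 < 1 / N := by positivity
  have ea : ∀ x, Ell (a' x) lam Lam := fun x => (Ell_lam hl hL).mix (h.ell x) (η0 x) (η1 x)
  have eb : ∀ x i, |b' x i| ≤ A1 := by
    intro x i
    simp only [hb']
    rw [abs_mul, abs_of_nonneg (η0 x)]
    calc _ ≤ 1 * A1 := mul_le_mul (η1 x) (h.bb x i) (abs_nonneg _) zero_le_one
      _ = A1 := one_mul _
  have ec0 : ∀ x, 1 / N ≤ c' x := fun x => by
    have := mul_nonneg (η0 x) (h.cl x); simp only [hc']; linarith
  have ec1 : ∀ x, c' x ≤ A1 + 1 := fun x => by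
    have := mul_le_mul (η1 x) (h.cu x) (h.cl x) zero_le_one; simp only [hc']; linarith
  have cabs : ∀ x, |c x| ≤ A1 := fun x => by rw [abs_of_nonneg (h.cl x)]; exact h.cu x
  set AA := K * lam + (K * (n * Lam) + A1) + (K * A1 + A1) + (A1 + 1) with hAA
  have q1 : 0 ≤ K * lam := by positivity
  have q2 : 0 ≤ K * (n * Lam) + A1 := by positivity
  have q3 : 0 ≤ K * A1 + A1 := by positivity
  have cf : Cf α lam Lam AA (1 / N) a' b' c' := by
    refine ⟨ea, ?_, fun x i => (eb x i).trans (by linarith), ?_, ec0, ?_, ?_⟩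
    · intro x y i j
      have h1 := cut_holder η0 η1 ηh ηz (f := fun x => a x i j) (fun x => entry_bd hl hL (h.ell x) i j) A1p
        (fun x hx y hy => h.ha x hx y hy i j) x y
      have e : a' x i j - a' y i j = (η x * a x i j - η y * a y i j) - (η x - η y) * (lam * Iid i j) := by
        simp only [ha']; ring
      rw [e]
      have I1 : |lam * Iid i j| ≤ lam := by
        rw [abs_mul, abs_of_pos hl]
        have : |Iid i j| ≤ 1 := by unfold Iid; split_ifs <;> simp
        calc _ ≤ lam * 1 := by gcongr
          _ = lam := mul_one _
      have h2 : |(η x - η y) * (lam * Iid i j)| ≤ K * ‖x - y‖ ^ α * lam := by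
        rw [abs_mul]
        exact mul_le_mul (ηh x y) I1 (abs_nonneg _) ((abs_nonneg _).trans (ηh x y))
      refine (abs_sub _ _).trans ((add_le_add h1 h2).trans ?_)
      calc _ = (K * lam + (K * (n * Lam) + A1)) * ‖x - y‖ ^ α := by ring
        _ ≤ _ := by gcongr; linarith
    · intro x y i
      refine (cut_holder η0 η1 ηh ηz (f := fun x => b x i) (fun x => h.bb x i) A1p
        (fun x hx y hy => h.hb x hx y hy i) x y).trans ?_
      gcongr; linarith
    · intro x
      rw [abs_of_nonneg (N1p.le.trans (ec0 x))]
      exact (ec1 x).trans (by linarith)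
    · intro x y
      have e : c' x - c' y = η x * c x - η y * c y := by simp only [hc']; ring
      rw [e]
      refine (cut_holder η0 η1 ηh ηz (f := c) cabs A1p h.hc x y).trans ?_
      gcongr; linarith
  obtain ⟨u, hu, u0, heq⟩ := approx_solve hn ha0 ha1 hl hL N1p cf hp (ψN.smul T)
    (fun x => mul_nonneg T0 (ψ0 x))
  refine ⟨a', b', c', u, fun x => T * ψ x, fun x => ⟨ea x, eb x, ec0 x, ec1 x⟩, hu, u0,
    fun x => mul_nonneg T0 (ψ0 x), heq, ?_, ?_, ?_⟩
  · intro x hx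
    have : N * d x ≤ 1 := by rw [le_div_iff₀ Np] at hx; simp only [hd]; linarith
    have e : ψ x = 1 := by
      simp only [hψ]; rw [min_eq_left (by linarith), max_eq_right zero_le_one]
    simp only [e, mul_one]
  · intro x hx
    have : 2 ≤ N * d x := by rw [div_le_iff₀ Np] at hx; simp only [hd]; linarith
    have e : ψ x = 0 := by
      simp only [hψ]; rw [min_eq_right (by linarith), max_eq_left (by linarith)]
    simp only [e, mul_zero]
  · intro x hx
    have e := ηo x hx
    refine ⟨?_, ?_, ?_⟩
    · ext i j; simp only [ha', e]; ring
    · ext i; simp only [hb', e]; ring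
    · simp only [hc', e]; ring
end assembly

section mainproof
variable {n : ℕ}

lemma blow_num {s k0 lam q M0 δ0 : ℝ} (hs : 0 < s) (hk : 0 < k0) (hl : 0 < lam) (hδ : 0 < δ0) :
    ∃ δ > 0, δ ≤ δ0 ∧ ∀ t, 0 < t → t < δ → M0 ≤ k0 * (t ^ 2 / lam) ^ (-s) - q := by
  have h1 : Tendsto (fun t : ℝ => t ^ (-s)) (nhdsWithin 0 (Ioi 0)) atTop :=
    tendsto_rpow_neg_nhdsGT_zero (neg_neg_of_pos hs)
  have h2 : Tendsto (fun t : ℝ => t ^ 2 / lam) (nhdsWithin 0 (Ioi 0)) (nhdsWithin 0 (Ioi 0)) := by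
    refine tendsto_nhdsWithin_iff.mpr ⟨?_, ?_⟩
    · have : Continuous (fun t : ℝ => t ^ 2 / lam) := by fun_prop
      have h := this.tendsto 0
      simp only [ne_eq, OfNat.ofNat_ne_zero, not_false_eq_true, zero_pow, zero_div] at h
      exact h.mono_left nhdsWithin_le_nhds
    · filter_upwards [self_mem_nhdsWithin] with t ht
      have : 0 < t := ht
      show 0 < t ^ 2 / lam
      positivity
  have h3 := (h1.comp h2).eventually (eventually_ge_atTop ((M0 + q) / k0))
  rw [eventually_nhdsWithin_iff, Metric.eventually_nhds_iff] at h3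
  obtain ⟨ε, hε, h⟩ := h3
  refine ⟨min ε δ0, lt_min hε hδ, min_le_right _ _, fun t ht htt => ?_⟩
  have h4 := h (y := t) (by rw [dist_zero_right, Real.norm_eq_abs, abs_of_pos ht]; exact htt.trans_le (min_le_left _ _)) ht
  have h5 : (M0 + q) / k0 ≤ (t ^ 2 / lam) ^ (-s) := h4
  rw [div_le_iff₀ hk] at h5
  linarith

theorem main_core (hn : 0 < n) {α lam Lam A1 p : ℝ} (ha0 : 0 < α) (ha1 : α < 1)
    (hl : 0 < lam) (hL : lam ≤ Lam) (hp : 1 < p) (hγ : 0 < 4 * (1 / (p - 1) + 1) - 2 * (n : ℝ))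
    {Ω : Set (ES n)} (hΩ : IsOpen Ω) (hne : (Ωᶜ).Nonempty)
    {a : ES n → Fin n → Fin n → ℝ} {b : ES n → Fin n → ℝ} {c : ES n → ℝ}
    (h : Loc α lam Lam A1 Ω a b c) :
    ∃ v : ES n → ℝ, (∀ x ∈ Ω, ContDiffAt ℝ 2 v x ∧ 0 ≤ v x ∧ LL a b c v x = v x ^ p) ∧
      ∀ M0, ∃ δ > 0, ∀ x ∈ Ω, infDist x Ωᶜ < δ → M0 ≤ v x := by
  have A1p : 0 ≤ A1 := (h.cl 0).trans (h.cu 0)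
  have Lp : 0 < Lam := hl.trans_le hL
  have A0p : 0 ≤ A1 + 1 := by linarith
  have s0 : 0 < 1 / (p - 1) := by have : 0 < p - 1 := by linarith
                                  positivity
  have hcl : IsClosed Ωᶜ := hΩ.isClosed_compl
  have dpos : ∀ x ∈ Ω, 0 < infDist x Ωᶜ := fun x hx =>
    (hcl.notMem_iff_infDist_pos hne).mp (fun hh => hh hx)
  have dmem : ∀ x, 0 < infDist x Ωᶜ → x ∈ Ω := fun x hx => by
    by_contra hh
    have : infDist x Ωᶜ = 0 := infDist_zero_of_mem hh
    linarith
  obtain ⟨κ, κ0, θ, θ0, k0, k0p, R0, R0p, hlow⟩ := lower (n := n) hn hp hl hL A0p hγ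
  obtain ⟨r1, r1p, -, hr1⟩ := small_pow (s := α) (κ := κ / (A1 + 1)) ha0 (by positivity)
  have hr1' : A1 * r1 ^ α ≤ κ := by
    rw [le_div_iff₀ (by linarith)] at hr1
    have : 0 ≤ r1 ^ α := by positivity
    nlinarith
  set R := min R0 ((r1 / 2) ^ 2 / Lam) with hR
  have Rp : 0 < R := lt_min R0p (by positivity)
  have RL : Lam * R ≤ (r1 / 2) ^ 2 := by
    have : R ≤ (r1 / 2) ^ 2 / Lam := min_le_right _ _
    rw [le_div_iff₀ Lp] at this; linarith
  obtain ⟨Cb, Cb0, hlow⟩ := hlow R Rp (min_le_left _ _)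
  set N : ℕ → ℝ := fun k => k + 1 with hN
  have N1 : ∀ k, 1 ≤ N k := fun k => by simp [hN]
  have Np : ∀ k, 0 < N k := fun k => by linarith [N1 k]
  have Nt : Tendsto (fun k => 1 / N k) atTop (nhds 0) := tendsto_one_div_add_atTop_nhds_zero_nat
  set e : ℕ → ℝ := fun k => θ / Lam * (1 / N k) ^ 2 with he
  have e0 : ∀ k, 0 < e k := fun k => by have := Np k; positivity
  have et : Tendsto e atTop (nhds 0) := by
    have := (Nt.pow 2).const_mul (θ / Lam)
    rw [zero_pow two_ne_zero, mul_zero] at this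
    exact this
  have hk : ∀ k, _ := fun k => approx_k hn ha0 ha1 hl hL hp hΩ hne h (N1 k)
    (T := Cb * e k ^ (-(1 / (p - 1)) - 1)) (by have := e0 k; positivity)
  choose a' b' c' u f g1 g2 g3 g4 g5 g6 g7 g8 using hk
  have ucd : ∀ k, ContDiff ℝ 2 (u k) := fun k => by obtain ⟨Q, hQ⟩ := g2 k; exact hQ.cd
  -- equation near an interior point
  have heq : ∀ k x, 2 / N k ≤ infDist x Ωᶜ → LL a b (fun y => c y + 1 / N k) (u k) x = u k x ^ p := by
    intro k x hx
    have := Np k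
    have h1 : 1 / N k ≤ infDist x Ωᶜ := le_trans (by gcongr; norm_num) hx
    obtain ⟨i1, i2, i3⟩ := g8 k x h1
    have h5 := g5 k x
    rw [g7 k x hx, sub_zero] at h5
    rw [← h5]
    simp only [LL, i1, i2, i3]
  have ev : ∀ t, 0 < t → ∀ᶠ k in (UF : Filter ℕ), 2 / N k ≤ t := by
    intro t ht
    apply UF_le
    have h1 := Nt.eventually (gt_mem_nhds (half_pos ht))
    filter_upwards [h1] with k hk
    have e : 2 / N k = 2 * (1 / N k) := by ring
    rw [e]; linarith
  obtain ⟨KK, KK0, hKO⟩ := KO (n := n) hp hl hL A0p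
  obtain ⟨v, hv⟩ := compact_loc ha0 hΩ ucd (by
    intro x hx
    have hd := dpos x hx
    set r := min 1 (infDist x Ωᶜ / 4) with hr
    have rp : 0 < r := lt_min one_pos (by linarith)
    have rl : r ≤ 1 := min_le_left _ _
    have r4 : r ≤ infDist x Ωᶜ / 4 := min_le_right _ _
    have din : ∀ y ∈ ball x (2 * r), infDist x Ωᶜ / 2 ≤ infDist y Ωᶜ := by
      intro y hy
      have h1 := infDist_le_infDist_add_dist (s := Ωᶜ) (x := x) (y := y)
      rw [mem_ball, dist_comm] at hy
      linarith
    have din' : ∀ y ∈ ball x r, y ∈ ball x (2 * r) := fun y hy => ball_subset_ball (by linarith) hy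
    have oin : ∀ y ∈ ball x r, y ∈ Ω := fun y hy => dmem y (by linarith [din y (din' y hy)])
    set M := KK / (r ^ 2) ^ (2 / (p - 1)) with hM
    have M0 : 0 ≤ M := by positivity
    obtain ⟨C, hC⟩ := interior_est (n := n) hn ha0 ha1 hl hL A0p M0 hp rp rl
    refine ⟨r / 8, by positivity, C, ?_⟩
    filter_upwards [ev _ (half_pos hd)] with k hk
    have ck : ∀ y, 0 ≤ c y + 1 / N k ∧ c y + 1 / N k ≤ A1 + 1 := fun y => by
      have h1 := h.cl y
      have h2 := h.cu y
      have h3 := Np k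
      have h4 : 1 / N k ≤ 1 := by rw [div_le_one h3]; exact N1 k
      have h5 : 0 < 1 / N k := by positivity
      constructor <;> linarith
    have mono : ∀ y z : ES n, A1 * ‖y - z‖ ^ α ≤ (A1 + 1) * ‖y - z‖ ^ α := fun y z => by gcongr; linarith
    refine hC x a b (fun y => c y + 1 / N k) (u k) (fun y _ => h.ell y)
      (fun y hy z hz i j => (h.ha y (oin y hy) z (oin z hz) i j).trans (mono y z))
      (fun y _ i => (h.bb y i).trans (by linarith))
      (fun y hy z hz i => (h.hb y (oin y hy) z (oin z hz) i).trans (mono y z))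
      (fun y _ => by rw [abs_of_nonneg (ck y).1]; exact (ck y).2)
      (fun y hy z hz => by
        rw [add_sub_add_right_eq_sub]
        exact (h.hc y (oin y hy) z (oin z hz)).trans (mono y z))
      (g2 k) (fun y hy => ⟨g3 k y, ?_⟩) (fun y hy => heq k y (hk.trans (din y (din' y hy))))
    have := hKO y r a b (fun y => c y + 1 / N k) (u k) rp rl (ucd k) (g3 k) (fun z hz =>
      ⟨h.ell z, fun i => (h.bb z i).trans (by linarith), (ck z).1, heq k z (hk.trans (din z (by
        rw [mem_ball] at hy hz ⊢
        linarith [dist_triangle z y x])))⟩)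
    rw [hM, le_div_iff₀ (by positivity)]
    linarith)
  refine ⟨v, fun x hx => ⟨(hv x hx).1, ge_of_tendsto (hv x hx).2.1 (Eventually.of_forall fun k => g3 k x), ?_⟩, ?_⟩
  · have l1 := LL_lim (a := a) (b := b) (c := c) (hv x hx).2
    have l2 : Tendsto (fun k => u k x ^ p + 1 / N k * u k x) UF (nhds (v x ^ p + 0 * v x)) :=
      ((hv x hx).2.1.rpow_const (Or.inr (by linarith))).add ((Nt.mono_left UF_le).mul (hv x hx).2.1)
    rw [zero_mul, add_zero] at l2
    refine tendsto_nhds_unique l1 (l2.congr' ?_)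
    filter_upwards [ev _ (dpos x hx)] with k hk
    rw [← heq k x hk]
    simp only [LL]; ring
  · intro M0
    obtain ⟨δ, δ0, δ1, hδ⟩ := blow_num (M0 := M0) (q := k0 * R ^ (-(1 / (p - 1)))) s0 k0p hl (half_pos r1p)
    refine ⟨δ, δ0, fun x hx hxd => (hδ _ (dpos x hx) hxd).trans ?_⟩
    obtain ⟨x0, hx0, hxx⟩ := hcl.exists_infDist_eq_dist hne x
    have dd : ‖x - x0‖ = infDist x Ωᶜ := by rw [hxx, dist_eq_norm]
    have lowk : ∀ k, k0 * (e k + infDist x Ωᶜ ^ 2 / lam) ^ (-(1 / (p - 1))) - k0 * R ^ (-(1 / (p - 1))) ≤ u k x := by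
      intro k
      have Nk := Np k
      have := hlow (a' k) (b' k) (c' k) (u k) (f k) x0 (a x) (1 / N k) (e k) (by positivity) (e0 k)
        (fun y => ⟨(g1 k y).1, fun i => ((g1 k y).2.1 i).trans (by linarith), (g1 k y).2.2⟩) (h.ell x) (ucd k) (g3 k)
        (g5 k) (fun y hy => by
          rcases le_total (infDist y Ωᶜ) (1 / N k) with hd | hd
          · right; rw [g6 k y hd]
          · left
            have N1' : 0 < 1 / N k := by positivity
            have hyO : y ∈ Ω := dmem y (N1'.trans_le hd)
            have hyx : 1 / N k ≤ ‖y - x0‖ := by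
              rw [← dist_eq_norm]; exact hd.trans (infDist_le_dist_of_mem hx0)
            refine ⟨?_, fun i j => ?_, g4 k y⟩
            · calc e k * Lam = θ * (1 / N k) ^ 2 := by simp only [he]; field_simp
                _ ≤ _ := by gcongr
            · rw [(g8 k y hd).1]
              refine (h.ha y hyO x hx i j).trans (le_trans ?_ hr1')
              have t1 : ‖y - x0‖ ≤ r1 / 2 := by
                have := hy.trans RL
                exact le_of_sq_le_sq this (by positivity)
              have t2 : ‖y - x‖ ≤ ‖y - x0‖ + ‖x - x0‖ := by
                have := norm_sub_le (y - x0) (x - x0)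
                rwa [sub_sub_sub_cancel_right] at this
              have t3 : ‖y - x‖ ≤ r1 := by rw [dd] at t2; linarith
              gcongr) x
      rwa [dd] at this
    have dp := dpos x hx
    have lt : Tendsto (fun k => k0 * (e k + infDist x Ωᶜ ^ 2 / lam) ^ (-(1 / (p - 1))) - k0 * R ^ (-(1 / (p - 1))))
        UF (nhds (k0 * (0 + infDist x Ωᶜ ^ 2 / lam) ^ (-(1 / (p - 1))) - k0 * R ^ (-(1 / (p - 1))))) := by
      refine Tendsto.sub_const (Tendsto.const_mul _ (Tendsto.rpow_const ((et.mono_left UF_le).add_const _) (Or.inl ?_))) _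
      have : 0 < infDist x Ωᶜ ^ 2 / lam := by positivity
      linarith
    rw [zero_add] at lt
    exact le_of_tendsto_of_tendsto' lt (hv x hx).2.1 lowk
end mainproof

/-- (Theorem 3.5 ii) of the paper). Suppose `p ∈ (1,∞)` if `n = 2`
and `p ∈ (1, n/(n-2))` if `n ≥ 3`, and the coefficients `aⁱʲ, bⁱ, c` of `L` are
Hölder continuous on `Ω` with exponent `β ∈ (0,1)`. Then the boundary blow-up
problem `Lu = u₊^p`, `u → +∞` at `∂Ω`, has at least one `C²(Ω)` solution. -/
theorem existence_holder_coeffs {n : ℕ} (hn : 2 ≤ n)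
    (Ω : Set (EuclideanSpace ℝ (Fin n)))
    (hΩo : IsOpen Ω) (hΩc : IsConnected Ω) (hΩb : IsBounded Ω)
    (a : EuclideanSpace ℝ (Fin n) → Fin n → Fin n → ℝ)
    (b : EuclideanSpace ℝ (Fin n) → Fin n → ℝ)
    (c : EuclideanSpace ℝ (Fin n) → ℝ)
    (K lam Lam : ℝ) (hco : CoeffsOK a b c K lam Lam)
    (β : NNReal) (hβ0 : 0 < β) (hβ1 : (β : ℝ) < 1)
    (hholda : ∀ i j, ∃ C : NNReal, HolderOnWith C β (fun x => a x i j) Ω)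
    (hholdb : ∀ i, ∃ C : NNReal, HolderOnWith C β (fun x => b x i) Ω)
    (hholdc : ∃ C : NNReal, HolderOnWith C β c Ω)
    (p : ℝ) (hp : 1 < p) (hp2 : 3 ≤ n → p < (n : ℝ) / ((n : ℝ) - 2)) :
    ∃ u : EuclideanSpace ℝ (Fin n) → ℝ, ContDiffOn ℝ 2 u Ω ∧
      (∀ x ∈ Ω, Lop a b c u x = (max (u x) 0) ^ p) ∧ BlowsUp Ω u := by
  obtain ⟨-, -, -, hsym, hbK, hcK, hK, hl, hL, hell⟩ := hco
  have hn0 : 0 < n := by omega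
  haveI : Nonempty (Fin n) := ⟨⟨0, hn0⟩⟩
  have hα0 : (0 : ℝ) < (β : ℝ) := by exact_mod_cast hβ0
  choose Ca hCa using hholda
  choose Cb hCb using hholdb
  obtain ⟨Cc, hCc⟩ := hholdc
  set Sa : ℝ := ∑ i, ∑ j, (Ca i j : ℝ) with hSa
  set Sb : ℝ := ∑ i, (Cb i : ℝ) with hSb
  have Sa0 : 0 ≤ Sa := Finset.sum_nonneg fun i _ => Finset.sum_nonneg fun j _ => (Ca i j).2
  have Sb0 : 0 ≤ Sb := Finset.sum_nonneg fun i _ => (Cb i).2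
  have Cc0 : (0 : ℝ) ≤ Cc := Cc.2
  have Sa1 : ∀ i j, (Ca i j : ℝ) ≤ Sa := fun i j =>
    (Finset.single_le_sum (f := fun j => (Ca i j : ℝ)) (fun j _ => (Ca i j).2) (Finset.mem_univ j)).trans
      (Finset.single_le_sum (f := fun i => ∑ j, (Ca i j : ℝ))
        (fun i _ => Finset.sum_nonneg fun j _ => (Ca i j).2) (Finset.mem_univ i))
  have Sb1 : ∀ i, (Cb i : ℝ) ≤ Sb := fun i =>
    Finset.single_le_sum (f := fun i => (Cb i : ℝ)) (fun j _ => (Cb j).2) (Finset.mem_univ i)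
  have hold : ∀ (C : NNReal) (g : ES n → ℝ) (B : ℝ), HolderOnWith C β g Ω → (C : ℝ) ≤ B → ∀ x ∈ Ω, ∀ y ∈ Ω,
      |g x - g y| ≤ B * ‖x - y‖ ^ (β : ℝ) := by
    intro C g B hg hCB x hx y hy
    have h1 := hg.dist_le hx hy
    rw [Real.dist_eq, dist_eq_norm] at h1
    exact h1.trans (by gcongr)
  have hloc : Loc (β : ℝ) lam Lam (Sa + Sb + Cc + K + 1) Ω a b c := by
    refine ⟨fun x => ⟨hsym x, hell x⟩, fun x hx y hy i j => ?_, fun x i => ?_, fun x hx y hy i => ?_,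
      fun x => (hcK x).1, fun x => by linarith [(hcK x).2], ?_⟩
    · exact hold _ (fun x => a x i j) _ (hCa i j) (by linarith [Sa1 i j]) x hx y hy
    · have h1 : (b x i) ^ 2 ≤ K :=
        (Finset.single_le_sum (f := fun i => (b x i) ^ 2) (fun j _ => sq_nonneg _) (Finset.mem_univ i)).trans (hbK x)
      have h2 : |b x i| ≤ K + 1 := by
        rw [← sq_abs] at h1
        nlinarith [sq_nonneg (|b x i| - 1), abs_nonneg (b x i)]
      linarith
    · exact hold _ (fun x => b x i) _ (hCb i) (by linarith [Sb1 i]) x hx y hy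
    · exact hold _ c _ hCc (by linarith)
  have hΩu : Ω ≠ univ := by
    intro hu
    rw [hu] at hΩb
    exact NormedSpace.unbounded_univ ℝ (ES n) hΩb
  have hne : (Ωᶜ).Nonempty := nonempty_compl.mpr hΩu
  have hγ : 0 < 4 * (1 / (p - 1) + 1) - 2 * (n : ℝ) := by
    have hp1 : 0 < p - 1 := by linarith
    rcases Nat.lt_or_ge n 3 with h3 | h3
    · have : n = 2 := by omega
      have h2 : (n : ℝ) = 2 := by rw [this]; norm_num
      rw [h2]
      have : 0 < 1 / (p - 1) := by positivity
      linarith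
    · have h2 := hp2 h3
      have h4 : (3 : ℝ) ≤ n := by exact_mod_cast h3
      rw [lt_div_iff₀ (by linarith)] at h2
      have h5 : ((n : ℝ) - 2) / 2 < 1 / (p - 1) := by
        rw [lt_div_iff₀ hp1]; linarith
      linarith
  obtain ⟨v, hv, hblow⟩ := main_core hn0 hα0 hβ1 hl hL hp hγ hΩo hne hloc
  refine ⟨v, fun x hx => (hv x hx).1.contDiffWithinAt, fun x hx => ?_, fun M => ?_⟩
  · obtain ⟨h1, h2, h3⟩ := hv x hx
    rw [max_eq_left h2, ← h3, Lop_eq h1]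
    rfl
  · obtain ⟨δ, δ0, hδ⟩ := hblow M
    refine ⟨δ, δ0, fun x hx hxd => hδ x hx (lt_of_le_of_lt ?_ hxd)⟩
    have hsub : frontier Ω ⊆ Ωᶜ := fun y hy hyΩ => by
      rw [hΩo.frontier_eq] at hy
      exact hy.2 hyΩ
    exact infDist_le_infDist_of_subset hsub (nonempty_frontier_iff.mpr ⟨hΩc.nonempty, hΩu⟩)
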